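/- There exists a ≥ 1 such that the following holds. For every x ∈ (0, 1/2) and every graph G with no copy of the complement of P5, either: (1) G has an x-restricted induced subgraph with at least x^a·|G| vertices; or (2) there is a complete or anticomplete (k, |G|/k^a)-blockade in G, for some real k with 2 ≤ k ≤ 1/x. -/

import Mathlib

open Finset
open scoped Classical

/-- A copy of `H` in `G`: an injective map preserving adjacency and non-adjacency. -/
def IsCopy {W V : Type*} (H : SimpleGraph W) (G : SimpleGraph V) (f : W → V) : Prop :=
  Function.Injective f ∧ ∀ u v : W, H.Adj u v ↔ G.Adj (f u) (f v)

/-- `G` is `H`-free: there is no copy of `H` in `G`. -/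
def Free {W V : Type*} (H : SimpleGraph W) (G : SimpleGraph V) : Prop :=
  ¬ ∃ f : W → V, IsCopy H G f

/-- The path on five vertices. -/
def P5 : SimpleGraph (Fin 5) := SimpleGraph.pathGraph 5

/-- The neighbours of `v` inside the finite set `A`. -/
noncomputable def nbrsIn {V : Type*} (G : SimpleGraph V) (v : V) (A : Finset V) : Finset V :=
  A.filter (fun u => G.Adj v u)

/-- `G` is `x`-sparse: every vertex has degree at most `x * |G|`. -/
def Sparse {V : Type*} [Fintype V] (G : SimpleGraph V) (x : ℝ) : Prop :=
  ∀ v : V, ((nbrsIn G v Finset.univ).card : ℝ) ≤ x * (Fintype.card V : ℝ)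

/-- `G` is `x`-restricted: `G` or its complement is `x`-sparse. -/
def Restricted {V : Type*} [Fintype V] (G : SimpleGraph V) (x : ℝ) : Prop :=
  Sparse G x ∨ Sparse Gᶜ x

/-- The induced subgraph `G[S]` is `x`-sparse. -/
def SparseOn {V : Type*} (G : SimpleGraph V) (S : Finset V) (x : ℝ) : Prop :=
  ∀ v ∈ S, ((nbrsIn G v S).card : ℝ) ≤ x * (S.card : ℝ)

/-- The induced subgraph `G[S]` is `x`-restricted: it or its complement is `x`-sparse. -/
def RestrictedOn {V : Type*} (G : SimpleGraph V) (S : Finset V) (x : ℝ) : Prop :=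
  SparseOn G S x ∨ SparseOn Gᶜ S x

/-- `(A, B)` is complete in `G`. -/
def CompletePair {V : Type*} (G : SimpleGraph V) (A B : Finset V) : Prop :=
  ∀ a ∈ A, ∀ b ∈ B, G.Adj a b

/-- `(A, B)` is anticomplete in `G`. -/
def AnticompletePair {V : Type*} (G : SimpleGraph V) (A B : Finset V) : Prop :=
  ∀ a ∈ A, ∀ b ∈ B, ¬ G.Adj a b

/-- `B` is `x`-sparse to `A` in `G`: every vertex of `B` has at most `x * |A|` neighbours in `A`. -/
def SparseTo {V : Type*} (G : SimpleGraph V) (x : ℝ) (A B : Finset V) : Prop :=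
  ∀ v ∈ B, ((nbrsIn G v A).card : ℝ) ≤ x * (A.card : ℝ)

/-- The number of edges of `G` between `A` and `B`. -/
noncomputable def edgesBetween {V : Type*} (G : SimpleGraph V) (A B : Finset V) : ℕ :=
  ((A ×ˢ B).filter (fun p => G.Adj p.1 p.2)).card

/-- `(A, B)` is weakly `x`-sparse in `G`. -/
def WeaklySparse {V : Type*} (G : SimpleGraph V) (x : ℝ) (A B : Finset V) : Prop :=
  (edgesBetween G A B : ℝ) ≤ x * (A.card : ℝ) * (B.card : ℝ)

/-- A blockade: a sequence of pairwise disjoint vertex subsets. -/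
def IsBlockade {V : Type*} {n : ℕ} (B : Fin n → Finset V) : Prop :=
  ∀ i j : Fin n, i ≠ j → Disjoint (B i) (B j)

/-- A pure blockade: every pair of distinct blocks is complete or anticomplete. -/
def PureBlockade {V : Type*} (G : SimpleGraph V) {n : ℕ} (B : Fin n → Finset V) : Prop :=
  ∀ i j : Fin n, i ≠ j → CompletePair G (B i) (B j) ∨ AnticompletePair G (B i) (B j)

/-- A complete blockade. -/
def CompleteBlockade {V : Type*} (G : SimpleGraph V) {n : ℕ} (B : Fin n → Finset V) : Prop :=
  ∀ i j : Fin n, i ≠ j → CompletePair G (B i) (B j)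

/-- An anticomplete blockade. -/
def AnticompleteBlockade {V : Type*} (G : SimpleGraph V) {n : ℕ} (B : Fin n → Finset V) : Prop :=
  ∀ i j : Fin n, i ≠ j → AnticompletePair G (B i) (B j)

/-- An `x`-sparse blockade: `B j` is `x`-sparse to `B i` whenever `i < j`. -/
def SparseBlockade {V : Type*} (G : SimpleGraph V) (x : ℝ) {n : ℕ} (B : Fin n → Finset V) : Prop :=
  ∀ i j : Fin n, i < j → SparseTo G x (B i) (B j)

/-- A comb: a blockade `Bl` together with distinct apexes `a i`, outside all blocks, such that
`a i` is adjacent to all of `Bl i` and nonadjacent to all of `Bl j` for `j ≠ i`. -/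
def IsComb {V : Type*} (G : SimpleGraph V) {k : ℕ} (a : Fin k → V) (Bl : Fin k → Finset V) :
    Prop :=
  IsBlockade Bl ∧ Function.Injective a ∧ (∀ i j : Fin k, a i ∉ Bl j) ∧
  (∀ i : Fin k, ∀ v ∈ Bl i, G.Adj (a i) v) ∧
  (∀ i j : Fin k, i ≠ j → ∀ v ∈ Bl j, ¬ G.Adj (a i) v)

noncomputable section

variable {V : Type*} [Fintype V]

/-- The bilinear form on weight functions with kernel `k`. -/
def bil (k : V → V → ℝ) : (V → ℝ) →ₗ[ℝ] (V → ℝ) →ₗ[ℝ] ℝ :=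
  LinearMap.mk₂ ℝ (fun μ ν => ∑ u, ∑ v, μ u * ν v * k u v)
    (by intro a b c; simp only [Pi.add_apply, add_mul, Finset.sum_add_distrib])
    (by intro r a b; simp only [Pi.smul_apply, smul_eq_mul, Finset.mul_sum, mul_assoc])
    (by intro a b c; simp only [Pi.add_apply, mul_add, add_mul, Finset.sum_add_distrib])
    (by
      intro r a b
      simp only [Pi.smul_apply, smul_eq_mul, Finset.mul_sum]
      refine Finset.sum_congr rfl fun u _ => Finset.sum_congr rfl fun v _ => by ring)

theorem bil_apply (k : V → V → ℝ) (μ ν : V → ℝ) :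
    bil k μ ν = ∑ u, ∑ v, μ u * ν v * k u v := rfl

/-- The adjacency kernel of `H`, with value `s` on the diagonal. -/
def kern (H : SimpleGraph V) (s : ℝ) (u v : V) : ℝ :=
  (if H.Adj u v then 1 else 0) + (if u = v then s else 0)

/-- `μ` is a probability weight supported on `L`. -/
structure ProbOn (L : Finset V) (μ : V → ℝ) : Prop where
  nonneg : ∀ v, 0 ≤ μ v
  supp : ∀ v, v ∉ L → μ v = 0
  sum_eq : ∑ v, μ v = 1

/-- The total weight of the neighbours of `w`. -/
def wdeg (H : SimpleGraph V) (μ : V → ℝ) (w : V) : ℝ := ∑ u, if H.Adj w u then μ u else 0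

theorem kern_symm {V : Type*} (H : SimpleGraph V) (s : ℝ) (u v : V) : kern H s u v = kern H s v u := by
  simp only [kern, H.adj_comm u v, eq_comm (a := u)]

theorem kern_nonneg {V : Type*} (H : SimpleGraph V) {s : ℝ} (hs : 0 ≤ s) (u v : V) :
    0 ≤ kern H s u v := by
  unfold kern; positivity

theorem bil_comm {k : V → V → ℝ} (hk : ∀ u v, k u v = k v u) (μ ν : V → ℝ) :
    bil k μ ν = bil k ν μ := by
  rw [bil_apply, bil_apply, Finset.sum_comm]
  refine Finset.sum_congr rfl fun u _ => Finset.sum_congr rfl fun v _ => by rw [hk]; ring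

theorem bil_nonneg {k : V → V → ℝ} (hk : ∀ u v, 0 ≤ k u v) {μ ν : V → ℝ} (hμ : ∀ v, 0 ≤ μ v)
    (hν : ∀ v, 0 ≤ ν v) : 0 ≤ bil k μ ν := by
  rw [bil_apply]
  exact Finset.sum_nonneg fun u _ => Finset.sum_nonneg fun v _ =>
    mul_nonneg (mul_nonneg (hμ u) (hν v)) (hk u v)

theorem ProbOn.mono {L M : Finset V} {μ : V → ℝ} (h : ProbOn L μ) (hLM : L ⊆ M) : ProbOn M μ :=
  ⟨h.nonneg, fun v hv => h.supp v fun h' => hv (hLM h'), h.sum_eq⟩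

theorem ProbOn.sum_on {L : Finset V} {μ : V → ℝ} (h : ProbOn L μ) : ∑ v ∈ L, μ v = 1 := by
  rw [← h.sum_eq]
  exact Finset.sum_subset (Finset.subset_univ L) fun v _ hv => h.supp v hv

theorem ProbOn.nonempty {L : Finset V} {μ : V → ℝ} (h : ProbOn L μ) : L.Nonempty := by
  by_contra hL
  rw [Finset.not_nonempty_iff_eq_empty] at hL
  have := h.sum_on
  simp [hL] at this

theorem ProbOn.le_one {L : Finset V} {μ : V → ℝ} (h : ProbOn L μ) (v : V) : μ v ≤ 1 := by
  rw [← h.sum_eq]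
  exact Finset.single_le_sum (fun u _ => h.nonneg u) (Finset.mem_univ v)

/-- A weighted average of costs over a probability weight is at least some cost. -/
theorem ProbOn.exists_le {L : Finset V} {μ : V → ℝ} (h : ProbOn L μ) (g : V → ℝ) :
    ∃ u ∈ L, g u ≤ ∑ v, μ v * g v := by
  by_contra! hc
  obtain ⟨u, hu⟩ : ∃ u, 0 < μ u := by
    by_contra! h0
    have : ∑ v, μ v ≤ 0 := Finset.sum_nonpos fun v _ => h0 v
    rw [h.sum_eq] at this
    linarith
  have huL : u ∈ L := by
    by_contra hL
    rw [h.supp u hL] at hu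
    exact lt_irrefl _ hu
  have : ∑ v, μ v * (∑ w, μ w * g w) < ∑ v, μ v * g v := by
    refine Finset.sum_lt_sum (fun v _ => ?_) ⟨u, Finset.mem_univ u, ?_⟩
    · by_cases hv : v ∈ L
      · exact mul_le_mul_of_nonneg_left (hc v hv).le (h.nonneg v)
      · simp [h.supp v hv]
    · exact mul_lt_mul_of_pos_left (hc u huL) hu
  rw [← Finset.sum_mul, h.sum_eq, one_mul] at this
  exact lt_irrefl _ this

theorem exists_minimizer (k : V → V → ℝ) {L : Finset V} (hL : ∃ μ, ProbOn L μ) :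
    ∃ μ, ProbOn L μ ∧ ∀ ν, ProbOn L ν → bil k μ μ ≤ bil k ν ν := by
  have hset : IsCompact {μ : V → ℝ | ProbOn L μ} := by
    refine IsCompact.of_isClosed_subset
      (isCompact_univ_pi (fun _ : V => isCompact_Icc (a := (0:ℝ)) (b := 1))) ?_ ?_
    · have : {μ : V → ℝ | ProbOn L μ} =
          (⋂ v, {μ | 0 ≤ μ v}) ∩ ((⋂ v, ⋂ (_ : v ∉ L), {μ | μ v = 0}) ∩ {μ | ∑ v, μ v = 1}) := by
        ext μ
        simp only [Set.mem_ofPred_eq, Set.mem_inter_iff, Set.mem_iInter]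
        exact ⟨fun h => ⟨h.nonneg, h.supp, h.sum_eq⟩, fun h => ⟨h.1, h.2.1, h.2.2⟩⟩
      rw [this]
      refine IsClosed.inter (isClosed_iInter fun v => ?_) (IsClosed.inter
        (isClosed_iInter fun v => isClosed_iInter fun _ => ?_) ?_)
      · exact isClosed_le continuous_const (continuous_apply v)
      · exact isClosed_eq (continuous_apply v) continuous_const
      · exact isClosed_eq (by fun_prop) continuous_const
    · intro μ hμ v _
      exact ⟨hμ.nonneg v, hμ.le_one v⟩
  have hcont : Continuous fun μ : V → ℝ => bil k μ μ := by
    simp only [bil_apply]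
    fun_prop
  obtain ⟨μ, hμ, hmin⟩ := hset.exists_isMinOn hL hcont.continuousOn
  exact ⟨μ, hμ, fun ν hν => hmin hν⟩

/-- The uniform probability weight on `X`. -/
def unif (X : Finset V) (v : V) : ℝ := if v ∈ X then (1 : ℝ) / X.card else 0

theorem unif_probOn {X : Finset V} (hX : X.Nonempty) : ProbOn X (unif X) := by
  have hc : (X.card : ℝ) ≠ 0 := by exact_mod_cast hX.card_pos.ne'
  refine ⟨fun v => by unfold unif; positivity, fun v hv => by simp [unif, hv], ?_⟩
  simp [unif, Finset.sum_ite_mem, hc]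

theorem sum_unif_mul (X : Finset V) (g : V → ℝ) :
    ∑ v, unif X v * g v = (∑ v ∈ X, g v) / X.card := by
  simp only [unif, ite_mul, zero_mul, Finset.sum_ite_mem, Finset.univ_inter, Finset.sum_div]
  exact Finset.sum_congr rfl fun v _ => by ring

theorem sum_kern {V : Type*} (H : SimpleGraph V) (s : ℝ) (X : Finset V) {u : V} (hu : u ∈ X) :
    ∑ v ∈ X, kern H s u v = (nbrsIn H u X).card + s := by
  simp only [kern, Finset.sum_add_distrib, Finset.sum_boole, nbrsIn]
  simp [hu]

theorem bil_unif (k : V → V → ℝ) (X : Finset V) :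
    bil k (unif X) (unif X) = (∑ u ∈ X, ∑ v ∈ X, k u v) / (X.card : ℝ) ^ 2 := by
  rw [bil_apply]
  have : ∀ u, ∑ v, unif X u * unif X v * k u v = unif X u * ((∑ v ∈ X, k u v) / X.card) := by
    intro u
    rw [← sum_unif_mul, Finset.mul_sum]
    exact Finset.sum_congr rfl fun v _ => by ring
  simp only [this]
  rw [sum_unif_mul, ← Finset.sum_div, div_div, sq]

theorem bil_unif_le (H : SimpleGraph V) {s d : ℝ} {X : Finset V} (hX : X.Nonempty)
    (hd : ∀ u ∈ X, ((nbrsIn H u X).card : ℝ) ≤ d) :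
    bil (kern H s) (unif X) (unif X) ≤ (d + s) / X.card := by
  have hc : (0 : ℝ) < X.card := by exact_mod_cast hX.card_pos
  rw [bil_unif, sq, ← div_div, div_le_div_iff_of_pos_right hc, div_le_iff₀ hc]
  calc ∑ u ∈ X, ∑ v ∈ X, kern H s u v ≤ ∑ u ∈ X, (d + s) := by
        refine Finset.sum_le_sum fun u hu => ?_
        rw [sum_kern H s X hu]
        linarith [hd u hu]
    _ = (d + s) * X.card := by rw [Finset.sum_const, nsmul_eq_mul, mul_comm]

/-- Weights on anticomplete disjoint sets do not interact. -/
theorem bil_eq_zero {H : SimpleGraph V} {s : ℝ} {A B : Finset V} {μ ν : V → ℝ}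
    (hμ : ∀ v, v ∉ A → μ v = 0) (hν : ∀ v, v ∉ B → ν v = 0)
    (hdis : Disjoint A B) (hanti : AnticompletePair H A B) : bil (kern H s) μ ν = 0 := by
  rw [bil_apply]
  refine Finset.sum_eq_zero fun u _ => Finset.sum_eq_zero fun v _ => ?_
  by_cases hu : u ∈ A
  · by_cases hv : v ∈ B
    · have h1 : u ≠ v := fun h => Finset.disjoint_left.1 hdis hu (h ▸ hv)
      simp [kern, hanti u hu v hv, h1]
    · simp [hν v hv]
  · simp [hμ u hu]

/-- Optimal mixing of weights on pairwise anticomplete disjoint sets. -/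
theorem exists_mix_family {H : SimpleGraph V} {s : ℝ} {F : Finset (Finset V)} (hF : F.Nonempty)
    (hdis : ∀ A ∈ F, ∀ B ∈ F, A ≠ B → Disjoint A B)
    (hanti : ∀ A ∈ F, ∀ B ∈ F, A ≠ B → AnticompletePair H A B)
    {f : Finset V → V → ℝ} (hf : ∀ A ∈ F, ProbOn A (f A))
    (hpos : ∀ A ∈ F, 0 < bil (kern H s) (f A) (f A)) :
    ∃ μ, ProbOn (F.biUnion id) μ ∧
      bil (kern H s) μ μ * ∑ A ∈ F, 1 / bil (kern H s) (f A) (f A) = 1 := by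
  set q : Finset V → ℝ := fun A => bil (kern H s) (f A) (f A) with hq
  set S : ℝ := ∑ A ∈ F, 1 / q A with hS
  have hSpos : 0 < S := Finset.sum_pos (fun A hA => one_div_pos.2 (hpos A hA)) hF
  set c : Finset V → ℝ := fun A => 1 / (q A * S) with hc
  have hcsum : ∑ A ∈ F, c A = 1 := by
    have : ∀ A ∈ F, c A = (1 / q A) / S := fun A _ => by
      simp only [hc]; rw [div_div]
    rw [Finset.sum_congr rfl this, ← Finset.sum_div, ← hS, div_self hSpos.ne']
  refine ⟨∑ A ∈ F, c A • f A, ⟨?_, ?_, ?_⟩, ?_⟩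
  · intro v
    simp only [Finset.sum_apply, Pi.smul_apply, smul_eq_mul]
    exact Finset.sum_nonneg fun A hA => mul_nonneg
      (one_div_nonneg.2 (mul_pos (hpos A hA) hSpos).le) ((hf A hA).nonneg v)
  · intro v hv
    simp only [Finset.sum_apply, Pi.smul_apply, smul_eq_mul]
    refine Finset.sum_eq_zero fun A hA => ?_
    rw [(hf A hA).supp v, mul_zero]
    exact fun h => hv (Finset.mem_biUnion.2 ⟨A, hA, h⟩)
  · simp only [Finset.sum_apply, Pi.smul_apply, smul_eq_mul]
    rw [Finset.sum_comm, ← hcsum]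
    refine Finset.sum_congr rfl fun A hA => ?_
    rw [← Finset.mul_sum, (hf A hA).sum_eq, mul_one]
  · have : bil (kern H s) (∑ A ∈ F, c A • f A) (∑ A ∈ F, c A • f A) = 1 / S := by
      simp only [map_sum, LinearMap.sum_apply, map_smul, LinearMap.smul_apply, smul_eq_mul]
      have h1 : ∀ A ∈ F, ∑ B ∈ F, c A * (c B * bil (kern H s) (f B) (f A)) = c A / S := by
        intro A hA
        rw [Finset.sum_eq_single A]
        · have := (hpos A hA).ne'
          simp only [hc, hq]
          field_simp
        · intro B hB hBA
          rw [bil_eq_zero (hf B hB).supp (hf A hA).supp (hdis B hB A hA hBA)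
            (hanti B hB A hA hBA)]
          ring
        · exact fun h => absurd hA h
      rw [show (∑ A ∈ F, c A * ∑ B ∈ F, c B * bil (kern H s) (f B) (f A)) = ∑ A ∈ F, c A / S from
        Finset.sum_congr rfl fun A hA => by rw [← h1 A hA, Finset.mul_sum], ← Finset.sum_div, hcsum]
    rw [this, one_div_mul_cancel hSpos.ne']

/-- Mixing two weights with small interaction. -/
theorem exists_mix_two {k : V → V → ℝ} (hk : ∀ u v, k u v = k v u) {A B : Finset V}
    {μ ν : V → ℝ} (hμ : ProbOn A μ) (hν : ProbOn B ν) {b₁ b₂ ξ : ℝ} (hb₁ : 0 < b₁) (hb₂ : 0 < b₂)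
    (h12 : bil k μ ν ≤ ξ) (h1 : bil k μ μ ≤ b₁ + ξ) (h2 : bil k ν ν ≤ b₂ + ξ) :
    ∃ ρ, ProbOn (A ∪ B) ρ ∧ bil k ρ ρ ≤ 1 / (1 / b₁ + 1 / b₂) + ξ := by
  set l : ℝ := b₂ / (b₁ + b₂) with hl
  have hs : 0 < b₁ + b₂ := by linarith
  have hl0 : 0 ≤ l := by positivity
  have hl1 : 0 ≤ 1 - l := by
    have : 1 - l = b₁ / (b₁ + b₂) := by rw [hl]; field_simp; ring
    rw [this]; positivity
  refine ⟨l • μ + (1 - l) • ν, ⟨?_, ?_, ?_⟩, ?_⟩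
  · intro v
    simp only [Pi.add_apply, Pi.smul_apply, smul_eq_mul]
    exact add_nonneg (mul_nonneg hl0 (hμ.nonneg v)) (mul_nonneg hl1 (hν.nonneg v))
  · intro v hv
    simp only [Finset.mem_union, not_or] at hv
    simp [hμ.supp v hv.1, hν.supp v hv.2]
  · simp only [Pi.add_apply, Pi.smul_apply, smul_eq_mul]
    rw [Finset.sum_add_distrib, ← Finset.mul_sum, ← Finset.mul_sum, hμ.sum_eq, hν.sum_eq]
    ring
  · simp only [map_add, map_smul, LinearMap.add_apply, LinearMap.smul_apply, smul_eq_mul]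
    rw [bil_comm hk ν μ]
    have e1 : l * l * bil k μ μ ≤ l * l * (b₁ + ξ) := mul_le_mul_of_nonneg_left h1 (by positivity)
    have e2 : (1 - l) * (1 - l) * bil k ν ν ≤ (1 - l) * (1 - l) * (b₂ + ξ) :=
      mul_le_mul_of_nonneg_left h2 (by positivity)
    have e3 : l * (1 - l) * bil k μ ν ≤ l * (1 - l) * ξ :=
      mul_le_mul_of_nonneg_left h12 (by positivity)
    have e4 : l * l * b₁ + (1 - l) * (1 - l) * b₂ = 1 / (1 / b₁ + 1 / b₂) := by
      rw [hl]; field_simp; ring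
    nlinarith

theorem bil_eq_sum_wdeg (H : SimpleGraph V) {s : ℝ} {A B : Finset V} {μ ν : V → ℝ}
    (hμ : ∀ v, v ∉ A → μ v = 0) (hν : ∀ v, v ∉ B → ν v = 0) (hdis : Disjoint A B) :
    bil (kern H s) μ ν = ∑ u, μ u * wdeg H ν u := by
  rw [bil_apply]
  refine Finset.sum_congr rfl fun u _ => ?_
  rw [wdeg, Finset.mul_sum]
  refine Finset.sum_congr rfl fun v _ => ?_
  by_cases huv : u = v
  · subst huv
    by_cases hu : u ∈ A
    · simp [hν u (Finset.disjoint_left.1 hdis hu)]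
    · simp [hμ u hu]
  · simp only [kern, huv, if_false, add_zero]
    split_ifs <;> simp

end

noncomputable section

variable {V : Type*}

/-- The sum of `c` over all ordered pairs of entries of a list. -/
def pairCost (c : V → V → ℝ) : List V → ℝ
  | [] => 0
  | u :: l => (l.map (c u)).sum + pairCost c l

theorem exists_list_cost [Fintype V] {c : V → V → ℝ} {L : Finset V} {μ : V → ℝ}
    (hμ : ProbOn L μ) (m : ℕ) (g : V → ℝ) :
    ∃ l : List V, l.length = m ∧ (∀ u ∈ l, u ∈ L) ∧ pairCost c l + (l.map g).sum ≤
      (m : ℝ) * (m - 1) / 2 * bil c μ μ + m * ∑ v, μ v * g v := by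
  induction m generalizing g with
  | zero => exact ⟨[], rfl, by simp, by simp [pairCost]⟩
  | succ m ih =>
    obtain ⟨u, huL, hu⟩ := hμ.exists_le (fun u => (m : ℝ) * (∑ v, μ v * c u v) + g u)
    obtain ⟨l, hl, hlL, hcost⟩ := ih (fun v => g v + c u v)
    refine ⟨u :: l, by simp [hl], ?_, ?_⟩
    · intro w hw
      rcases List.mem_cons.1 hw with rfl | hw
      · exact huL
      · exact hlL w hw
    have e1 : ∑ v, μ v * ((m : ℝ) * (∑ w, μ w * c v w) + g v) =
        m * bil c μ μ + ∑ v, μ v * g v := by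
      simp only [mul_add, Finset.sum_add_distrib, bil_apply, Finset.mul_sum]
      congr 1
      exact Finset.sum_congr rfl fun v _ => Finset.sum_congr rfl fun w _ => by ring
    have e2 : ∑ v, μ v * (g v + c u v) = ∑ v, μ v * g v + ∑ v, μ v * c u v := by
      simp only [mul_add, Finset.sum_add_distrib]
    have e3 : (l.map fun v => g v + c u v).sum = (l.map g).sum + (l.map (c u)).sum :=
      List.sum_map_add
    rw [e2, e3] at hcost
    rw [e1] at hu
    simp only [pairCost, List.map_cons, List.sum_cons]
    push_cast
    linarith

theorem list_sum_nonneg {f : V → ℝ} (hf : ∀ v, 0 ≤ f v) (l : List V) : 0 ≤ (l.map f).sum :=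
  List.sum_nonneg (by simpa using fun a _ => hf a)

theorem sum_toFinset_le {f : V → ℝ} (hf : ∀ v, 0 ≤ f v) (l : List V) :
    ∑ v ∈ l.toFinset, f v ≤ (l.map f).sum := by
  induction l with
  | nil => simp
  | cons u l ih =>
    rw [List.toFinset_cons, List.map_cons, List.sum_cons]
    by_cases hu : u ∈ l.toFinset
    · rw [Finset.insert_eq_of_mem hu]
      linarith [hf u]
    · rw [Finset.sum_insert hu]
      linarith

theorem pairCost_nonneg {c : V → V → ℝ} (hc : ∀ u v, 0 ≤ c u v) (l : List V) :
    0 ≤ pairCost c l := by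
  induction l with
  | nil => simp [pairCost]
  | cons u l ih => exact add_nonneg (list_sum_nonneg (hc u) l) ih

theorem pairCost_kern (H : SimpleGraph V) (s : ℝ) (l : List V) :
    pairCost (kern H s) l = pairCost (fun u v => if H.Adj u v then 1 else 0) l
      + s * pairCost (fun u v => if u = v then 1 else 0) l := by
  induction l with
  | nil => simp [pairCost]
  | cons u l ih =>
    have e : (l.map (kern H s u)).sum = (l.map fun v => if H.Adj u v then (1 : ℝ) else 0).sum
        + s * (l.map fun v => if u = v then (1 : ℝ) else 0).sum := by
      rw [← List.sum_map_mul_left, ← List.sum_map_add]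
      congr 1
      refine List.map_congr_left fun v _ => ?_
      simp [kern]
    simp only [pairCost, ih, e]
    ring

theorem length_sub_le_card (l : List V) :
    (l.length : ℝ) - pairCost (fun u v => if u = v then 1 else 0) l ≤ l.toFinset.card := by
  induction l with
  | nil => simp [pairCost]
  | cons u l ih =>
    have h0 : ∀ v : V, (0 : ℝ) ≤ if u = v then 1 else 0 := fun v => by positivity
    have hle := sum_toFinset_le h0 l
    rw [List.toFinset_cons, List.length_cons]
    simp only [pairCost]
    push_cast
    by_cases hu : u ∈ l.toFinset
    · rw [Finset.insert_eq_of_mem hu]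
      have : (1 : ℝ) ≤ ∑ v ∈ l.toFinset, if u = v then 1 else 0 := by
        simp only [Finset.sum_ite_eq, hu, if_true, le_refl]
      linarith
    · rw [Finset.card_insert_of_notMem hu]
      push_cast
      linarith [list_sum_nonneg h0 l]

theorem sum_degree_le_pairCost (H : SimpleGraph V) (l : List V) :
    ∑ u ∈ l.toFinset, ((nbrsIn H u l.toFinset).card : ℝ) ≤
      2 * pairCost (fun u v => if H.Adj u v then 1 else 0) l := by
  have key : ∀ (w : V) (T : Finset V), ((nbrsIn H w T).card : ℝ) =
      ∑ v ∈ T, if H.Adj w v then (1 : ℝ) else 0 := fun w T => by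
    rw [Finset.sum_boole, nbrsIn]
  simp only [key]
  induction l with
  | nil => simp [pairCost]
  | cons u l ih =>
    have h0 : ∀ v : V, (0 : ℝ) ≤ if H.Adj u v then 1 else 0 := fun v => by positivity
    have hle := sum_toFinset_le h0 l
    simp only [pairCost, List.toFinset_cons]
    by_cases hu : u ∈ l.toFinset
    · rw [Finset.insert_eq_of_mem hu]
      linarith [list_sum_nonneg h0 l]
    · simp only [Finset.sum_insert hu, Finset.sum_add_distrib, SimpleGraph.irrefl, if_false]
      have : ∑ x ∈ l.toFinset, (if H.Adj x u then (1 : ℝ) else 0) =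
          ∑ x ∈ l.toFinset, if H.Adj u x then (1 : ℝ) else 0 := by
        simp only [H.adj_comm]
      rw [this]
      linarith

/-- Markov's inequality for counting. -/
theorem card_filter_lt_le {T : Finset V} {f : V → ℝ} {c M : ℝ} (hc : 0 < c)
    (hf : ∀ u ∈ T, 0 ≤ f u) (hsum : ∑ u ∈ T, f u ≤ c * M) :
    ((T.filter fun u => c < f u).card : ℝ) ≤ M := by
  have h1 : c * (T.filter fun u => c < f u).card ≤ ∑ u ∈ T, f u := by
    calc c * (T.filter fun u => c < f u).card = ∑ u ∈ T.filter (fun u => c < f u), c := by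
          rw [Finset.sum_const, nsmul_eq_mul, mul_comm]
      _ ≤ ∑ u ∈ T.filter (fun u => c < f u), f u :=
          Finset.sum_le_sum fun u hu => (Finset.mem_filter.1 hu).2.le
      _ ≤ ∑ u ∈ T, f u :=
          Finset.sum_le_sum_of_subset_of_nonneg (Finset.filter_subset _ _) fun u hu _ => hf u hu
  exact le_of_mul_le_mul_left (h1.trans hsum) hc

/-- A set with small average of `f` has a large part where `f` is small. -/
theorem exists_half_small {T : Finset V} {f : V → ℝ} {c : ℝ} (hc : 0 < c)
    (hf : ∀ u ∈ T, 0 ≤ f u) (hsum : ∑ u ∈ T, f u ≤ c * T.card) :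
    ∃ T' ⊆ T, (T.card : ℝ) ≤ 2 * T'.card ∧ ∀ u ∈ T', f u ≤ 2 * c := by
  refine ⟨T.filter fun u => ¬ 2 * c < f u, Finset.filter_subset _ _, ?_, ?_⟩
  · have h1 := card_filter_lt_le (c := 2 * c) (M := T.card / 2) (by linarith) hf (by linarith)
    have h2 := Finset.card_filter_add_card_filter_not (s := T) (fun u => 2 * c < f u)
    have h3 : ((T.filter fun u => 2 * c < f u).card : ℝ) +
        (T.filter fun u => ¬ 2 * c < f u).card = T.card := by exact_mod_cast h2
    linarith
  · intro u hu
    exact not_lt.1 (Finset.mem_filter.1 hu).2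

theorem card_nbrsIn_mono (H : SimpleGraph V) (v : V) {A B : Finset V} (h : A ⊆ B) :
    (nbrsIn H v A).card ≤ (nbrsIn H v B).card :=
  Finset.card_le_card (Finset.filter_subset_filter _ h)

/-- A probability weight of small energy yields a large sparse set. -/
theorem exists_sparse_of_bil_le [Fintype V] {H : SimpleGraph V} {s : ℕ} (hs : 1 ≤ s) {K : ℝ}
    (hK : 1 ≤ K) {L : Finset V} {μ : V → ℝ} (hμ : ProbOn L μ)
    (hq : bil (kern H s) μ μ ≤ 1 / K) :
    ∃ T : Finset V, (s : ℝ) ≤ 4 * T.card ∧ SparseOn H T (16 / K) := by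
  obtain ⟨l, hl, -, hcost⟩ := exists_list_cost (c := kern H s) hμ s (fun _ => 0)
  have hs1 : (1 : ℝ) ≤ s := by exact_mod_cast hs
  have hK0 : 0 < K := by linarith
  have hpe := pairCost_nonneg (c := fun u v : V => if u = v then 1 else 0)
    (fun u v => by positivity) l
  have hpa := pairCost_nonneg (c := fun u v : V => if H.Adj u v then 1 else 0)
    (fun u v => by positivity) l
  rw [pairCost_kern] at hcost
  have hz : (l.map (fun _ : V => (0 : ℝ))).sum = 0 := by simp
  rw [hz] at hcost
  simp only [mul_zero, Finset.sum_const_zero, add_zero] at hcost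
  set pe := pairCost (fun u v : V => if u = v then (1 : ℝ) else 0) l
  set pa := pairCost (fun u v : V => if H.Adj u v then (1 : ℝ) else 0) l
  have hcost2 : pa + s * pe ≤ (s : ℝ) ^ 2 / (2 * K) := by
    refine hcost.trans ?_
    calc (s : ℝ) * (s - 1) / 2 * bil (kern H s) μ μ ≤ (s : ℝ) * (s - 1) / 2 * (1 / K) := by
          refine mul_le_mul_of_nonneg_left hq ?_
          have : (0 : ℝ) ≤ s - 1 := by linarith
          positivity
      _ ≤ (s : ℝ) * s / 2 * (1 / K) := by gcongr; linarith
      _ = _ := by field_simp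
  have hbound : (s : ℝ) ^ 2 / (2 * K) ≤ s ^ 2 / 2 := by
    rw [div_le_div_iff₀ (by positivity) (by norm_num)]
    nlinarith [sq_nonneg (s : ℝ)]
  have hpe2 : pe ≤ s / 2 := by nlinarith
  set T := l.toFinset
  have hT : (s : ℝ) / 2 ≤ T.card := by
    have := length_sub_le_card l
    rw [hl] at this
    change (s : ℝ) - pe ≤ T.card at this
    linarith
  have hTpos : (0 : ℝ) < T.card := by linarith
  have hdeg : ∑ u ∈ T, ((nbrsIn H u T).card : ℝ) ≤ (4 * T.card / K) * T.card := by
    refine (sum_degree_le_pairCost H l).trans ?_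
    change 2 * pa ≤ _
    have h1 : 2 * pa ≤ (s : ℝ) ^ 2 / K := by
      have : (s : ℝ) ^ 2 / K = 2 * ((s : ℝ) ^ 2 / (2 * K)) := by field_simp
      rw [this]; nlinarith
    refine h1.trans ?_
    rw [div_mul_eq_mul_div, div_le_div_iff_of_pos_right hK0]
    nlinarith
  obtain ⟨T', hT'T, hcard, hsmall⟩ := exists_half_small (by positivity)
    (fun u _ => by positivity) hdeg
  refine ⟨T', by linarith, fun v hv => ?_⟩
  calc ((nbrsIn H v T').card : ℝ) ≤ (nbrsIn H v T).card := by
        exact_mod_cast card_nbrsIn_mono H v hT'T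
    _ ≤ 2 * (4 * T.card / K) := hsmall v hv
    _ ≤ 2 * (4 * (2 * T'.card) / K) := by gcongr
    _ = 16 / K * T'.card := by ring

end

noncomputable section

variable {V : Type*}

/-- The complement of `P5` is a four-cycle `a b c d` with a further vertex joined to `a` and `b`. -/
theorem house_absurd {G : SimpleGraph V} (hG : Free P5ᶜ G) {a b c d r : V}
    (hab : G.Adj a b) (hbc : G.Adj b c) (hcd : G.Adj c d) (hda : G.Adj d a)
    (hac : ¬ G.Adj a c) (hbd : ¬ G.Adj b d) (hra : G.Adj r a) (hrb : G.Adj r b)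
    (hrc : ¬ G.Adj r c) (hrd : ¬ G.Adj r d) : False := by
  have n1 : a ≠ c := fun h => hrc (h ▸ hra)
  have n2 : b ≠ d := fun h => hrd (h ▸ hrb)
  have n3 : r ≠ c := fun h => hac (h ▸ hra.symm)
  have n4 : r ≠ d := fun h => hbd (h ▸ hrb.symm)
  have e1 := hab.ne
  have e2 := hbc.ne
  have e3 := hcd.ne
  have e4 := hda.ne
  have e5 := hra.ne
  have e6 := hrb.ne
  refine hG ⟨![a, c, r, d, b], ?_, ?_⟩
  · intro i j hij
    fin_cases i <;> fin_cases j <;> simp_all [eq_comm]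
  · intro i j
    fin_cases i <;> fin_cases j <;>
      simp_all [P5, SimpleGraph.pathGraph_adj, G.adj_comm]

/-- `Y` is a union of components of the graph induced by `H` on `X`. -/
def SepIn (H : SimpleGraph V) (X Y : Finset V) : Prop :=
  Y ⊆ X ∧ ∀ y ∈ Y, ∀ z ∈ X, z ∉ Y → ¬ H.Adj y z

/-- The component of `u` in the graph induced by `H` on `X`. -/
def comp (H : SimpleGraph V) (X : Finset V) (u : V) : Finset V :=
  X.filter fun v => ∀ Y, SepIn H X Y → u ∈ Y → v ∈ Y

variable {H : SimpleGraph V} {X Y : Finset V} {u v : V}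

theorem SepIn.compl (h : SepIn H X Y) : SepIn H X (X \ Y) := by
  refine ⟨Finset.sdiff_subset, fun y hy z hz hzY hadj => ?_⟩
  rw [Finset.mem_sdiff] at hy hzY
  have hz' : z ∈ Y := by
    by_contra h'
    exact hzY ⟨hz, h'⟩
  exact h.2 z hz' y hy.1 hy.2 hadj.symm

theorem comp_subset : comp H X u ⊆ X := Finset.filter_subset _ _

theorem mem_comp_self (hu : u ∈ X) : u ∈ comp H X u :=
  Finset.mem_filter.2 ⟨hu, fun _ _ h => h⟩

theorem comp_sepIn (H : SimpleGraph V) (X : Finset V) (u : V) : SepIn H X (comp H X u) := by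
  refine ⟨comp_subset, fun y hy z hz hzc hadj => hzc ?_⟩
  refine Finset.mem_filter.2 ⟨hz, fun Y hY huY => ?_⟩
  have hyY := (Finset.mem_filter.1 hy).2 Y hY huY
  by_contra hzY
  exact hY.2 y hyY z hz hzY hadj

theorem comp_subset_of_sepIn (hY : SepIn H X Y) (hu : u ∈ Y) : comp H X u ⊆ Y :=
  fun _ hv => (Finset.mem_filter.1 hv).2 Y hY hu

theorem comp_eq_of_mem (hu : u ∈ X) (hv : v ∈ comp H X u) : comp H X v = comp H X u := by
  refine (comp_subset_of_sepIn (comp_sepIn H X u) hv).antisymm ?_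
  refine comp_subset_of_sepIn (comp_sepIn H X v) ?_
  by_contra hcon
  have h1 := comp_subset_of_sepIn (comp_sepIn H X v).compl (Finset.mem_sdiff.2 ⟨hu, hcon⟩) hv
  exact (Finset.mem_sdiff.1 h1).2 (mem_comp_self (comp_subset hv))

/-- A predicate that is not constant on a component is not constant on some edge of it. -/
theorem exists_adj_split {p : V → Prop} {a b : V} (hu : u ∈ X) (ha : a ∈ comp H X u)
    (hb : b ∈ comp H X u) (hpa : p a) (hpb : ¬ p b) :
    ∃ c ∈ comp H X u, ∃ d ∈ comp H X u, H.Adj c d ∧ p c ∧ ¬ p d := by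
  by_contra! hcon
  have hsep : SepIn H X ((comp H X u).filter p) := by
    refine ⟨(Finset.filter_subset _ _).trans comp_subset, fun y hy z hz hzY hadj => ?_⟩
    rw [Finset.mem_filter] at hy hzY
    have hzc : z ∈ comp H X u := by
      by_contra hzc
      exact (comp_sepIn H X u).2 y hy.1 z hz hzc hadj
    exact hzY ⟨hzc, hcon y hy.1 z hzc hadj hy.2⟩
  by_cases hup : p u
  · have h1 := comp_subset_of_sepIn hsep
      (Finset.mem_filter.2 ⟨mem_comp_self hu, hup⟩) hb
    exact hpb (Finset.mem_filter.1 h1).2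
  · have h1 := comp_subset_of_sepIn hsep.compl
      (Finset.mem_sdiff.2 ⟨hu, fun h => hup (Finset.mem_filter.1 h).2⟩) ha
    exact (Finset.mem_sdiff.1 h1).2 (Finset.mem_filter.2 ⟨ha, hpa⟩)

/-- Either some component is giant, or the set splits into two large separated parts. -/
theorem exists_giant (H : SimpleGraph V) {X : Finset V} {h : ℝ} (hh : 0 < h)
    (hX : 3 * h ≤ X.card) :
    (∃ q ∈ X, (X.card : ℝ) ≤ (comp H X q).card + h) ∨
      ∃ Y, SepIn H X Y ∧ h ≤ Y.card ∧ h ≤ (X \ Y).card := by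
  by_contra! hcon
  obtain ⟨hcon1, hcon2⟩ := hcon
  have hdich : ∀ Y, SepIn H X Y → (X.card : ℝ) ≤ Y.card + h ∨ (Y.card : ℝ) < h := by
    intro Y hY
    by_contra! h'
    have h1 := hcon2 Y hY h'.2
    have h2 : ((X \ Y).card : ℝ) + Y.card = X.card := by
      exact_mod_cast Finset.card_sdiff_add_card_eq_card hY.1
    linarith
  have hex : ∃ Z ∈ X.powerset, SepIn H X Z ∧ (X.card : ℝ) ≤ Z.card + h :=
    ⟨X, by simp, ⟨subset_rfl, fun _ _ z hz hzn => absurd hz hzn⟩, by linarith⟩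
  obtain ⟨Z, hZ, hZmin⟩ := Finset.exists_min_image
    (X.powerset.filter fun Z => SepIn H X Z ∧ (X.card : ℝ) ≤ Z.card + h) Finset.card
    (by obtain ⟨Z, h1, h2⟩ := hex; exact ⟨Z, Finset.mem_filter.2 ⟨h1, h2⟩⟩)
  obtain ⟨-, hZsep, hZcard⟩ := Finset.mem_filter.1 hZ
  have hZne : Z.Nonempty := by
    rw [Finset.nonempty_iff_ne_empty]
    rintro rfl
    simp at hZcard
    linarith
  obtain ⟨q, hq⟩ := hZne
  have hqX := hZsep.1 hq
  have hsub := comp_subset_of_sepIn hZsep hq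
  have hsmall : ((comp H X q).card : ℝ) < h :=
    (hdich _ (comp_sepIn H X q)).resolve_left fun h' => absurd (hcon1 q hqX) (by linarith)
  have hsep2 : SepIn H X (Z \ comp H X q) := by
    refine ⟨Finset.sdiff_subset.trans hZsep.1, fun y hy z hz hzn hadj => ?_⟩
    rw [Finset.mem_sdiff] at hy hzn
    by_cases hzZ : z ∈ Z
    · have hzc : z ∈ comp H X q := by
        by_contra h'
        exact hzn ⟨hzZ, h'⟩
      exact (comp_sepIn H X q).2 z hzc y (hZsep.1 hy.1) hy.2 hadj.symm
    · exact hZsep.2 y hy.1 z hz hzZ hadj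
  have hcards : ((Z \ comp H X q).card : ℝ) + (comp H X q).card = Z.card := by
    exact_mod_cast Finset.card_sdiff_add_card_eq_card hsub
  rcases hdich _ hsep2 with h' | h'
  · have := hZmin (Z \ comp H X q) (Finset.mem_filter.2
      ⟨Finset.mem_powerset.2 hsep2.1, hsep2, h'⟩)
    have h3 : (Z.card : ℝ) ≤ (Z \ comp H X q).card := by exact_mod_cast this
    have h4 : (1 : ℝ) ≤ (comp H X q).card := by
      exact_mod_cast Finset.card_pos.2 ⟨q, mem_comp_self hqX⟩
    linarith
  · linarith

end

noncomputable section

variable {V : Type*}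

/-- `L` contains no two disjoint sets of size at least `g` that are complete or anticomplete. -/
def NoPure (G : SimpleGraph V) (L : Finset V) (g : ℝ) : Prop :=
  ∀ A ⊆ L, ∀ B ⊆ L, Disjoint A B → g ≤ A.card → g ≤ B.card →
    ¬ CompletePair G A B ∧ ¬ AnticompletePair G A B

theorem mem_nbrsIn {G : SimpleGraph V} {v u : V} {A : Finset V} :
    u ∈ nbrsIn G v A ↔ u ∈ A ∧ G.Adj v u := Finset.mem_filter

theorem nbrsIn_subset (G : SimpleGraph V) (v : V) (A : Finset V) : nbrsIn G v A ⊆ A :=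
  Finset.filter_subset _ _

theorem NoPure.mono {G : SimpleGraph V} {L M : Finset V} {g h : ℝ} (hL : NoPure G L g)
    (hML : M ⊆ L) (hgh : g ≤ h) : NoPure G M h :=
  fun A hA B hB hd h1 h2 => hL A (hA.trans hML) B (hB.trans hML) hd (hgh.trans h1) (hgh.trans h2)

theorem SepIn.anticomplete {H : SimpleGraph V} {X Y : Finset V} (h : SepIn H X Y) :
    AnticompletePair H Y (X \ Y) := fun a ha b hb =>
  h.2 a ha b (Finset.mem_sdiff.1 hb).1 (Finset.mem_sdiff.1 hb).2

/-- For nonadjacent `v`, `w`, a vertex adjacent to `v` only is complete or anticomplete to each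
anticomponent of the common neighbourhood. -/
theorem pure_to_anticomp {G : SimpleGraph V} (hG : Free P5ᶜ G) {v w u q : V} {T : Finset V}
    (hvw : ¬ G.Adj v w) (hvT : ∀ t ∈ T, G.Adj v t) (hwT : ∀ t ∈ T, G.Adj w t)
    (hvu : G.Adj v u) (hwu : ¬ G.Adj w u) (hq : q ∈ T) :
    (∀ t ∈ comp Gᶜ T q, G.Adj u t) ∨ ∀ t ∈ comp Gᶜ T q, ¬ G.Adj u t := by
  by_contra! hcon
  obtain ⟨⟨b, hb, hub⟩, a, ha, hua⟩ := hcon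
  obtain ⟨c, hc, d, hd, hcd, huc, hud⟩ := exists_adj_split (p := G.Adj u) hq ha hb hua hub
  have hcT := comp_subset hc
  have hdT := comp_subset hd
  exact house_absurd hG (hvT c hcT) (hwT c hcT).symm (hwT d hdT) (hvT d hdT).symm hvw
    ((SimpleGraph.compl_adj _ _ _).1 hcd).2 hvu.symm huc (fun h => hwu h.symm) hud

theorem SepIn.complete_of_compl {G : SimpleGraph V} {X Y : Finset V} (h : SepIn Gᶜ X Y) :
    CompletePair G Y (X \ Y) := by
  intro a ha b hb
  have h1 := h.anticomplete a ha b hb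
  rw [SimpleGraph.compl_adj] at h1
  by_contra h2
  exact h1 ⟨fun hab => (Finset.mem_sdiff.1 hb).2 (hab ▸ ha), h2⟩

theorem common_nbrs_dichotomy {G : SimpleGraph V} (hG : Free P5ᶜ G) {L : Finset V} {g : ℝ}
    (hg : 0 < g) (hL : NoPure G L g) {v w : V} (hvw : ¬ G.Adj v w) {A : Finset V} (hAL : A ⊆ L)
    (hA : ∀ u ∈ A, G.Adj v u) :
    ((nbrsIn G w A).card : ℝ) ≤ 3 * g ∨ ((A \ nbrsIn G w A).card : ℝ) ≤ 3 * g := by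
  set T := nbrsIn G w A with hT
  have hTA : T ⊆ A := nbrsIn_subset _ _ _
  rcases le_or_gt ((T.card : ℝ)) (3 * g) with h | h
  · exact Or.inl h
  right
  rcases exists_giant Gᶜ hg h.le with ⟨q, hq, hcard⟩ | ⟨Y, hY, h1, h2⟩
  · have hQT : comp Gᶜ T q ⊆ T := comp_subset
    have hQ : g ≤ (comp Gᶜ T q).card := by linarith
    set U₁ := (A \ T).filter fun u => ∀ t ∈ comp Gᶜ T q, G.Adj u t
    set U₂ := (A \ T).filter fun u => ¬ ∀ t ∈ comp Gᶜ T q, G.Adj u t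
    have hd : ∀ U : Finset V, U ⊆ A \ T → Disjoint U (comp Gᶜ T q) := fun U hU =>
      Finset.disjoint_left.2 fun x hx hxQ => (Finset.mem_sdiff.1 (hU hx)).2 (hQT hxQ)
    have hU₁ : (U₁.card : ℝ) < g := by
      by_contra! h'
      exact (hL U₁ (((Finset.filter_subset _ _).trans Finset.sdiff_subset).trans hAL) _
        ((hQT.trans hTA).trans hAL) (hd _ (Finset.filter_subset _ _)) h' hQ).1
        fun a ha => (Finset.mem_filter.1 ha).2
    have hU₂ : (U₂.card : ℝ) < g := by
      by_contra! h'
      refine (hL U₂ (((Finset.filter_subset _ _).trans Finset.sdiff_subset).trans hAL) _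
        ((hQT.trans hTA).trans hAL) (hd _ (Finset.filter_subset _ _)) h' hQ).2 fun a ha => ?_
      obtain ⟨ha1, ha2⟩ := Finset.mem_filter.1 ha
      obtain ⟨haA, haT⟩ := Finset.mem_sdiff.1 ha1
      exact (pure_to_anticomp hG hvw (fun t ht => hA t (hTA ht)) (fun t ht => (mem_nbrsIn.1 ht).2)
        (hA a haA) (fun h => haT (mem_nbrsIn.2 ⟨haA, h⟩)) hq).resolve_left ha2
    have := Finset.card_filter_add_card_filter_not (s := A \ T)
      (fun u => ∀ t ∈ comp Gᶜ T q, G.Adj u t)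
    have h3 : (U₁.card : ℝ) + U₂.card = (A \ T).card := by exact_mod_cast this
    linarith
  · exact absurd hY.complete_of_compl (hL Y ((hY.1.trans hTA).trans hAL) (T \ Y)
      ((Finset.sdiff_subset.trans hTA).trans hAL) Finset.disjoint_sdiff h1 h2).1

theorem card_filter_cover {A : Finset V} {p q : V → Prop} (h : ∀ a ∈ A, p a ∨ q a) :
    (A.card : ℝ) ≤ (A.filter p).card + (A.filter q).card := by
  have : A ⊆ A.filter p ∪ A.filter q := by
    intro a ha
    rcases h a ha with h | h
    · exact Finset.mem_union_left _ (Finset.mem_filter.2 ⟨ha, h⟩)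
    · exact Finset.mem_union_right _ (Finset.mem_filter.2 ⟨ha, h⟩)
  exact_mod_cast (Finset.card_le_card this).trans (Finset.card_union_le _ _)

theorem sparseOn_of_degree {H : SimpleGraph V} {W S : Finset V} {ζ : ℝ} (hζ : 0 < ζ) (hS : S ⊆ W)
    (hcard : (W.card : ℝ) ≤ 2 * S.card)
    (hdeg : ∀ v ∈ S, ((nbrsIn H v W).card : ℝ) ≤ ζ * W.card) : SparseOn H S (2 * ζ) := by
  intro v hv
  have h1 : ((nbrsIn H v S).card : ℝ) ≤ (nbrsIn H v W).card := by
    exact_mod_cast card_nbrsIn_mono H v hS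
  nlinarith [hdeg v hv]

/-- A set has a large restricted half, or contains a large pair with small cross degrees. -/
theorem restricted_half_or_pair {G : SimpleGraph V} (hG : Free P5ᶜ G) {W : Finset V} {g ζ : ℝ}
    (hg : 0 < g) (hζ : 0 < ζ) (hW : NoPure G W g) :
    (∃ S ⊆ W, (W.card : ℝ) ≤ 2 * S.card ∧ (SparseOn G S (2 * ζ) ∨ SparseOn Gᶜ S (2 * ζ))) ∨
    ∃ A ⊆ W, ∃ B ⊆ W, Disjoint A B ∧ ζ * W.card ≤ A.card ∧ ζ / 2 * W.card ≤ B.card ∧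
      ((∀ w ∈ B, ((nbrsIn G w A).card : ℝ) ≤ 3 * g) ∨
        ∀ w ∈ B, ((nbrsIn Gᶜ w A).card : ℝ) ≤ 3 * g) := by
  set p : SimpleGraph V → V → Prop := fun H v => ((nbrsIn H v W).card : ℝ) ≤ ζ * W.card with hp
  by_cases hcov : ∀ v ∈ W, p G v ∨ p Gᶜ v
  · left
    have h1 := card_filter_cover hcov
    have key : ∀ H : SimpleGraph V, (W.card : ℝ) ≤ 2 * (W.filter (p H)).card →
        SparseOn H (W.filter (p H)) (2 * ζ) := fun H h =>
      sparseOn_of_degree hζ (Finset.filter_subset _ _) h fun v hv => (Finset.mem_filter.1 hv).2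
    rcases le_total ((W.filter (p G)).card : ℝ) (W.filter (p Gᶜ)).card with h | h
    · have h' : (W.card : ℝ) ≤ 2 * (W.filter (p Gᶜ)).card := by linarith
      exact ⟨_, Finset.filter_subset _ _, h', Or.inr (key _ h')⟩
    · have h' : (W.card : ℝ) ≤ 2 * (W.filter (p G)).card := by linarith
      exact ⟨_, Finset.filter_subset _ _, h', Or.inl (key _ h')⟩
  · right
    push Not at hcov
    obtain ⟨v, hv, h1, h2⟩ := hcov
    simp only [hp, not_le] at h1 h2
    set A := nbrsIn G v W with hA
    set R := nbrsIn Gᶜ v W with hR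
    have hRA : ∀ w ∈ R, w ∉ A := fun w hw hwA =>
      ((SimpleGraph.compl_adj _ _ _).1 (mem_nbrsIn.1 hw).2).2 (mem_nbrsIn.1 hwA).2
    have hdich : ∀ w ∈ R, ((nbrsIn G w A).card : ℝ) ≤ 3 * g ∨
        ((nbrsIn Gᶜ w A).card : ℝ) ≤ 3 * g := by
      intro w hw
      have hvw := ((SimpleGraph.compl_adj _ _ _).1 (mem_nbrsIn.1 hw).2).2
      refine (common_nbrs_dichotomy hG hg hW hvw (nbrsIn_subset _ _ _)
        (fun u hu => (mem_nbrsIn.1 hu).2)).imp id fun h => le_trans ?_ h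
      have : nbrsIn Gᶜ w A ⊆ A \ nbrsIn G w A := by
        intro u hu
        rw [mem_nbrsIn, SimpleGraph.compl_adj] at hu
        exact Finset.mem_sdiff.2 ⟨hu.1, fun h => hu.2.2 (mem_nbrsIn.1 h).2⟩
      exact_mod_cast Finset.card_le_card this
    have hc := card_filter_cover hdich
    have hdis : ∀ B ⊆ R, Disjoint A B := fun B hB =>
      Finset.disjoint_left.2 fun x hx hxB => hRA x (hB hxB) hx
    refine ⟨A, nbrsIn_subset _ _ _, ?_⟩
    rcases le_total ((R.filter fun w => ((nbrsIn G w A).card : ℝ) ≤ 3 * g).card : ℝ)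
      (R.filter fun w => ((nbrsIn Gᶜ w A).card : ℝ) ≤ 3 * g).card with h | h
    · exact ⟨_, (Finset.filter_subset _ _).trans (nbrsIn_subset _ _ _),
        hdis _ (Finset.filter_subset _ _), h1.le, by linarith,
        Or.inr fun w hw => (Finset.mem_filter.1 hw).2⟩
    · exact ⟨_, (Finset.filter_subset _ _).trans (nbrsIn_subset _ _ _),
        hdis _ (Finset.filter_subset _ _), h1.le, by linarith,
        Or.inl fun w hw => (Finset.mem_filter.1 hw).2⟩

/-- The number of ordered adjacent pairs inside `U`. -/
def degSum (H : SimpleGraph V) (U : Finset V) : ℝ := ∑ u ∈ U, ((nbrsIn H u U).card : ℝ)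

theorem degSum_le_sq (H : SimpleGraph V) (U : Finset V) : degSum H U ≤ (U.card : ℝ) ^ 2 := by
  calc degSum H U ≤ ∑ _u ∈ U, (U.card : ℝ) := Finset.sum_le_sum fun u _ => by
        exact_mod_cast Finset.card_le_card (nbrsIn_subset H u U)
    _ = _ := by rw [Finset.sum_const, nsmul_eq_mul, sq]

theorem sum_card_nbrsIn_comm (H : SimpleGraph V) (A B : Finset V) :
    ∑ a ∈ A, ((nbrsIn H a B).card : ℝ) = ∑ b ∈ B, ((nbrsIn H b A).card : ℝ) := by
  have key : ∀ (w : V) (T : Finset V), ((nbrsIn H w T).card : ℝ) =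
      ∑ v ∈ T, if H.Adj w v then (1 : ℝ) else 0 := fun w T => by
    rw [Finset.sum_boole, nbrsIn]
  simp only [key]
  rw [Finset.sum_comm]
  simp only [H.adj_comm]

theorem card_nbrsIn_union_le (H : SimpleGraph V) (v : V) (A B : Finset V) :
    ((nbrsIn H v (A ∪ B)).card : ℝ) ≤ (nbrsIn H v A).card + (nbrsIn H v B).card := by
  have : nbrsIn H v (A ∪ B) = nbrsIn H v A ∪ nbrsIn H v B := Finset.filter_union _ _ _
  rw [this]
  exact_mod_cast Finset.card_union_le _ _

theorem degSum_union_le (H : SimpleGraph V) {A B : Finset V} (hd : Disjoint A B) {κ : ℝ}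
    (hκ : ∀ w ∈ B, ((nbrsIn H w A).card : ℝ) ≤ κ) :
    degSum H (A ∪ B) ≤ degSum H A + (B.card : ℝ) ^ 2 + 2 * (B.card * κ) := by
  have hAB : ∑ b ∈ B, ((nbrsIn H b A).card : ℝ) ≤ B.card * κ := by
    calc _ ≤ ∑ _b ∈ B, κ := Finset.sum_le_sum hκ
      _ = _ := by rw [Finset.sum_const, nsmul_eq_mul]
  have hBA := (sum_card_nbrsIn_comm H A B).le.trans hAB
  have hBB := degSum_le_sq H B
  unfold degSum at *
  rw [Finset.sum_union hd]
  have h1 : ∑ u ∈ A, ((nbrsIn H u (A ∪ B)).card : ℝ) ≤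
      ∑ u ∈ A, ((nbrsIn H u A).card + (nbrsIn H u B).card : ℝ) :=
    Finset.sum_le_sum fun u _ => card_nbrsIn_union_le H u A B
  have h2 : ∑ u ∈ B, ((nbrsIn H u (A ∪ B)).card : ℝ) ≤
      ∑ u ∈ B, ((nbrsIn H u A).card + (nbrsIn H u B).card : ℝ) :=
    Finset.sum_le_sum fun u _ => card_nbrsIn_union_le H u A B
  rw [Finset.sum_add_distrib] at h1 h2
  linarith

/-- If every large subset contains a large pair with small cross degrees, then there are many
blocks with few edges between them. -/
theorem exists_degSum_small {G : SimpleGraph V} {L : Finset V} {ζ κ : ℝ} (hζ : 0 < ζ)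
    (hζ1 : ζ ≤ 1) {m : ℕ} (hκ : κ ≤ m)
    (hpair : ∀ W ⊆ L, (m : ℝ) ≤ W.card → ∃ A ⊆ W, ∃ B ⊆ W, Disjoint A B ∧ ζ * W.card ≤ A.card ∧
      ζ / 2 * W.card ≤ B.card ∧ ((∀ w ∈ B, ((nbrsIn G w A).card : ℝ) ≤ κ) ∨
        ∀ w ∈ B, ((nbrsIn Gᶜ w A).card : ℝ) ≤ κ)) (t : ℕ) :
    ∀ i j : ℕ, i + j = t → ∀ W ⊆ L, (m : ℝ) * (2 / ζ) ^ t ≤ W.card →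
      ∃ U ⊆ W, (U.card = (i + 1) * m ∧ degSum G U ≤ (i + 1) * (3 * (m : ℝ) ^ 2)) ∨
        (U.card = (j + 1) * m ∧ degSum Gᶜ U ≤ (j + 1) * (3 * (m : ℝ) ^ 2)) := by
  have hζ2 : 1 ≤ 2 / ζ := by rw [le_div_iff₀ hζ]; linarith
  induction t with
  | zero =>
    intro i j hij W hW hcard
    obtain ⟨rfl, rfl⟩ : i = 0 ∧ j = 0 := by omega
    obtain ⟨U, hU, hUc⟩ := Finset.exists_subset_card_eq (s := W) (n := m)
      (by simp at hcard; exact_mod_cast hcard)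
    refine ⟨U, hU, Or.inl ⟨by simp [hUc], ?_⟩⟩
    have := degSum_le_sq G U
    rw [hUc] at this
    push_cast
    nlinarith [sq_nonneg (m : ℝ)]
  | succ t ih =>
    intro i j hij W hW hcard
    have hpow : 1 ≤ (2 / ζ) ^ t := one_le_pow₀ hζ2
    have hm0 : (0 : ℝ) ≤ m := by positivity
    have hcard2 : (m : ℝ) * (2 / ζ) ^ t * (2 / ζ) ≤ W.card := by
      rw [mul_assoc, ← pow_succ]; exact hcard
    have hcard3 : (m : ℝ) * (2 / ζ) ^ t ≤ ζ / 2 * W.card := by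
      calc (m : ℝ) * (2 / ζ) ^ t = ζ / 2 * ((m : ℝ) * (2 / ζ) ^ t * (2 / ζ)) := by
            field_simp
        _ ≤ _ := by gcongr
    have hmW : (m : ℝ) ≤ ζ / 2 * W.card := by nlinarith
    have hWc : (0 : ℝ) ≤ W.card := by positivity
    have hmW' : (m : ℝ) ≤ W.card := by nlinarith
    have triv : ∀ H : SimpleGraph V, ∃ U ⊆ W, U.card = m ∧ degSum H U ≤ 3 * (m : ℝ) ^ 2 := by
      intro H
      obtain ⟨U, hU, hUc⟩ := Finset.exists_subset_card_eq (s := W) (n := m) (by exact_mod_cast hmW')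
      refine ⟨U, hU, hUc, ?_⟩
      have := degSum_le_sq H U
      rw [hUc] at this
      nlinarith [sq_nonneg (m : ℝ)]
    have ext : ∀ (H : SimpleGraph V) (A B U : Finset V) (i : ℕ), A ⊆ W → B ⊆ W → Disjoint A B →
        (m : ℝ) ≤ B.card → (∀ w ∈ B, ((nbrsIn H w A).card : ℝ) ≤ κ) → U ⊆ A →
        U.card = (i + 1) * m → degSum H U ≤ (i + 1) * (3 * (m : ℝ) ^ 2) →
        ∃ U' ⊆ W, U'.card = (i + 1 + 1) * m ∧
          degSum H U' ≤ ((i + 1 : ℕ) + 1) * (3 * (m : ℝ) ^ 2) := by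
      intro H A B U i hA hB hAB hmB hdeg hUA hUc hUd
      obtain ⟨B', hB', hB'c⟩ := Finset.exists_subset_card_eq (s := B) (n := m)
        (by exact_mod_cast hmB)
      have hdis : Disjoint U B' := Finset.disjoint_of_subset_left hUA
        (Finset.disjoint_of_subset_right hB' hAB)
      refine ⟨U ∪ B', Finset.union_subset (hUA.trans hA) (hB'.trans hB), ?_, ?_⟩
      · rw [Finset.card_union_of_disjoint hdis, hUc, hB'c]
        ring
      · have := degSum_union_le H hdis (κ := κ) fun w hw => le_trans
          (by exact_mod_cast card_nbrsIn_mono H w hUA) (hdeg w (hB' hw))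
        rw [hB'c] at this
        push_cast
        nlinarith
    rcases Nat.eq_zero_or_pos i with rfl | hi
    · obtain ⟨U, hU, h1, h2⟩ := triv G
      exact ⟨U, hU, Or.inl ⟨by simp [h1], by simpa using h2⟩⟩
    rcases Nat.eq_zero_or_pos j with rfl | hj
    · obtain ⟨U, hU, h1, h2⟩ := triv Gᶜ
      exact ⟨U, hU, Or.inr ⟨by simp [h1], by simpa using h2⟩⟩
    obtain ⟨A, hA, B, hB, hAB, hAc, hBc, hdeg⟩ := hpair W hW hmW'
    have hAc' : (m : ℝ) * (2 / ζ) ^ t ≤ A.card := by nlinarith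
    have hBc' : (m : ℝ) ≤ B.card := hmW.trans hBc
    rcases hdeg with hdeg | hdeg
    · obtain ⟨i, rfl⟩ : ∃ i', i = i' + 1 := ⟨i - 1, by omega⟩
      obtain ⟨U, hU, h | h⟩ := ih i j (by omega) A (hA.trans hW) hAc'
      · obtain ⟨U', h1, h2, h3⟩ := ext G A B U i hA hB hAB hBc' hdeg hU h.1 h.2
        exact ⟨U', h1, Or.inl ⟨h2, h3⟩⟩
      · exact ⟨U, hU.trans hA, Or.inr h⟩
    · obtain ⟨j, rfl⟩ : ∃ j', j = j' + 1 := ⟨j - 1, by omega⟩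
      obtain ⟨U, hU, h | h⟩ := ih i j (by omega) A (hA.trans hW) hAc'
      · exact ⟨U, hU.trans hA, Or.inl h⟩
      · obtain ⟨U', h1, h2, h3⟩ := ext Gᶜ A B U j hA hB hAB hBc' hdeg hU h.1 h.2
        exact ⟨U', h1, Or.inr ⟨h2, h3⟩⟩

theorem exists_sparse_of_degSum {H : SimpleGraph V} {U : Finset V} {y : ℝ} (hy : 0 < y)
    (hU : degSum H U ≤ y / 4 * (U.card : ℝ) ^ 2) (hne : U.Nonempty) :
    ∃ S ⊆ U, (U.card : ℝ) ≤ 2 * S.card ∧ SparseOn H S y := by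
  have hc : (0 : ℝ) < U.card := by exact_mod_cast hne.card_pos
  obtain ⟨S, hS, hcard, hdeg⟩ := exists_half_small (T := U)
    (f := fun u => ((nbrsIn H u U).card : ℝ)) (c := y / 4 * U.card) (by positivity)
    (fun u _ => by positivity) (by unfold degSum at hU; linarith [hU, sq (U.card : ℝ)])
  refine ⟨S, hS, hcard, ?_⟩
  have := sparseOn_of_degree (H := H) (ζ := y / 2) (by positivity) hS hcard
    (fun v hv => by have := hdeg v hv; linarith)
  rwa [mul_div_cancel₀ y two_ne_zero] at this

end

noncomputable section

theorem exists_restricted_of_noPure {y : ℝ} (hy : 0 < y) (hy1 : y ≤ 1) :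
    ∃ δ : ℝ, 0 < δ ∧ ∃ η₀ : ℝ, 0 < η₀ ∧ ∀ η : ℝ, 0 < η → η ≤ η₀ →
      ∀ (V : Type) (G : SimpleGraph V), Free P5ᶜ G →
      ∀ L : Finset V, 1 ≤ η * L.card → NoPure G L (η * L.card) →
        ∃ S ⊆ L, δ * L.card ≤ S.card ∧ (SparseOn G S y ∨ SparseOn Gᶜ S y) := by
  obtain ⟨k, hk⟩ := exists_nat_ge (12 / y)
  have hk' : 12 ≤ y * (k + 1) := by
    rw [div_le_iff₀ hy] at hk
    nlinarith
  set ζ : ℝ := y / 2 with hζ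
  have hζ0 : 0 < ζ := by positivity
  set E : ℝ := (2 / ζ) ^ (k + k) with hE
  have hE0 : 0 < E := by positivity
  refine ⟨1 / (4 * E), by positivity, 1 / (6 * E), by positivity, ?_⟩
  intro η hη hηle V G hG L hL hpure
  set n : ℝ := (L.card : ℝ) with hn
  have hn0 : 0 ≤ n := by positivity
  have hηn : 1 ≤ n / (6 * E) := by
    calc 1 ≤ η * n := hL
      _ ≤ 1 / (6 * E) * n := by gcongr
      _ = _ := by ring
  have hnE : 6 ≤ n / E := by
    have : n / E = 6 * (n / (6 * E)) := by field_simp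
    linarith
  set m : ℕ := ⌊n / E⌋₊ with hm
  have hm1 : (m : ℝ) ≤ n / E := Nat.floor_le (by positivity)
  have hm2 : n / E - 1 < m := Nat.sub_one_lt_floor _
  have hm3 : n / (2 * E) ≤ m := by
    have : n / (2 * E) = n / E / 2 := by field_simp
    linarith
  have hm0 : (0 : ℝ) < m := by linarith
  have hδ : 1 / (4 * E) * n ≤ m / 2 := by
    have : 1 / (4 * E) * n = n / (2 * E) / 2 := by field_simp; ring
    linarith
  have hκ : 3 * (η * n) ≤ m := by
    have h1 : η * n ≤ 1 / (6 * E) * n := by gcongr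
    have : 3 * (1 / (6 * E) * n) = n / (2 * E) := by field_simp; ring
    linarith
  by_cases hhalf : ∃ W ⊆ L, (m : ℝ) ≤ W.card ∧ ∃ S ⊆ W, (W.card : ℝ) ≤ 2 * S.card ∧
      (SparseOn G S (2 * ζ) ∨ SparseOn Gᶜ S (2 * ζ))
  · obtain ⟨W, hW, hmW, S, hS, hWS, hsp⟩ := hhalf
    rw [hζ, mul_div_cancel₀ y two_ne_zero] at hsp
    exact ⟨S, hS.trans hW, by linarith, hsp⟩
  · push Not at hhalf
    have hpair := exists_degSum_small (G := G) (L := L) hζ0 (by rw [hζ]; linarith) hκ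
      (fun W hW hmW => by
        rcases restricted_half_or_pair hG (by linarith : (0 : ℝ) < η * n) hζ0
          (hpure.mono hW le_rfl) with ⟨S, hS, h1, h2⟩ | h
        · exact absurd h2 (by have := hhalf W hW hmW S hS h1; tauto)
        · exact h) (k + k) k k rfl L subset_rfl (by
          rw [← hE]; rw [le_div_iff₀ hE0] at hm1; exact hm1)
    obtain ⟨U, hU, hUor⟩ := hpair
    have fin : ∀ H : SimpleGraph V, U.card = (k + 1) * m →
        degSum H U ≤ (k + 1) * (3 * (m : ℝ) ^ 2) →
        ∃ S ⊆ L, 1 / (4 * E) * n ≤ S.card ∧ SparseOn H S y := by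
      intro H h1 h2
      have hUc : (U.card : ℝ) = (k + 1) * m := by rw [h1]; push_cast; ring
      have hU0 : (0 : ℝ) < U.card := by rw [hUc]; positivity
      obtain ⟨S, hS, h3, h4⟩ := exists_sparse_of_degSum (H := H) (U := U) hy (by
        rw [hUc]
        refine h2.trans ?_
        have : y / 4 * (((k : ℝ) + 1) * m) ^ 2 = (y * (k + 1)) * ((k + 1) * (m : ℝ) ^ 2) / 4 := by
          ring
        rw [this]
        have : (0 : ℝ) ≤ (k + 1) * (m : ℝ) ^ 2 := by positivity
        nlinarith) (Finset.card_pos.1 (by exact_mod_cast hU0))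
      refine ⟨S, hS.trans hU, ?_, h4⟩
      have : (m : ℝ) ≤ U.card := by rw [hUc]; nlinarith [(Nat.cast_nonneg k : (0 : ℝ) ≤ k)]
      linarith
    rcases hUor with ⟨h1, h2⟩ | ⟨h1, h2⟩
    · obtain ⟨S, hS, h3, h4⟩ := fin G h1 h2
      exact ⟨S, hS, h3, Or.inl h4⟩
    · obtain ⟨S, hS, h3, h4⟩ := fin Gᶜ h1 h2
      exact ⟨S, hS, h3, Or.inr h4⟩

/-- Extending an induced path by one vertex into a smaller giant component. -/
theorem exists_path_extend {V : Type*} {H : SimpleGraph V} {S X : Finset V} {q x : V} {M d g : ℝ}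
    (hno : ∀ A ⊆ S, ∀ B ⊆ S, Disjoint A B → g ≤ A.card → g ≤ B.card → ¬ AnticompletePair H A B)
    (hg : 0 < g) (hX : X ⊆ S) (hq : q ∈ X) (hM : M ≤ (comp H X q).card)
    (hd : ((nbrsIn H x S).card : ℝ) ≤ d) (h3 : 3 * g ≤ M - d - 1)
    (hx : ∃ a ∈ comp H X q, a = x ∨ H.Adj x a) :
    ∃ X' ⊆ S, ∃ q' ∈ X', M - d - 1 - g ≤ (comp H X' q').card ∧ X' ⊆ comp H X q ∧
      (∀ c ∈ X', x ≠ c ∧ ¬ H.Adj x c) ∧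
      ∃ z ∈ comp H X q, H.Adj x z ∧ ∃ c ∈ comp H X' q', H.Adj z c := by
  set C := comp H X q with hC
  have hCS : C ⊆ S := comp_subset.trans hX
  set X' := C.filter fun c => x ≠ c ∧ ¬ H.Adj x c with hX'
  have hcard : M - d - 1 ≤ X'.card := by
    have h1 : C ⊆ (X' ∪ nbrsIn H x S) ∪ {x} := by
      intro c hc
      by_cases h1 : c = x
      · simp [h1]
      · by_cases h2 : H.Adj x c
        · exact Finset.mem_union_left _ (Finset.mem_union_right _ (mem_nbrsIn.2 ⟨hCS hc, h2⟩))
        · exact Finset.mem_union_left _ (Finset.mem_union_left _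
            (Finset.mem_filter.2 ⟨hc, fun h => h1 h.symm, h2⟩))
    have h2 := (Finset.card_le_card h1).trans ((Finset.card_union_le _ _).trans
      (Nat.add_le_add_right (Finset.card_union_le _ _) _))
    rw [Finset.card_singleton] at h2
    have h4 : (C.card : ℝ) ≤ X'.card + (nbrsIn H x S).card + 1 := by exact_mod_cast h2
    linarith
  have hX'C : X' ⊆ C := Finset.filter_subset _ _
  rcases exists_giant H hg (h3.trans hcard) with ⟨q', hq', hgiant⟩ | ⟨Y, hY, h1, h2⟩
  · refine ⟨X', hX'C.trans hCS, q', hq', by linarith, hX'C,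
      fun c hc => (Finset.mem_filter.1 hc).2, ?_⟩
    obtain ⟨a, ha, hax⟩ := hx
    have haX' : a ∉ X' := by
      intro h
      have := (Finset.mem_filter.1 h).2
      rcases hax with h' | h'
      · exact this.1 h'.symm
      · exact this.2 h'
    obtain ⟨c, -, z, hz, hcz, hcC', hzC'⟩ := exists_adj_split (p := (· ∈ comp H X' q')) hq
      (hX'C hq') ha (mem_comp_self hq') (fun h => haX' (comp_subset h))
    have hcX' := (Finset.mem_filter.1 (comp_subset hcC')).2
    have hzX' : z ∉ X' := fun h => (comp_sepIn H X' q').2 c hcC' z h hzC' hcz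
    refine ⟨z, hz, ?_, c, hcC', hcz.symm⟩
    by_contra hxz
    exact hzX' (Finset.mem_filter.2 ⟨hz, fun h => hcX'.2 (h ▸ hcz.symm), hxz⟩)
  · exact absurd hY.anticomplete (hno Y (hY.1.trans (hX'C.trans hCS)) _
      (Finset.sdiff_subset.trans (hX'C.trans hCS)) Finset.disjoint_sdiff h1 h2)

/-- A large set with sparse complement contains a large complete pair. -/
theorem not_sparse_compl {V : Type*} {G : SimpleGraph V} (hG : Free P5ᶜ G) {S : Finset V} {g : ℝ}
    (hg1 : 1 ≤ g) (hgS : 20 * g ≤ S.card) (hS : NoPure G S g)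
    (hsp : SparseOn Gᶜ S (1 / 20)) : False := by
  have hno : ∀ A ⊆ S, ∀ B ⊆ S, Disjoint A B → g ≤ A.card → g ≤ B.card →
      ¬ AnticompletePair Gᶜ A B := by
    intro A hA B hB hd h1 h2 hanti
    refine (hS A hA B hB hd h1 h2).1 fun a ha b hb => ?_
    by_contra h
    exact hanti a ha b hb ((SimpleGraph.compl_adj _ _ _).2
      ⟨fun e => Finset.disjoint_left.1 hd ha (e ▸ hb), h⟩)
  set N : ℝ := (S.card : ℝ)
  have hg : 0 < g := by linarith
  have adj : ∀ {a b : V}, a ≠ b ∧ ¬ Gᶜ.Adj a b → G.Adj a b := fun {a b} h => by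
    by_contra h'
    exact h.2 ((SimpleGraph.compl_adj _ _ _).2 ⟨h.1, h'⟩)
  have nadj : ∀ {a b : V}, Gᶜ.Adj a b → ¬ G.Adj a b := fun h =>
    ((SimpleGraph.compl_adj _ _ _).1 h).2
  rcases exists_giant Gᶜ (X := S) hg (by linarith) with ⟨x₁, hx₁, hgiant⟩ | ⟨Y, hY, h1, h2⟩
  · obtain ⟨X₁, hX₁S, q₁, hq₁, hc₁, -, hn₁, x₂, hx₂, h12, c₁, hc₁', h2c⟩ :=
      exists_path_extend (M := N - g) hno hg subset_rfl hx₁ (by linarith) (hsp x₁ hx₁)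
        (by linarith) ⟨x₁, mem_comp_self hx₁, Or.inl rfl⟩
    obtain ⟨X₂, hX₂S, q₂, hq₂, hc₂, hX₂, hn₂, x₃, hx₃, h23, c₂, hc₂', h3c⟩ :=
      exists_path_extend hno hg hX₁S hq₁ hc₁ (hsp x₂ (comp_subset hx₂))
        (by linarith) ⟨c₁, hc₁', Or.inr h2c⟩
    obtain ⟨X₃, hX₃S, q₃, hq₃, hc₃, hX₃, hn₃, x₄, hx₄, h34, x₅, hx₅, h45⟩ :=
      exists_path_extend hno hg hX₂S hq₂ hc₂ (hsp x₃ (hX₁S (comp_subset hx₃)))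
        (by linarith) ⟨c₂, hc₂', Or.inr h3c⟩
    have hx₅3 := comp_subset hx₅
    have hx₅2 := comp_subset (hX₃ hx₅3)
    have hx₅1 := comp_subset (hX₂ hx₅2)
    have hx₄2 := comp_subset hx₄
    have hx₄1 := comp_subset (hX₂ hx₄2)
    exact house_absurd hG (a := x₁) (b := x₅) (c := x₂) (d := x₄) (r := x₃)
      (adj (hn₁ x₅ hx₅1)) (adj (hn₂ x₅ hx₅2)).symm (adj (hn₂ x₄ hx₄2))
      (adj (hn₁ x₄ hx₄1)).symm (nadj h12) (nadj h45.symm)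
      (adj (hn₁ x₃ (comp_subset hx₃))).symm (adj (hn₃ x₅ hx₅3)) (nadj h23.symm) (nadj h34)
  · exact hno Y hY.1 _ Finset.sdiff_subset Finset.disjoint_sdiff h1 h2 hY.anticomplete

/-- House-free sets without linear pure pairs contain linear sparse sets. -/
theorem exists_sparse_of_noPure {y : ℝ} (hy : 0 < y) (hy1 : y ≤ 1 / 20) :
    ∃ δ : ℝ, 0 < δ ∧ ∃ η : ℝ, 0 < η ∧ ∀ (V : Type) (G : SimpleGraph V), Free P5ᶜ G →
      ∀ L : Finset V, 1 ≤ η * L.card → NoPure G L (η * L.card) →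
        ∃ S ⊆ L, δ * L.card ≤ S.card ∧ SparseOn G S y := by
  obtain ⟨δ, hδ, η₀, hη₀, h⟩ := exists_restricted_of_noPure hy (by linarith)
  refine ⟨δ, hδ, min η₀ (δ / 20), by positivity, fun V G hG L hL hpure => ?_⟩
  obtain ⟨S, hS, hcard, hsp | hsp⟩ := h _ (by positivity) (min_le_left _ _) V G hG L hL hpure
  · exact ⟨S, hS, hcard, hsp⟩
  · exfalso
    have hle : min η₀ (δ / 20) * L.card ≤ δ / 20 * L.card :=
      mul_le_mul_of_nonneg_right (min_le_right _ _) (by positivity)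
    refine not_sparse_compl hG hL (by linarith) (hpure.mono hS le_rfl) fun v hv => ?_
    exact (hsp v hv).trans (by gcongr)

end

noncomputable section

variable {V : Type*} {G : SimpleGraph V} {v w q : V} {D B B' Q Q' : Finset V}

/-- `w` has both a neighbour and a nonneighbour in `B`. -/
def Mixed (G : SimpleGraph V) (w : V) (B : Finset V) : Prop :=
  (∃ b ∈ B, G.Adj w b) ∧ ∃ b ∈ B, ¬ G.Adj w b

/-- The atom of `q` with respect to `w`: the component of `q` inside its anticomponent among the
neighbours of `w` in `D`. -/
def atomOf (G : SimpleGraph V) (D : Finset V) (w q : V) : Finset V :=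
  comp G (comp Gᶜ (nbrsIn G w D) q) q

/-- The structural properties of an atom `B` lying in an anticomponent `Q`. -/
structure AtomIn (G : SimpleGraph V) (D B Q : Finset V) : Prop where
  nonempty : B.Nonempty
  sub : B ⊆ Q
  sub' : Q ⊆ D
  isModule : ∀ u ∈ D, u ∉ Q → (∀ t ∈ Q, G.Adj u t) ∨ ∀ t ∈ Q, ¬ G.Adj u t
  sep : ∀ b ∈ B, ∀ u ∈ Q, u ∉ B → ¬ G.Adj b u
  split : ∀ p : V → Prop, ∀ a ∈ B, ∀ b ∈ B, p a → ¬ p b →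
    ∃ c ∈ B, ∃ d ∈ B, G.Adj c d ∧ p c ∧ ¬ p d
  split' : ∀ p : V → Prop, ∀ a ∈ Q, ∀ b ∈ Q, p a → ¬ p b →
    ∃ c ∈ Q, ∃ d ∈ Q, ¬ G.Adj c d ∧ p c ∧ ¬ p d

theorem atomOf_atomIn (hG : Free P5ᶜ G) (hD : ∀ u ∈ D, G.Adj v u) (hvw : ¬ G.Adj v w)
    (hq : q ∈ nbrsIn G w D) :
    AtomIn G D (atomOf G D w q) (comp Gᶜ (nbrsIn G w D) q) := by
  have hqQ := mem_comp_self (H := Gᶜ) hq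
  refine ⟨⟨q, mem_comp_self hqQ⟩, comp_subset, comp_subset.trans (nbrsIn_subset _ _ _),
    fun u hu huQ => ?_, fun b hb u hu hub => (comp_sepIn G _ q).2 b hb u hu hub,
    fun p a ha b hb hpa hpb => exists_adj_split hqQ ha hb hpa hpb,
    fun p a ha b hb hpa hpb => ?_⟩
  · by_cases huw : G.Adj w u
    · left
      intro t ht
      have h1 := (comp_sepIn Gᶜ _ q).2 t ht u (mem_nbrsIn.2 ⟨hu, huw⟩) huQ
      rw [SimpleGraph.compl_adj] at h1
      by_contra h2
      exact h1 ⟨fun e => huQ (e ▸ ht), fun h => h2 h.symm⟩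
    · exact pure_to_anticomp hG hvw (fun t ht => hD t (nbrsIn_subset _ _ _ ht))
        (fun t ht => (mem_nbrsIn.1 ht).2) (hD u hu) huw hq
  · obtain ⟨c, hc, d, hd, hcd, h⟩ := exists_adj_split hq ha hb hpa hpb
    exact ⟨c, hc, d, hd, ((SimpleGraph.compl_adj _ _ _).1 hcd).2, h⟩

namespace AtomIn

theorem isModule_self (hB : AtomIn G D B Q) {u : V} (hu : u ∈ D) (huB : u ∉ B) :
    (∀ t ∈ B, G.Adj u t) ∨ ∀ t ∈ B, ¬ G.Adj u t := by
  by_cases huQ : u ∈ Q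
  · exact Or.inr fun t ht h => hB.sep t ht u huQ huB h.symm
  · exact (hB.isModule u hu huQ).imp (fun h t ht => h t (hB.sub ht)) fun h t ht => h t (hB.sub ht)

theorem complete_of_adj (hB : AtomIn G D B Q) {u t : V} (hu : u ∈ D) (huB : u ∉ B) (ht : t ∈ B)
    (h : G.Adj u t) : ∀ t ∈ B, G.Adj u t :=
  (hB.isModule_self hu huB).resolve_right fun h' => h' t ht h

/-- A vertex outside `B` with a neighbour in `B` is complete to the anticomponent. -/
theorem complete_of_adj' (hB : AtomIn G D B Q) {u t : V} (hu : u ∈ D) (huB : u ∉ B) (ht : t ∈ B)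
    (h : G.Adj u t) : u ∉ Q ∧ ∀ t ∈ Q, G.Adj u t := by
  have huQ : u ∉ Q := fun huQ => hB.sep t ht u huQ huB h.symm
  exact ⟨huQ, (hB.isModule u hu huQ).resolve_right fun h' => h' t (hB.sub ht) h⟩

/-- Intersecting atoms are nested. -/
theorem laminar (hB : AtomIn G D B Q) (hB' : AtomIn G D B' Q') {x : V} (hx : x ∈ B)
    (hx' : x ∈ B') : B ⊆ B' ∨ B' ⊆ B := by
  by_contra! hcon
  obtain ⟨h1, h2⟩ := hcon
  obtain ⟨b₁, hb₁, hb₁'⟩ := Finset.not_subset.1 h1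
  obtain ⟨b₂, hb₂, hb₂'⟩ := Finset.not_subset.1 h2
  have hsD : B ⊆ D := hB.sub.trans hB.sub'
  have hsD' : B' ⊆ D := hB'.sub.trans hB'.sub'
  obtain ⟨u, hu, z, hz, huz, huB', hzB'⟩ := hB.split (· ∈ B') x hx b₁ hb₁ hx' hb₁'
  have hzb₂ := hB'.complete_of_adj (hsD hz) hzB' huB' huz.symm b₂ hb₂
  obtain ⟨-, hQ⟩ := hB.complete_of_adj' (hsD' hb₂) hb₂' hz hzb₂.symm
  obtain ⟨c, hc, d, hd, hcd, hcB', hdB'⟩ :=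
    hB.split' (· ∈ B') u (hB.sub hu) z (hB.sub hz) huB' hzB'
  exact hcd (hB'.complete_of_adj (hB.sub' hd) hdB' hb₂ (hQ d hd).symm c hcB').symm

/-- Disjoint atoms form a pure pair. -/
theorem pure (hB : AtomIn G D B Q) (hB' : AtomIn G D B' Q') (hd : Disjoint B B') :
    CompletePair G B B' ∨ AnticompletePair G B B' := by
  by_contra! hcon
  obtain ⟨h1, h2⟩ := hcon
  simp only [CompletePair, AnticompletePair] at h1 h2
  push Not at h1 h2
  obtain ⟨a, ha, b, hb, hab⟩ := h2
  obtain ⟨a', ha', b', hb', hab'⟩ := h1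
  have hsD : B ⊆ D := hB.sub.trans hB.sub'
  have hsD' : B' ⊆ D := hB'.sub.trans hB'.sub'
  have hab2 := hB'.complete_of_adj (hsD ha) (Finset.disjoint_left.1 hd ha) hb hab b' hb'
  exact hab' (hB.complete_of_adj (hsD' hb') (Finset.disjoint_right.1 hd hb') ha hab2.symm a'
    ha').symm

/-- No vertex is mixed on two disjoint atoms. -/
theorem not_mixed_both (hG : Free P5ᶜ G) (hD : ∀ u ∈ D, G.Adj v u) (hvw : ¬ G.Adj v w)
    (hB : AtomIn G D B Q) (hB' : AtomIn G D B' Q') (hd : Disjoint B B') (hw : Mixed G w B)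
    (hw' : Mixed G w B') : False := by
  obtain ⟨⟨a, ha, hwa⟩, b, hb, hwb⟩ := hw
  obtain ⟨⟨a', ha', hwa'⟩, b', hb', hwb'⟩ := hw'
  have hsD : B ⊆ D := hB.sub.trans hB.sub'
  have hsD' : B' ⊆ D := hB'.sub.trans hB'.sub'
  rcases hB.pure hB' hd with hc | hc
  · have k1 : ∀ x ∈ B', x ∉ Q ∧ ∀ t ∈ Q, G.Adj x t := fun x hx =>
      hB.complete_of_adj' (hsD' hx) (Finset.disjoint_right.1 hd hx) ha (hc a ha x hx).symm
    have k2 : ∀ x ∈ Q, ∀ t ∈ Q', G.Adj x t := fun x hx =>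
      (hB'.complete_of_adj' (hB.sub' hx) (fun h => (k1 x h).1 hx) ha'
        ((k1 a' ha').2 x hx).symm).2
    obtain ⟨c, hcQ, d, hdQ, hcd, hwc, hwd⟩ :=
      hB.split' (G.Adj w) a (hB.sub ha) b (hB.sub hb) hwa hwb
    obtain ⟨c', hcQ', d', hdQ', hcd', hwc', hwd'⟩ :=
      hB'.split' (G.Adj w) a' (hB'.sub ha') b' (hB'.sub hb') hwa' hwb'
    exact house_absurd hG (k2 c hcQ c' hcQ') (k2 d hdQ c' hcQ').symm (k2 d hdQ d' hdQ')
      (k2 c hcQ d' hdQ').symm hcd hcd' hwc hwc' hwd hwd'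
  · obtain ⟨k, hk, l, hl, hkl, hwk, hwl⟩ := hB.split (G.Adj w) a ha b hb hwa hwb
    exact house_absurd hG (a := v) (b := k) (c := w) (d := a') (r := l) (hD k (hsD hk)) hwk.symm
      hwa' (hD a' (hsD' ha')).symm hvw (hc k hk a' ha') (hD l (hsD hl)).symm hkl.symm
      (fun h => hwl h.symm) (hc l hl a' ha')

end AtomIn

end

noncomputable section

variable {V : Type*} [Fintype V]

theorem card_le_of_energy {H : SimpleGraph V} {L X : Finset V} {s K d : ℝ} (hK : 0 < K)
    (hds : 0 ≤ d + s) (hL : ∀ μ, ProbOn L μ → 1 / K < bil (kern H s) μ μ) (hX : X ⊆ L)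
    (hd : ∀ u ∈ X, ((nbrsIn H u X).card : ℝ) ≤ d) : (X.card : ℝ) ≤ K * (d + s) := by
  rcases X.eq_empty_or_nonempty with rfl | hne
  · simp; positivity
  have h1 := hL _ ((unif_probOn hne).mono hX)
  have h2 := h1.trans_le (bil_unif_le H hne hd)
  have hc : (0 : ℝ) < X.card := by exact_mod_cast hne.card_pos
  rw [div_lt_div_iff₀ hK hc] at h2
  linarith

theorem card_nbrsIn_le_of_small_atoms {G : SimpleGraph V} {L D D₁ : Finset V} {s K h : ℝ} {w : V}
    (hK : 0 < K) (hs : 0 ≤ s) (hh : 0 ≤ h)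
    (hL : ∀ μ, ProbOn L μ → 1 / K < bil (kern G s) μ μ)
    (hL' : ∀ μ, ProbOn L μ → 1 / K < bil (kern Gᶜ s) μ μ) (hDL : D ⊆ L) (hD₁ : D₁ ⊆ D)
    (hat : ∀ q ∈ nbrsIn G w D₁, ((atomOf G D w q).card : ℝ) ≤ h) :
    ((nbrsIn G w D₁).card : ℝ) ≤ K * (K * (h + s) + s) := by
  have hXL : nbrsIn G w D₁ ⊆ L := ((nbrsIn_subset _ _ _).trans hD₁).trans hDL
  refine card_le_of_energy hK (by positivity) hL' hXL fun u hu => ?_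
  set T := nbrsIn G w D
  have hXT : nbrsIn G w D₁ ⊆ T := Finset.filter_subset_filter _ hD₁
  have h1 : nbrsIn Gᶜ u (nbrsIn G w D₁) ⊆ nbrsIn G w D₁ ∩ comp Gᶜ T u := by
    intro x hx
    rw [mem_nbrsIn] at hx
    refine Finset.mem_inter.2 ⟨hx.1, ?_⟩
    by_contra hxc
    exact (comp_sepIn Gᶜ T u).2 u (mem_comp_self (hXT hu)) x (hXT hx.1) hxc hx.2
  have h2 : ((nbrsIn G w D₁ ∩ comp Gᶜ T u).card : ℝ) ≤ K * (h + s) := by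
    refine card_le_of_energy hK (by positivity) hL (Finset.inter_subset_left.trans hXL)
      fun x hx => ?_
    obtain ⟨hx1, hx2⟩ := Finset.mem_inter.1 hx
    refine le_trans ?_ (hat x hx1)
    have hcx : comp Gᶜ T x = comp Gᶜ T u := comp_eq_of_mem (hXT hu) hx2
    have : nbrsIn G x (nbrsIn G w D₁ ∩ comp Gᶜ T u) ⊆ atomOf G D w x := by
      intro y hy
      rw [mem_nbrsIn] at hy
      change y ∈ comp G (comp Gᶜ T x) x
      rw [hcx]
      by_contra hyc
      exact (comp_sepIn G _ x).2 x (mem_comp_self hx2) y (Finset.mem_inter.1 hy.1).2 hyc hy.2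
    exact_mod_cast Finset.card_le_card this
  have h3 : ((nbrsIn Gᶜ u (nbrsIn G w D₁)).card : ℝ) ≤
      (nbrsIn G w D₁ ∩ comp Gᶜ T u).card := by exact_mod_cast Finset.card_le_card h1
  exact h3.trans h2

/-- The maximal atoms complete to `w` have bounded total weight. -/
theorem sum_sq_le_one {V : Type*} {G : SimpleGraph V} {D : Finset V} {w : V} {τ : Finset V → ℝ}
    {F : Finset (Finset V)}
    (hτ0 : ∀ B, 0 ≤ τ B) (hτm : ∀ A B, A ⊆ B → τ A ≤ τ B)
    (hanti : ∀ F' ⊆ F, (∀ A ∈ F', ∀ B ∈ F', A ≠ B → AnticompletePair G A B) →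
      ∑ B ∈ F', τ B ≤ 1)
    (hcomp : ∀ U : Finset (Finset V), (∀ A ∈ U, ∃ F' ⊆ F, F'.Nonempty ∧ A = F'.biUnion id) →
      (∀ A ∈ U, ∀ B ∈ U, A ≠ B → Disjoint A B ∧ CompletePair G A B) → ∑ B ∈ U, τ B ≤ 1)
    (hdis : ∀ A ∈ F, ∀ B ∈ F, A ≠ B → Disjoint A B)
    (hat : ∀ B ∈ F, ∃ Q, AtomIn G D B Q)
    (hw : ∀ B ∈ F, ∀ t ∈ B, G.Adj w t)
    (hmax : ∀ B ∈ F, ∀ q ∈ B, atomOf G D w q ⊆ B) :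
    ∑ B ∈ F, τ B ^ 2 ≤ 1 := by
  have : Nonempty V := ⟨w⟩
  have hex : ∀ B ∈ F, ∃ q, q ∈ B := fun B hB => by
    obtain ⟨Q, hQ⟩ := hat B hB
    exact hQ.nonempty
  choose! rep hrep using hex
  set T := nbrsIn G w D with hT
  set cl : Finset V → Finset V := fun B => comp Gᶜ T (rep B) with hcl
  have hrepT : ∀ B ∈ F, rep B ∈ T := fun B hB => by
    obtain ⟨Q, hQ⟩ := hat B hB
    exact mem_nbrsIn.2 ⟨hQ.sub' (hQ.sub (hrep B hB)), hw B hB _ (hrep B hB)⟩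
  have hsame : ∀ A ∈ F, ∀ B ∈ F, A ≠ B → cl A = cl B → AnticompletePair G A B := by
    intro A hA B hB hAB hc
    obtain ⟨QA, hQA⟩ := hat A hA
    obtain ⟨QB, hQB⟩ := hat B hB
    have hd := hdis A hA B hB hAB
    refine (hQA.pure hQB hd).resolve_left fun hcp => ?_
    have h1 := hcp _ (hrep A hA) _ (hrep B hB)
    have h2 : rep B ∈ comp Gᶜ T (rep A) := by
      change rep B ∈ cl A
      rw [hc]
      exact mem_comp_self (hrepT B hB)
    have h3 : rep B ∉ atomOf G D w (rep A) := fun h =>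
      Finset.disjoint_left.1 hd (hmax A hA _ (hrep A hA) h) (hrep B hB)
    exact (comp_sepIn G (comp Gᶜ T (rep A)) (rep A)).2 _
      (mem_comp_self (mem_comp_self (hrepT A hA))) _ h2 h3 h1
  have hdiff : ∀ A ∈ F, ∀ B ∈ F, cl A ≠ cl B → CompletePair G A B := by
    intro A hA B hB hc
    have hAB : A ≠ B := fun e => hc (e ▸ rfl)
    obtain ⟨QA, hQA⟩ := hat A hA
    obtain ⟨QB, hQB⟩ := hat B hB
    have hd := hdis A hA B hB hAB
    refine (hQA.pure hQB hd).resolve_right fun hcp => hc ?_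
    have h1 := hcp _ (hrep A hA) _ (hrep B hB)
    refine (comp_eq_of_mem (hrepT A hA) ?_).symm
    by_contra h2
    refine (comp_sepIn Gᶜ T (rep A)).2 _ (mem_comp_self (hrepT A hA)) _ (hrepT B hB) h2 ?_
    exact (SimpleGraph.compl_adj _ _ _).2 ⟨fun e => Finset.disjoint_left.1 hd (hrep A hA)
      (e ▸ hrep B hB), h1⟩
  set U : Finset V → Finset V := fun c => (F.filter fun B => cl B = c).biUnion id with hU
  have hfib : ∀ c ∈ F.image cl, ∑ B ∈ F with cl B = c, τ B ^ 2 ≤ τ (U c) := by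
    intro c _
    calc ∑ B ∈ F with cl B = c, τ B ^ 2 ≤ ∑ B ∈ F with cl B = c, τ (U c) * τ B := by
          refine Finset.sum_le_sum fun B hB => ?_
          rw [sq]
          exact mul_le_mul_of_nonneg_right
            (hτm _ _ (Finset.subset_biUnion_of_mem id hB)) (hτ0 B)
      _ = τ (U c) * ∑ B ∈ F with cl B = c, τ B := by rw [Finset.mul_sum]
      _ ≤ τ (U c) * 1 := by
          refine mul_le_mul_of_nonneg_left (hanti _ (Finset.filter_subset _ _) ?_) (hτ0 _)
          intro A hA B hB hAB
          obtain ⟨hA1, hA2⟩ := Finset.mem_filter.1 hA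
          obtain ⟨hB1, hB2⟩ := Finset.mem_filter.1 hB
          exact hsame A hA1 B hB1 hAB (hA2.trans hB2.symm)
      _ = τ (U c) := mul_one _
  have hUdis : ∀ c, ∀ c', c ≠ c' → Disjoint (U c) (U c') ∧ CompletePair G (U c) (U c') := by
    intro c c' hcc
    have key : ∀ x ∈ U c, ∀ y ∈ U c', x ≠ y ∧ G.Adj x y := by
      intro x hx y hy
      obtain ⟨A, hA, hxA⟩ := Finset.mem_biUnion.1 hx
      obtain ⟨B, hB, hyB⟩ := Finset.mem_biUnion.1 hy
      obtain ⟨hA1, hA2⟩ := Finset.mem_filter.1 hA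
      obtain ⟨hB1, hB2⟩ := Finset.mem_filter.1 hB
      have h1 := hdiff A hA1 B hB1 (by rw [hA2, hB2]; exact hcc) x hxA y hyB
      exact ⟨h1.ne, h1⟩
    exact ⟨Finset.disjoint_left.2 fun x hx hx' => (key x hx x hx').1 rfl,
      fun x hx y hy => (key x hx y hy).2⟩
  have hUne : ∀ c ∈ F.image cl, (U c).Nonempty := by
    intro c hc
    obtain ⟨B, hB, rfl⟩ := Finset.mem_image.1 hc
    exact ⟨rep B, Finset.mem_biUnion.2 ⟨B, Finset.mem_filter.2 ⟨hB, rfl⟩, hrep B hB⟩⟩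
  have hinj : Set.InjOn U (F.image cl : Finset (Finset V)) := by
    intro c hc c' hc' he
    by_contra hne
    obtain ⟨x, hx⟩ := hUne c hc
    exact Finset.disjoint_left.1 (hUdis c c' hne).1 hx (he ▸ hx)
  calc ∑ B ∈ F, τ B ^ 2 = ∑ c ∈ F.image cl, ∑ B ∈ F with cl B = c, τ B ^ 2 :=
        (Finset.sum_fiberwise_of_maps_to (fun B hB => Finset.mem_image_of_mem cl hB) _).symm
    _ ≤ ∑ c ∈ F.image cl, τ (U c) := Finset.sum_le_sum hfib
    _ = ∑ A ∈ (F.image cl).image U, τ A := (Finset.sum_image hinj).symm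
    _ ≤ 1 := by
        refine hcomp _ ?_ ?_
        · intro A hA
          obtain ⟨c, hc, rfl⟩ := Finset.mem_image.1 hA
          obtain ⟨B, hB, rfl⟩ := Finset.mem_image.1 hc
          exact ⟨F.filter fun B' => cl B' = cl B, Finset.filter_subset _ _,
            ⟨B, Finset.mem_filter.2 ⟨hB, rfl⟩⟩, rfl⟩
        · intro A hA B hB hAB
          obtain ⟨c, hc, rfl⟩ := Finset.mem_image.1 hA
          obtain ⟨c', hc', rfl⟩ := Finset.mem_image.1 hB
          exact hUdis c c' fun e => hAB (e ▸ rfl)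

/-- The restriction of a weight to a set. -/
def restr (μ : V → ℝ) (M : Finset V) (v : V) : ℝ := if v ∈ M then μ v else 0

theorem sum_restr (μ : V → ℝ) (M : Finset V) : ∑ v, restr μ M v = ∑ v ∈ M, μ v := by
  simp [restr, Finset.sum_ite_mem]

theorem ProbOn.exists_normalized {L M : Finset V} {μ : V → ℝ} (h : ProbOn L μ)
    (hx : ∑ v ∈ M, μ v ≠ 0) : ∃ ν, ProbOn M ν ∧ restr μ M = (∑ v ∈ M, μ v) • ν := by
  set x := ∑ v ∈ M, μ v
  have hx0 : 0 ≤ x := Finset.sum_nonneg fun v _ => h.nonneg v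
  refine ⟨x⁻¹ • restr μ M, ⟨fun v => ?_, fun v hv => by simp [restr, hv], ?_⟩, ?_⟩
  · refine mul_nonneg (inv_nonneg.2 hx0) ?_
    unfold restr
    split_ifs
    · exact h.nonneg v
    · exact le_rfl
  · simp only [Pi.smul_apply, smul_eq_mul]
    rw [← Finset.mul_sum, sum_restr, inv_mul_cancel₀ hx]
  · rw [smul_smul, mul_inv_cancel₀ hx, one_smul]

/-- Weights on a module interact identically with weights outside it. -/
theorem bil_module_eq {G : SimpleGraph V} {s : ℝ} {M : Finset V} {ν ν' ρ : V → ℝ}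
    (hν : ProbOn M ν) (hν' : ProbOn M ν')
    (hρ : ∀ u, ρ u ≠ 0 → u ∉ M ∧ ((∀ t ∈ M, G.Adj t u) ∨ ∀ t ∈ M, ¬ G.Adj t u)) :
    bil (kern G s) ν ρ = bil (kern G s) ν' ρ := by
  have key : ∀ ν, ProbOn M ν → bil (kern G s) ν ρ =
      ∑ u, ρ u * if ∀ t ∈ M, G.Adj t u then 1 else 0 := by
    intro ν hν
    rw [bil_apply, Finset.sum_comm]
    refine Finset.sum_congr rfl fun u _ => ?_
    by_cases hu : ρ u = 0
    · simp [hu]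
    obtain ⟨huM, hpure⟩ := hρ u hu
    have h1 : ∀ t, ν t * ρ u * kern G s t u =
        ρ u * (ν t * if ∀ t ∈ M, G.Adj t u then 1 else 0) := by
      intro t
      by_cases ht : t ∈ M
      · have htu : t ≠ u := fun e => huM (e ▸ ht)
        have : kern G s t u = if ∀ t ∈ M, G.Adj t u then 1 else 0 := by
          simp only [kern, htu, if_false, add_zero]
          rcases hpure with h | h
          · rw [if_pos (h t ht), if_pos h]
          · rw [if_neg (h t ht), if_neg fun h' => h t ht (h' t ht)]
        rw [this]
        ring
      · simp [hν.supp t ht]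
    rw [Finset.sum_congr rfl fun t _ => h1 t, ← Finset.mul_sum, ← Finset.sum_mul, hν.sum_eq,
      one_mul]
  rw [key ν hν, key ν' hν']

theorem bil_complete_eq {G : SimpleGraph V} {s : ℝ} {A B : Finset V} {μ ν : V → ℝ}
    (hμ : ProbOn A μ) (hν : ProbOn B ν) (hAB : CompletePair G A B) :
    bil (kern G s) μ ν = 1 := by
  have h1 : ∀ u v, μ u * ν v * kern G s u v = μ u * ν v := by
    intro u v
    by_cases hu : u ∈ A
    · by_cases hv : v ∈ B
      · have := hAB u hu v hv
        simp [kern, this, this.ne]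
      · simp [hν.supp v hv]
    · simp [hμ.supp u hu]
  rw [bil_apply]
  simp only [h1, ← Finset.mul_sum, hν.sum_eq, mul_one, hμ.sum_eq]

theorem exists_flat {G : SimpleGraph V} {s h : ℝ} {M : Finset V} (hs : 0 ≤ s) (hh : 0 < h)
    (hM : h ≤ M.card) {ν : V → ℝ} (hν : ProbOn M ν) :
    ∃ ν', ProbOn M ν' ∧ bil (kern G s) ν' ν' ≤ 1 + s / h ∧
      bil (kern G s) ν' ν' ≤ bil (kern G s) ν ν := by
  by_cases hle : bil (kern G s) ν ν ≤ 1 + s / h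
  · exact ⟨ν, hν, hle, le_rfl⟩
  have hM0 : (0 : ℝ) < M.card := hh.trans_le hM
  have h1 : bil (kern G s) (unif M) (unif M) ≤ 1 + s / h := by
    refine (bil_unif_le G (Finset.card_pos.1 (by exact_mod_cast hM0)) (d := M.card) fun u _ => by
      exact_mod_cast Finset.card_le_card (nbrsIn_subset G u M)).trans ?_
    rw [add_div, div_self hM0.ne']
    gcongr
  exact ⟨_, unif_probOn (Finset.card_pos.1 (by exact_mod_cast hM0)), h1,
    h1.trans (not_le.1 hle).le⟩

end

noncomputable section

variable {V : Type*} [Fintype V]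

theorem bil_comb₂ {k : V → V → ℝ} (hk : ∀ u v, k u v = k v u) (x : ℝ) (α ρ : V → ℝ) :
    bil k (x • α + ρ) (x • α + ρ) = x ^ 2 * bil k α α + 2 * x * bil k α ρ + bil k ρ ρ := by
  simp only [map_add, map_smul, LinearMap.add_apply, LinearMap.smul_apply, smul_eq_mul,
    bil_comm hk ρ α]
  ring

theorem bil_comb₃ {k : V → V → ℝ} (hk : ∀ u v, k u v = k v u) (x y : ℝ) (α β ρ : V → ℝ) :
    bil k (x • α + y • β + ρ) (x • α + y • β + ρ) = x ^ 2 * bil k α α + y ^ 2 * bil k β β +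
      2 * x * y * bil k α β + 2 * x * bil k α ρ + 2 * y * bil k β ρ + bil k ρ ρ := by
  simp only [map_add, map_smul, LinearMap.add_apply, LinearMap.smul_apply, smul_eq_mul,
    bil_comm hk ρ α, bil_comm hk ρ β, bil_comm hk β α]
  ring

theorem ProbOn.merge {L A : Finset V} {ρ ν : V → ℝ} {x y : ℝ} (hx : 0 ≤ x)
    (hy : 0 ≤ y) (hρ : ∀ v, 0 ≤ ρ v) (hρs : ∀ v, v ∉ L → ρ v = 0) (hρA : ∑ v, ρ v = 1 - x - y)
    (hν : ProbOn A ν) (hA : A ⊆ L) : ProbOn L ((x + y) • ν + ρ) := by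
  refine ⟨fun v => ?_, fun v hv => ?_, ?_⟩
  · simp only [Pi.add_apply, Pi.smul_apply, smul_eq_mul]
    have := hν.nonneg v
    have := hρ v
    positivity
  · simp [hν.supp v fun h => hv (hA h), hρs v hv]
  · simp only [Pi.add_apply, Pi.smul_apply, smul_eq_mul, Finset.sum_add_distrib,
      ← Finset.mul_sum, hν.sum_eq, hρA]
    ring

/-- Weight can be moved off one of two complete modules at small cost. -/
theorem exists_erase_one {G : SimpleGraph V} {s h : ℝ} {F : Finset (Finset V)} (hs : 0 ≤ s)
    (hh : 0 < h) (hdis : ∀ A ∈ F, ∀ B ∈ F, A ≠ B → Disjoint A B)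
    (hpure : ∀ A ∈ F, ∀ B ∈ F, A ≠ B → CompletePair G A B ∨ AnticompletePair G A B)
    (hcard : ∀ A ∈ F, h ≤ A.card) {μ : V → ℝ} (hμ : ProbOn (F.biUnion id) μ) {A B : Finset V}
    (hA : A ∈ F) (hB : B ∈ F) (hAB : A ≠ B) (hc : CompletePair G A B) :
    ∃ C ∈ F, ∃ μ', ProbOn ((F.erase C).biUnion id) μ' ∧
      bil (kern G s) μ' μ' ≤ bil (kern G s) μ μ + 2 * (s / h) := by
  have hk := kern_symm G s
  have hsh : 0 ≤ s / h := by positivity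
  have hdrop : ∀ C ∈ F, ∑ v ∈ C, μ v = 0 → ProbOn ((F.erase C).biUnion id) μ := by
    intro C _ h0
    refine ⟨hμ.nonneg, fun v hv => ?_, hμ.sum_eq⟩
    by_cases hvC : v ∈ C
    · exact (Finset.sum_eq_zero_iff_of_nonneg fun v _ => hμ.nonneg v).1 h0 v hvC
    · refine hμ.supp v fun hv' => hv ?_
      obtain ⟨X, hX, hvX⟩ := Finset.mem_biUnion.1 hv'
      exact Finset.mem_biUnion.2 ⟨X, Finset.mem_erase.2 ⟨fun e => hvC (e ▸ hvX), hX⟩, hvX⟩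
  by_cases hx0 : ∑ v ∈ A, μ v = 0
  · exact ⟨A, hA, μ, hdrop A hA hx0, by linarith⟩
  by_cases hy0 : ∑ v ∈ B, μ v = 0
  · exact ⟨B, hB, μ, hdrop B hB hy0, by linarith⟩
  obtain ⟨α₀, hα₀, hα₀r⟩ := hμ.exists_normalized hx0
  obtain ⟨β₀, hβ₀, hβ₀r⟩ := hμ.exists_normalized hy0
  have hd := hdis A hA B hB hAB
  set ρ : V → ℝ := fun v => if v ∈ A ∨ v ∈ B then 0 else μ v with hρ
  have hdec : μ = restr μ A + restr μ B + ρ := by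
    ext v
    have := fun h : v ∈ A => Finset.disjoint_left.1 hd h
    by_cases h1 : v ∈ A
    · simp [restr, hρ, h1, this h1]
    · by_cases h2 : v ∈ B <;> simp [restr, hρ, h1, h2]
  have hρ0 : ∀ v, 0 ≤ ρ v := fun v => by
    simp only [hρ]
    split_ifs
    exacts [le_rfl, hμ.nonneg v]
  have hρsum : ∑ v, ρ v = 1 - ∑ v ∈ A, μ v - ∑ v ∈ B, μ v := by
    have h1 := hμ.sum_eq
    rw [hdec] at h1
    simp only [Pi.add_apply, Finset.sum_add_distrib, sum_restr] at h1
    linarith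
  have hx : 0 ≤ ∑ v ∈ A, μ v := Finset.sum_nonneg fun v _ => hμ.nonneg v
  have hy : 0 ≤ ∑ v ∈ B, μ v := Finset.sum_nonneg fun v _ => hμ.nonneg v
  have hxy : (∑ v ∈ A, μ v) + ∑ v ∈ B, μ v ≤ 1 := by
    have : 0 ≤ ∑ v, ρ v := Finset.sum_nonneg fun v _ => hρ0 v
    linarith
  rw [hα₀r, hβ₀r] at hdec
  set x := ∑ v ∈ A, μ v
  set y := ∑ v ∈ B, μ v
  have hρmem : ∀ u, ρ u ≠ 0 → u ∉ A ∧ u ∉ B ∧ ∃ X ∈ F, u ∈ X := by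
    intro u hu
    simp only [hρ] at hu
    split_ifs at hu with h1
    · exact absurd rfl hu
    · push Not at h1
      refine ⟨h1.1, h1.2, ?_⟩
      by_contra h2
      exact hu (hμ.supp u fun h3 => h2 (by simpa using h3))
  have hρmod : ∀ C ∈ F, (∀ u, ρ u ≠ 0 → u ∉ C) → ∀ u, ρ u ≠ 0 → u ∉ C ∧
      ((∀ t ∈ C, G.Adj t u) ∨ ∀ t ∈ C, ¬ G.Adj t u) := by
    intro C hC hCρ u hu
    obtain ⟨-, -, X, hX, huX⟩ := hρmem u hu
    have hCX : C ≠ X := fun e => hCρ u hu (e ▸ huX)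
    exact ⟨hCρ u hu, (hpure C hC X hX hCX).imp (fun h t ht => h t ht u huX)
      fun h t ht => h t ht u huX⟩
  have hρA : ∀ u, ρ u ≠ 0 → u ∉ A := fun u hu => (hρmem u hu).1
  have hρB : ∀ u, ρ u ≠ 0 → u ∉ B := fun u hu => (hρmem u hu).2.1
  obtain ⟨α, hα, hα1, hα2⟩ := exists_flat (G := G) hs hh (hcard A hA) hα₀
  obtain ⟨β, hβ, hβ1, hβ2⟩ := exists_flat (G := G) hs hh (hcard B hB) hβ₀
  have hq : bil (kern G s) μ μ = x ^ 2 * bil (kern G s) α₀ α₀ + y ^ 2 * bil (kern G s) β₀ β₀ +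
      2 * x * y + 2 * x * bil (kern G s) α ρ + 2 * y * bil (kern G s) β ρ +
      bil (kern G s) ρ ρ := by
    conv_lhs => rw [hdec]
    rw [bil_comb₃ hk, bil_complete_eq hα₀ hβ₀ hc, bil_module_eq hα₀ hα (hρmod A hA hρA),
      bil_module_eq hβ₀ hβ (hρmod B hB hρB), mul_one]
  have hsub : ∀ C ∈ F, ∀ C' ∈ F, C ≠ C' → C ⊆ (F.erase C').biUnion id := fun C hC C' _ hne =>
    Finset.subset_biUnion_of_mem id (Finset.mem_erase.2 ⟨hne, hC⟩)
  have hsupp : ∀ C ∈ F, (∀ u, ρ u ≠ 0 → u ∉ C) → ∀ v, v ∉ (F.erase C).biUnion id → ρ v = 0 := by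
    intro C hC hCρ v hv
    by_contra h
    obtain ⟨-, -, X, hX, hvX⟩ := hρmem v h
    exact hv (Finset.mem_biUnion.2
      ⟨X, Finset.mem_erase.2 ⟨fun e => hCρ v h (e ▸ hvX), hX⟩, hvX⟩)
  have hA' := bil_comb₂ hk (x + y) α ρ
  have hB' := bil_comb₂ hk (y + x) β ρ
  have hx1 : 0 < x := lt_of_le_of_ne hx (Ne.symm hx0)
  have hy1 : 0 < y := lt_of_le_of_ne hy (Ne.symm hy0)
  have hPA : ProbOn ((F.erase B).biUnion id) ((x + y) • α + ρ) :=
    ProbOn.merge hx hy hρ0 (hsupp B hB hρB) hρsum hα (hsub A hA B hB hAB)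
  have hPB : ProbOn ((F.erase A).biUnion id) ((y + x) • β + ρ) :=
    ProbOn.merge hy hx hρ0 (hsupp A hA hρA) (by rw [hρsum]; ring) hβ
      (hsub B hB A hA hAB.symm)
  set qa := bil (kern G s) α α
  set qb := bil (kern G s) β β
  set ra := bil (kern G s) α ρ
  set rb := bil (kern G s) β ρ
  have h1 := mul_le_mul_of_nonneg_left hα2 (sq_nonneg x)
  have h2 := mul_le_mul_of_nonneg_left hβ2 (sq_nonneg y)
  have h3 : x * y * (qa + qb - 2) ≤ 2 * (s / h) := by
    have h4 : qa + qb - 2 ≤ 2 * (s / h) := by linarith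
    have h5 : x * y ≤ 1 := by nlinarith
    calc x * y * (qa + qb - 2) ≤ x * y * (2 * (s / h)) :=
          mul_le_mul_of_nonneg_left h4 (by positivity)
      _ ≤ 1 * (2 * (s / h)) := mul_le_mul_of_nonneg_right h5 (by positivity)
      _ = _ := one_mul _
  by_cases hcase : qa * (2 * x * y + y ^ 2) - y ^ 2 * qb - 2 * x * y + 2 * y * (ra - rb) ≤
      x * y * (qa + qb - 2)
  · exact ⟨B, hB, _, hPA, by rw [hA', hq]; nlinarith⟩
  · refine ⟨A, hA, _, hPB, ?_⟩
    have h6 : qb * (2 * x * y + x ^ 2) - x ^ 2 * qa - 2 * x * y + 2 * x * (rb - ra) ≤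
        x * y * (qa + qb - 2) := by
      rw [not_le] at hcase
      have h7 := mul_lt_mul_of_pos_left hcase hx1
      by_contra h8
      rw [not_le] at h8
      have h9 := mul_lt_mul_of_pos_left h8 hy1
      nlinarith
    rw [hB', hq]
    nlinarith

/-- Weight on pairwise pure modules can be concentrated on pairwise anticomplete ones. -/
theorem exists_anticomplete_subfamily {G : SimpleGraph V} {s h : ℝ} (hs : 0 ≤ s) (hh : 0 < h) :
    ∀ (n : ℕ) (F : Finset (Finset V)), F.card ≤ n →
    (∀ A ∈ F, ∀ B ∈ F, A ≠ B → Disjoint A B) →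
    (∀ A ∈ F, ∀ B ∈ F, A ≠ B → CompletePair G A B ∨ AnticompletePair G A B) →
    (∀ A ∈ F, h ≤ A.card) → ∀ μ : V → ℝ, ProbOn (F.biUnion id) μ →
    ∃ J ⊆ F, (∀ A ∈ J, ∀ B ∈ J, A ≠ B → AnticompletePair G A B) ∧
      ∃ μ', ProbOn (J.biUnion id) μ' ∧
        bil (kern G s) μ' μ' ≤ bil (kern G s) μ μ + 2 * (s / h) * n := by
  intro n
  induction n with
  | zero =>
    intro F hF _ _ _ μ hμ
    have : F = ∅ := by simpa using hF
    subst this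
    exact ⟨∅, subset_rfl, by simp, μ, hμ, by simp⟩
  | succ n ih =>
    intro F hF hdis hpure hcard μ hμ
    by_cases hall : ∀ A ∈ F, ∀ B ∈ F, A ≠ B → AnticompletePair G A B
    · refine ⟨F, subset_rfl, hall, μ, hμ, ?_⟩
      have : 0 ≤ 2 * (s / h) * ((n + 1 : ℕ) : ℝ) := by positivity
      linarith
    push Not at hall
    obtain ⟨A, hA, B, hB, hAB, hn⟩ := hall
    obtain ⟨C, hC, μ', hμ', hle⟩ := exists_erase_one hs hh hdis hpure hcard hμ hA hB hAB
      ((hpure A hA B hB hAB).resolve_right hn)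
    have hsub : F.erase C ⊆ F := Finset.erase_subset _ _
    obtain ⟨J, hJ, hJa, μ'', hμ'', hle'⟩ := ih (F.erase C)
      (by rw [Finset.card_erase_of_mem hC]; omega)
      (fun A hA B hB => hdis A (hsub hA) B (hsub hB))
      (fun A hA B hB => hpure A (hsub hA) B (hsub hB)) (fun A hA => hcard A (hsub hA)) μ' hμ'
    refine ⟨J, hJ.trans hsub, hJa, μ'', hμ'', ?_⟩
    push_cast
    linarith

end

noncomputable section

variable {V : Type*}

/-- The vertices of `R` mixed on `B`. -/
def mixedIn (G : SimpleGraph V) (R B : Finset V) : Finset V := R.filter fun w => Mixed G w B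

/-- `w` is adjacent to every vertex of `B`. -/
def CompleteTo (G : SimpleGraph V) (w : V) (B : Finset V) : Prop := ∀ t ∈ B, G.Adj w t

/-- The vertices of `R` complete to `B`. -/
def completeIn (G : SimpleGraph V) (R B : Finset V) : Finset V :=
  R.filter fun w => CompleteTo G w B

theorem sum_card_mixedIn_le {G : SimpleGraph V} (hG : Free P5ᶜ G) {v : V} {D R : Finset V}
    (hD : ∀ u ∈ D, G.Adj v u) (hR : ∀ w ∈ R, ¬ G.Adj v w) {F : Finset (Finset V)}
    (hat : ∀ B ∈ F, ∃ Q, AtomIn G D B Q) (hdis : ∀ A ∈ F, ∀ B ∈ F, A ≠ B → Disjoint A B) :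
    ∑ B ∈ F, (mixedIn G R B).card ≤ R.card := by
  rw [← Finset.card_biUnion]
  · exact Finset.card_le_card (Finset.biUnion_subset.2 fun B _ => Finset.filter_subset _ _)
  · intro A hA B hB hAB
    obtain ⟨QA, hQA⟩ := hat A hA
    obtain ⟨QB, hQB⟩ := hat B hB
    rw [Function.onFun, Finset.disjoint_left]
    intro w hw hw'
    obtain ⟨hwR, hm⟩ := Finset.mem_filter.1 hw
    exact hQA.not_mixed_both hG hD (hR w hwR) hQB (hdis A hA B hB hAB) hm
      (Finset.mem_filter.1 hw').2

/-- Outside a small exceptional set, all large atoms lie in disjoint atoms on which few vertices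
are mixed. -/
theorem exists_light_atoms {G : SimpleGraph V} (hG : Free P5ᶜ G) {v : V} {D R : Finset V}
    (hD : ∀ u ∈ D, G.Adj v u) (hR : ∀ w ∈ R, ¬ G.Adj v w) {N ε h : ℝ} (hε : 0 < ε)
    (hRN : (R.card : ℝ) ≤ N) (hdeg : ∀ q ∈ D, ((nbrsIn G q R).card : ℝ) ≤ ε ^ 2 * N) :
    ∃ X ⊆ R, (X.card : ℝ) ≤ ε * N ∧ ∃ F : Finset (Finset V),
      (∀ B ∈ F, ∃ Q, AtomIn G D B Q) ∧ (∀ A ∈ F, ∀ B ∈ F, A ≠ B → Disjoint A B) ∧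
      (∀ B ∈ F, h ≤ B.card) ∧ (∀ B ∈ F, ((mixedIn G R B).card : ℝ) ≤ ε * N) ∧
      (∀ w ∈ R, w ∉ X → ∀ q ∈ nbrsIn G w D, ((atomOf G D w q).card : ℝ) < h ∨
        ∃ B ∈ F, q ∈ B) ∧
      ∀ w ∈ R, w ∉ X → ∀ B ∈ F, (∀ t ∈ B, G.Adj w t) → ∀ q ∈ B, atomOf G D w q ⊆ B := by
  set U : Finset (Finset V) := R.biUnion fun w => (nbrsIn G w D).image (atomOf G D w) with hU
  have hUmem : ∀ w ∈ R, ∀ q ∈ nbrsIn G w D, atomOf G D w q ∈ U := fun w hw q hq =>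
    Finset.mem_biUnion.2 ⟨w, hw, Finset.mem_image_of_mem _ hq⟩
  have hUat : ∀ B ∈ U, ∃ Q, AtomIn G D B Q := by
    intro B hB
    obtain ⟨w, hw, hB⟩ := Finset.mem_biUnion.1 hB
    obtain ⟨q, hq, rfl⟩ := Finset.mem_image.1 hB
    exact ⟨_, atomOf_atomIn hG hD (hR w hw) hq⟩
  have hnest : ∀ A ∈ U, ∀ B ∈ U, ¬ Disjoint A B → A ⊆ B ∨ B ⊆ A := by
    intro A hA B hB hAB
    obtain ⟨QA, hQA⟩ := hUat A hA
    obtain ⟨QB, hQB⟩ := hUat B hB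
    obtain ⟨x, hx, hx'⟩ := Finset.not_disjoint_iff.1 hAB
    exact hQA.laminar hQB hx hx'
  set Hv := U.filter fun B => ε * N < (mixedIn G R B).card with hHv
  set Hm := Hv.filter fun B => Minimal (· ∈ Hv) B with hHm
  set Lt := U.filter fun B => ((mixedIn G R B).card : ℝ) ≤ ε * N ∧ h ≤ B.card with hLt
  set F := Lt.filter fun B => Maximal (· ∈ Lt) B with hF
  have hHmU : ∀ B ∈ Hm, B ∈ U := fun B hB =>
    (Finset.mem_filter.1 (Finset.mem_filter.1 hB).1).1
  have hFU : ∀ B ∈ F, B ∈ U := fun B hB =>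
    (Finset.mem_filter.1 (Finset.mem_filter.1 hB).1).1
  have hHmdis : ∀ A ∈ Hm, ∀ B ∈ Hm, A ≠ B → Disjoint A B := by
    intro A hA B hB hAB
    by_contra hd
    have mA := (Finset.mem_filter.1 hA).2
    have mB := (Finset.mem_filter.1 hB).2
    rcases hnest A (hHmU A hA) B (hHmU B hB) hd with h1 | h1
    · exact hAB (Finset.Subset.antisymm h1 (mB.2 mA.1 h1))
    · exact hAB (Finset.Subset.antisymm (mA.2 mB.1 h1) h1)
  have hFdis : ∀ A ∈ F, ∀ B ∈ F, A ≠ B → Disjoint A B := by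
    intro A hA B hB hAB
    by_contra hd
    have mA := (Finset.mem_filter.1 hA).2
    have mB := (Finset.mem_filter.1 hB).2
    rcases hnest A (hFU A hA) B (hFU B hB) hd with h1 | h1
    · exact hAB (Finset.Subset.antisymm h1 (mA.2 mB.1 h1))
    · exact hAB (Finset.Subset.antisymm (mB.2 mA.1 h1) h1)
  set X := R.filter fun w => ∃ B ∈ Hm, ∀ t ∈ B, G.Adj w t with hX
  have hlight : ∀ w ∈ R, w ∉ X → ∀ q ∈ nbrsIn G w D,
      ((mixedIn G R (atomOf G D w q)).card : ℝ) ≤ ε * N := by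
    intro w hw hwX q hq
    by_contra hlt
    rw [not_le] at hlt
    have hmem : atomOf G D w q ∈ Hv := Finset.mem_filter.2 ⟨hUmem w hw q hq, hlt⟩
    obtain ⟨B, hB, hBmin⟩ := Hv.exists_le_minimal hmem
    refine hwX (Finset.mem_filter.2 ⟨hw, B, Finset.mem_filter.2 ⟨hBmin.1, hBmin⟩,
      fun t ht => ?_⟩)
    exact (mem_nbrsIn.1 (comp_subset (comp_subset (hB ht)))).2
  have hbig : ∀ w ∈ R, w ∉ X → ∀ q ∈ nbrsIn G w D, h ≤ ((atomOf G D w q).card : ℝ) →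
      ∃ B ∈ F, atomOf G D w q ⊆ B := by
    intro w hw hwX q hq hge
    have hmem : atomOf G D w q ∈ Lt :=
      Finset.mem_filter.2 ⟨hUmem w hw q hq, hlight w hw hwX q hq, hge⟩
    obtain ⟨B, hB, hBmax⟩ := Lt.exists_le_maximal hmem
    exact ⟨B, Finset.mem_filter.2 ⟨hBmax.1, hBmax⟩, hB⟩
  have hself : ∀ w, ∀ q ∈ nbrsIn G w D, q ∈ atomOf G D w q := fun w q hq =>
    mem_comp_self (mem_comp_self hq)
  refine ⟨X, Finset.filter_subset _ _, ?_, F, fun B hB => hUat B (hFU B hB), hFdis,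
    fun B hB => (Finset.mem_filter.1 (Finset.mem_filter.1 hB).1).2.2,
    fun B hB => (Finset.mem_filter.1 (Finset.mem_filter.1 hB).1).2.1, ?_, ?_⟩
  · have h1 : (X.card : ℝ) ≤ ∑ B ∈ Hm, ε ^ 2 * N := by
      have h2 : X ⊆ Hm.biUnion fun B => completeIn G R B := by
        intro w hw
        obtain ⟨hwR, B, hB, hwB⟩ := Finset.mem_filter.1 hw
        exact Finset.mem_biUnion.2 ⟨B, hB, Finset.mem_filter.2 ⟨hwR, hwB⟩⟩
      have h3 : (X.card : ℝ) ≤ ∑ B ∈ Hm, ((completeIn G R B).card : ℝ) := by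
        exact_mod_cast (Finset.card_le_card h2).trans Finset.card_biUnion_le
      refine h3.trans (Finset.sum_le_sum fun B hB => ?_)
      obtain ⟨Q, hQ⟩ := hUat B (hHmU B hB)
      obtain ⟨q, hq⟩ := hQ.nonempty
      refine le_trans ?_ (hdeg q (hQ.sub' (hQ.sub hq)))
      have h4 : completeIn G R B ⊆ nbrsIn G q R := by
        intro w hw
        obtain ⟨hwR, hwB⟩ := Finset.mem_filter.1 hw
        exact mem_nbrsIn.2 ⟨hwR, (hwB q hq).symm⟩
      exact_mod_cast Finset.card_le_card h4
    have h5 : ∑ B ∈ Hm, ε * N ≤ N := by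
      have h6 : (∑ B ∈ Hm, ((mixedIn G R B).card : ℝ)) ≤ R.card := by
        exact_mod_cast sum_card_mixedIn_le hG hD hR (fun B hB => hUat B (hHmU B hB)) hHmdis
      refine le_trans (Finset.sum_le_sum fun B hB => ?_) (h6.trans hRN)
      exact (Finset.mem_filter.1 (Finset.mem_filter.1 hB).1).2.le
    rw [Finset.sum_const, nsmul_eq_mul] at h1 h5
    calc (X.card : ℝ) ≤ ε * (Hm.card * (ε * N)) := by rw [sq] at h1; linarith
      _ ≤ ε * N := mul_le_mul_of_nonneg_left h5 hε.le
  · intro w hw hwX q hq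
    by_cases hge : h ≤ ((atomOf G D w q).card : ℝ)
    · obtain ⟨B, hB, hsub⟩ := hbig w hw hwX q hq hge
      exact Or.inr ⟨B, hB, hsub (hself w q hq)⟩
    · exact Or.inl (not_le.1 hge)
  · intro w hw hwX B hB hwB q hq
    obtain ⟨Q, hQ⟩ := hUat B (hFU B hB)
    have hqn : q ∈ nbrsIn G w D := mem_nbrsIn.2 ⟨hQ.sub' (hQ.sub hq), hwB q hq⟩
    have hqa := hself w q hqn
    rcases hnest _ (hUmem w hw q hqn) B (hFU B hB)
      (Finset.not_disjoint_iff.2 ⟨q, hqa, hq⟩) with h1 | h1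
    · exact h1
    have hBh : h ≤ (B.card : ℝ) := (Finset.mem_filter.1 (Finset.mem_filter.1 hB).1).2.2
    obtain ⟨B', hB', hsub⟩ := hbig w hw hwX q hqn
      (hBh.trans (by exact_mod_cast Finset.card_le_card h1))
    by_cases hBB : B' = B
    · exact hBB ▸ hsub
    · exact absurd hq (Finset.disjoint_left.1 (hFdis B' hB' B hB hBB) (hsub hqa))

end

noncomputable section

variable {V : Type*} [Fintype V]

/-- The properties of a set `L` that minimises the product of the two energies, where `τ`
measures relative size. -/
structure Crit (G : SimpleGraph V) (L : Finset V) (s K a : ℝ) (p : ℕ) (τ : Finset V → ℝ) :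
    Prop where
  s_pos : 0 < s
  K_large : 32 ≤ K
  p_pos : 0 < p
  tau_nonneg : ∀ H, 0 ≤ τ H
  tau_mono : ∀ A B, A ⊆ B → τ A ≤ τ B
  tau_pow : ∀ H, τ H ^ p * L.card = H.card
  card_pos : 0 < L.card
  exists_prob : ∀ H ⊆ L, s ≤ H.card → ∃ μ, ProbOn H μ ∧ bil (kern G s) μ μ * τ H ≤ a
  sum_anticomplete : ∀ F : Finset (Finset V), (∀ A ∈ F, A ⊆ L ∧ s ≤ A.card) →
    (∀ A ∈ F, ∀ B ∈ F, A ≠ B → Disjoint A B) →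
    (∀ A ∈ F, ∀ B ∈ F, A ≠ B → AnticompletePair G A B) → ∑ A ∈ F, τ A ≤ 1
  sum_complete : ∀ F : Finset (Finset V), (∀ A ∈ F, A ⊆ L ∧ s ≤ A.card) →
    (∀ A ∈ F, ∀ B ∈ F, A ≠ B → Disjoint A B) →
    (∀ A ∈ F, ∀ B ∈ F, A ≠ B → CompletePair G A B) → ∑ A ∈ F, τ A ≤ 1
  le_energy : ∀ μ, ProbOn L μ → a ≤ bil (kern G s) μ μ
  lt_energy : 1 / K < a
  lt_energy' : ∀ μ, ProbOn L μ → 1 / K < bil (kern Gᶜ s) μ μ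

namespace Crit

variable {G : SimpleGraph V} {L : Finset V} {s K a : ℝ} {p : ℕ} {τ : Finset V → ℝ}

theorem le_tau (hC : Crit G L s K a p τ) {z : ℝ} {H : Finset V}
    (h : z ^ p * L.card ≤ H.card) : z ≤ τ H := by
  rw [← hC.tau_pow H, mul_le_mul_iff_of_pos_right (by exact_mod_cast hC.card_pos)] at h
  exact le_of_pow_le_pow_left₀ hC.p_pos.ne' (hC.tau_nonneg H) h

theorem tau_le_one (hC : Crit G L s K a p τ) {H : Finset V} (h : H ⊆ L) : τ H ≤ 1 := by
  have h1 : τ H ^ p ≤ 1 := by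
    have h2 : (0 : ℝ) < L.card := by exact_mod_cast hC.card_pos
    have h3 : (H.card : ℝ) ≤ 1 * L.card := by
      rw [one_mul]; exact_mod_cast Finset.card_le_card h
    rw [← hC.tau_pow H] at h3
    exact le_of_mul_le_mul_right h3 h2
  exact (pow_le_one_iff_of_nonneg (hC.tau_nonneg H) hC.p_pos.ne').1 h1

theorem a_pos (hC : Crit G L s K a p τ) : 0 < a :=
  lt_trans (by have := hC.K_large; positivity) hC.lt_energy

theorem exists_prob_le (hC : Crit G L s K a p τ) {z : ℝ} (hz : 0 < z) {H : Finset V} (hH : H ⊆ L)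
    (hs : s ≤ H.card) (h : z ^ p * L.card ≤ H.card) :
    ∃ μ, ProbOn H μ ∧ bil (kern G s) μ μ ≤ a / z := by
  obtain ⟨μ, hμ, hle⟩ := hC.exists_prob H hH hs
  refine ⟨μ, hμ, ?_⟩
  rw [le_div_iff₀ hz]
  exact (mul_le_mul_of_nonneg_left (hC.le_tau h)
    (bil_nonneg (kern_nonneg G hC.s_pos.le) hμ.nonneg hμ.nonneg)).trans hle

end Crit

theorem sum_wdeg (H : SimpleGraph V) (μ : V → ℝ) (R : Finset V) :
    ∑ w ∈ R, wdeg H μ w = ∑ u, μ u * (nbrsIn H u R).card := by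
  simp only [wdeg]
  rw [Finset.sum_comm]
  refine Finset.sum_congr rfl fun u _ => ?_
  rw [← Finset.sum_filter, Finset.sum_const, nsmul_eq_mul, mul_comm]
  simp only [nbrsIn, H.adj_comm]

theorem wdeg_nonneg (H : SimpleGraph V) {μ : V → ℝ} (hμ : ∀ v, 0 ≤ μ v) (w : V) :
    0 ≤ wdeg H μ w := Finset.sum_nonneg fun u _ => by split_ifs; exacts [hμ u, le_rfl]

theorem exists_prob_of_small_atoms {G : SimpleGraph V} {L : Finset V} {s K a : ℝ} {p : ℕ}
    {τ : Finset V → ℝ} (hC : Crit G L s K a p τ) {D D₁ R : Finset V} {N z : ℝ} (hz : 0 < z)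
    (hDL : D ⊆ L) (hD₁ : D₁ ⊆ D) (hD0 : D.Nonempty) (hcard : (D.card : ℝ) ≤ 2 * D₁.card)
    (hRN : (R.card : ℝ) ≤ N) (hs : s * K ^ 6 ≤ D.card) (hzD : z ^ p * L.card ≤ D.card / 4)
    (hat : ∀ w ∈ R, ∀ q ∈ nbrsIn G w D₁, ((atomOf G D w q).card : ℝ) ≤ D.card / K ^ 6) :
    ∃ μ, ProbOn D₁ μ ∧ bil (kern G s) μ μ ≤ a / z ∧
      (((R.filter fun w => 1 / (3 * K) < wdeg G μ w).card : ℕ) : ℝ) ≤ 36 / K ^ 3 * N := by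
  have hK := hC.K_large
  have hK0 : 0 < K := by linarith
  have hs0 := hC.s_pos
  have hd0 : (0 : ℝ) < D.card := by exact_mod_cast hD0.card_pos
  set d : ℝ := (D.card : ℝ) with hd
  set h := d / K ^ 6 with hh
  have hh0 : 0 < h := by positivity
  have hsh : s ≤ h := by rw [hh, le_div_iff₀ (by positivity)]; exact hs
  have hdh : d = h * K ^ 6 := by rw [hh]; field_simp
  have hN0 : 0 ≤ N := le_trans (Nat.cast_nonneg _) hRN
  have hT : ∀ w ∈ R, ((nbrsIn G w D₁).card : ℝ) ≤ 3 * K ^ 2 * h := by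
    intro w hw
    have := card_nbrsIn_le_of_small_atoms (G := G) (K := K) hK0 hs0.le hh0.le
      (fun μ hμ => hC.lt_energy.trans_le (hC.le_energy μ hμ)) hC.lt_energy' hDL hD₁ (hat w hw)
    refine this.trans ?_
    have h1 : K * s ≤ K * h := by gcongr
    have h2 : K * h ≤ K * (K * h) := le_mul_of_one_le_left (mul_nonneg hK0.le hh0.le) (by linarith)
    nlinarith [mul_le_mul_of_nonneg_left h1 hK0.le]
  set c : ℝ := 12 * N / K ^ 4 with hc
  set M := D₁.filter fun u => ((nbrsIn G u R).card : ℝ) ≤ c with hM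
  have hsumT : ∑ u ∈ D₁, ((nbrsIn G u R).card : ℝ) ≤ N * (3 * K ^ 2 * h) := by
    have h1 : ∑ u ∈ D₁, ((nbrsIn G u R).card : ℝ) = ∑ w ∈ R, ((nbrsIn G w D₁).card : ℝ) := by
      exact_mod_cast sum_card_nbrsIn_comm G D₁ R
    rw [h1]
    refine (Finset.sum_le_sum hT).trans ?_
    rw [Finset.sum_const, nsmul_eq_mul]
    exact mul_le_mul_of_nonneg_right hRN
      (mul_nonneg (mul_nonneg (by norm_num) (sq_nonneg K)) hh0.le)
  have hMcard : d / 4 ≤ M.card := by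
    have hsplit := Finset.card_filter_add_card_filter_not (s := D₁)
      (fun u => ((nbrsIn G u R).card : ℝ) ≤ c)
    have hsplit' : (M.card : ℝ) + (D₁.filter fun u => ¬ ((nbrsIn G u R).card : ℝ) ≤ c).card =
        D₁.card := by exact_mod_cast hsplit
    simp only [not_le] at hsplit'
    have hbad : (((D₁.filter fun u => c < ((nbrsIn G u R).card : ℝ)).card : ℕ) : ℝ) ≤ d / 4 := by
      rcases hN0.eq_or_lt with h0 | h0
      · have hR0 : R = ∅ := by
          rw [← h0] at hRN
          exact Finset.card_eq_zero.1 (by exact_mod_cast le_antisymm hRN (Nat.cast_nonneg _))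
        have : (D₁.filter fun u => c < ((nbrsIn G u R).card : ℝ)) = ∅ := by
          refine Finset.filter_eq_empty_iff.2 fun u _ => ?_
          simp [hc, ← h0, hR0, nbrsIn]
        rw [this, Finset.card_empty, Nat.cast_zero]
        linarith
      · refine card_filter_lt_le (by positivity) (fun u _ => Nat.cast_nonneg _) ?_
        refine hsumT.trans (le_of_eq ?_)
        rw [hc, hdh]
        field_simp
        ring
    linarith
  have hML : M ⊆ L := ((Finset.filter_subset _ _).trans hD₁).trans hDL
  have hsM : s ≤ M.card := by
    refine le_trans ?_ hMcard
    have : (4 : ℝ) ≤ K ^ 6 := by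
      calc (4 : ℝ) ≤ 32 ^ 6 := by norm_num
        _ ≤ K ^ 6 := by gcongr
    nlinarith
  obtain ⟨μ, hμ, hle⟩ := hC.exists_prob_le hz hML hsM (hzD.trans hMcard)
  refine ⟨μ, hμ.mono (Finset.filter_subset _ _), hle, ?_⟩
  refine card_filter_lt_le (by positivity) (fun w _ => wdeg_nonneg G hμ.nonneg w) ?_
  rw [sum_wdeg]
  calc ∑ u, μ u * ((nbrsIn G u R).card : ℝ) ≤ ∑ u, μ u * c := by
        refine Finset.sum_le_sum fun u _ => ?_
        by_cases hu : u ∈ M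
        · exact mul_le_mul_of_nonneg_left (Finset.mem_filter.1 hu).2 (hμ.nonneg u)
        · simp [hμ.supp u hu]
    _ = c := by rw [← Finset.sum_mul, hμ.sum_eq, one_mul]
    _ = 1 / (3 * K) * (36 / K ^ 3 * N) := by rw [hc]; field_simp; ring

end

noncomputable section

variable {V : Type*} [Fintype V]

theorem min_cube_le {t z x : ℝ} (ht : 0 ≤ t) (h1 : x ≤ t ^ 3) (h2 : x ≤ z ^ 6) :
    x ≤ t * z ^ 4 := by
  rcases le_total t (z ^ 2) with h | h
  · calc x ≤ t ^ 3 := h1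
      _ = t * t ^ 2 := by ring
      _ ≤ t * (z ^ 2) ^ 2 := by gcongr
      _ = t * z ^ 4 := by ring
  · calc x ≤ z ^ 6 := h2
      _ = z ^ 2 * z ^ 4 := by ring
      _ ≤ t * z ^ 4 := by gcongr

section Atoms

variable {G : SimpleGraph V} {L : Finset V} {s K a : ℝ} {k : ℕ} {τ : Finset V → ℝ}

theorem sum_card_heavy_le {p : ℕ} (hp : p = 3 * (k + 2)) (hC : Crit G L s K a p τ)
    {F : Finset (Finset V)} {N ε : ℝ} (hN : 0 < N) (hε : 0 ≤ ε) {m : Finset V → ℝ}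
    (hm0 : ∀ B ∈ F, 0 ≤ m B) (hm : ∀ B ∈ F, m B ≤ ε * N) (hsum : ∑ B ∈ F, m B ≤ N)
    (hτ : ∀ B ∈ F, τ B ^ 3 * N < m B) :
    ∑ B ∈ F, (B.card : ℝ) ≤ L.card * ε ^ (k + 1) := by
  have hn : (0 : ℝ) < L.card := by exact_mod_cast hC.card_pos
  calc ∑ B ∈ F, (B.card : ℝ) ≤ ∑ B ∈ F, L.card * ε ^ (k + 1) / N * m B := by
        refine Finset.sum_le_sum fun B hB => ?_
        have h1 : τ B ^ 3 ≤ m B / N := by rw [le_div_iff₀ hN]; exact (hτ B hB).le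
        have h2 : m B / N ≤ ε := by rw [div_le_iff₀ hN]; exact hm B hB
        have h0 := hC.tau_nonneg B
        have h3 : 0 ≤ m B / N := div_nonneg (hm0 B hB) hN.le
        calc (B.card : ℝ) = (τ B ^ 3) ^ (k + 1) * τ B ^ 3 * L.card := by
              rw [← hC.tau_pow B, hp]; ring
          _ ≤ ε ^ (k + 1) * (m B / N) * L.card := by
              gcongr
              exact h1.trans h2
          _ = _ := by ring
    _ = L.card * ε ^ (k + 1) / N * ∑ B ∈ F, m B := by rw [Finset.mul_sum]
    _ ≤ L.card * ε ^ (k + 1) / N * N := by gcongr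
    _ = _ := by field_simp

theorem sum_card_dominated_le {p : ℕ} (hp : p = 3 * (k + 2)) (hC : Crit G L s K a p τ)
    {F : Finset (Finset V)} (hF : ∀ B ∈ F, B ⊆ L) {N ε : ℝ} (hN : 0 < N) (hε : 0 ≤ ε)
    {m : Finset V → ℝ} (hm0 : ∀ B ∈ F, 0 ≤ m B) (hm : ∀ B ∈ F, m B ≤ ε * N)
    (hsum : ∑ B ∈ F, τ B ^ 2 * m B ≤ N) (hτ : ∀ B ∈ F, τ B ^ 3 * N < m B) :
    ∑ B ∈ F, (B.card : ℝ) ≤ L.card * ε ^ k := by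
  have hn : (0 : ℝ) < L.card := by exact_mod_cast hC.card_pos
  calc ∑ B ∈ F, (B.card : ℝ) ≤ ∑ B ∈ F, L.card * ε ^ k / N * (τ B ^ 2 * m B) := by
        refine Finset.sum_le_sum fun B hB => ?_
        have h1 : τ B ^ 3 ≤ m B / N := by rw [le_div_iff₀ hN]; exact (hτ B hB).le
        have h2 : m B / N ≤ ε := by rw [div_le_iff₀ hN]; exact hm B hB
        have h0 := hC.tau_nonneg B
        have h4 := hC.tau_le_one (hF B hB)
        have h3 : 0 ≤ m B / N := div_nonneg (hm0 B hB) hN.le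
        calc (B.card : ℝ) = (τ B ^ 3) ^ k * τ B ^ 3 * (τ B ^ 2 * τ B) * L.card := by
              rw [← hC.tau_pow B, hp]; ring
          _ ≤ ε ^ k * (m B / N) * (τ B ^ 2 * 1) * L.card := by
              gcongr
              exact h1.trans h2
          _ = _ := by ring
    _ = L.card * ε ^ k / N * ∑ B ∈ F, τ B ^ 2 * m B := by rw [Finset.mul_sum]
    _ ≤ L.card * ε ^ k / N * N := by gcongr
    _ = _ := by field_simp

theorem sum_sq_completeIn_le {p : ℕ} (hC : Crit G L s K a p τ) {D R : Finset V}
    {F : Finset (Finset V)} (hDL : D ⊆ L) (hat : ∀ B ∈ F, ∃ Q, AtomIn G D B Q)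
    (hdis : ∀ A ∈ F, ∀ B ∈ F, A ≠ B → Disjoint A B) (hs : ∀ B ∈ F, s ≤ B.card)
    (hmax : ∀ w ∈ R, ∀ B ∈ F, (∀ t ∈ B, G.Adj w t) → ∀ q ∈ B, atomOf G D w q ⊆ B) :
    ∑ B ∈ F, τ B ^ 2 * (completeIn G R B).card ≤ R.card := by
  have hFL : ∀ B ∈ F, B ⊆ L := fun B hB => by
    obtain ⟨Q, hQ⟩ := hat B hB
    exact (hQ.sub.trans hQ.sub').trans hDL
  calc ∑ B ∈ F, τ B ^ 2 * ((completeIn G R B).card : ℝ)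
      = ∑ B ∈ F, ∑ w ∈ R, if CompleteTo G w B then τ B ^ 2 else 0 := by
        refine Finset.sum_congr rfl fun B _ => ?_
        rw [← Finset.sum_filter, Finset.sum_const, nsmul_eq_mul, mul_comm]
        rfl
    _ = ∑ w ∈ R, ∑ B ∈ F with CompleteTo G w B, τ B ^ 2 := by
        rw [Finset.sum_comm]
        exact Finset.sum_congr rfl fun w _ => (Finset.sum_filter _ _).symm
    _ ≤ ∑ w ∈ R, 1 := by
        refine Finset.sum_le_sum fun w hw => ?_
        have hsub : (F.filter fun B => CompleteTo G w B) ⊆ F := Finset.filter_subset _ _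
        refine sum_sq_le_one (G := G) (D := D) (w := w) hC.tau_nonneg hC.tau_mono ?_ ?_
          (fun A hA B hB => hdis A (hsub hA) B (hsub hB)) (fun B hB => hat B (hsub hB))
          (fun B hB => (Finset.mem_filter.1 hB).2)
          fun B hB => hmax w hw B (hsub hB) (Finset.mem_filter.1 hB).2
        · intro F' hF' ha
          exact hC.sum_anticomplete F' (fun A hA => ⟨hFL A (hsub (hF' hA)), hs A (hsub (hF' hA))⟩)
            (fun A hA B hB => hdis A (hsub (hF' hA)) B (hsub (hF' hB))) ha
        · intro U hU hUc
          refine hC.sum_complete U (fun A hA => ?_) (fun A hA B hB hAB => (hUc A hA B hB hAB).1)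
            fun A hA B hB hAB => (hUc A hA B hB hAB).2
          obtain ⟨F', hF', ⟨B, hB⟩, rfl⟩ := hU A hA
          refine ⟨Finset.biUnion_subset.2 fun B hB => hFL B (hsub (hF' hB)),
            (hs B (hsub (hF' hB))).trans ?_⟩
          exact_mod_cast Finset.card_le_card (Finset.subset_biUnion_of_mem id hB)
    _ = R.card := by simp

theorem exists_prob_of_light_atoms {p : ℕ} (hp : p = 3 * (k + 2)) (hC : Crit G L s K a p τ)
    (hG : Free P5ᶜ G) {v : V} {D R R' : Finset V} (hDL : D ⊆ L) (hD : ∀ u ∈ D, G.Adj v u)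
    (hR : ∀ w ∈ R, ¬ G.Adj v w) (hR' : R' ⊆ R) {N z : ℝ} (hN : 0 < N) (hz : 0 < z) (hz4 : z ≤ 1)
    (hRN : (R.card : ℝ) ≤ N) {F : Finset (Finset V)}
    (hat : ∀ B ∈ F, ∃ Q, AtomIn G D B Q)
    (hdis : ∀ A ∈ F, ∀ B ∈ F, A ≠ B → Disjoint A B)
    (hF : ∀ B ∈ F, (D.card : ℝ) / K ^ 6 ≤ B.card)
    (hmix : ∀ B ∈ F, ((mixedIn G R B).card : ℝ) ≤ z ^ 6 * N)
    (hcom : ∀ B ∈ F, ((completeIn G R' B).card : ℝ) ≤ z ^ 12 * N)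
    (hmax : ∀ w ∈ R', ∀ B ∈ F, (∀ t ∈ B, G.Adj w t) → ∀ q ∈ B, atomOf G D w q ⊆ B)
    (hD0 : D.Nonempty) (hcov : (D.card : ℝ) ≤ 2 * (F.biUnion id).card)
    (hs : 4 * K ^ 7 * s ≤ D.card / K ^ 6)
    (hz1 : L.card * (z ^ 6) ^ (k + 1) ≤ (D.card : ℝ) / 8)
    (hz2 : L.card * (z ^ 12) ^ k ≤ (D.card : ℝ) / 8)
    (hz3 : (2 * z) ^ p * L.card ≤ (D.card : ℝ) / 4) :
    ∃ μ, ProbOn D μ ∧ bil (kern G s) μ μ ≤ a / z ∧ ∃ Y ⊆ R', (Y.card : ℝ) ≤ 2 * z ^ 4 * N ∧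
      ∀ w ∈ R', w ∉ Y → wdeg G μ w = 0 := by
  have hK := hC.K_large
  have hK0 : 0 < K := by linarith
  have hs0 := hC.s_pos
  have hd0 : (0 : ℝ) < D.card := by exact_mod_cast hD0.card_pos
  have hh0 : 0 < (D.card : ℝ) / K ^ 6 := by positivity
  have hsh : s ≤ (D.card : ℝ) / K ^ 6 := by
    refine le_trans ?_ hs
    have : (1 : ℝ) ≤ 4 * K ^ 7 := by
      have := one_le_pow₀ (n := 7) (by linarith : (1 : ℝ) ≤ K)
      linarith
    nlinarith
  have hFD : ∀ B ∈ F, B ⊆ D := fun B hB => by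
    obtain ⟨Q, hQ⟩ := hat B hB
    exact hQ.sub.trans hQ.sub'
  have hFs : ∀ B ∈ F, s ≤ B.card := fun B hB => hsh.trans (hF B hB)
  have hsumcard : ∀ F' ⊆ F, ((F'.biUnion id).card : ℝ) = ∑ B ∈ F', (B.card : ℝ) := by
    intro F' hF'
    have := Finset.card_biUnion (s := F') (t := id) fun A hA B hB =>
      hdis A (hF' hA) B (hF' hB)
    rw [this]
    push_cast
    rfl
  set F₁ := F.filter fun B => τ B ^ 3 * N < (mixedIn G R B).card with hF₁
  set F₂ := F.filter fun B => τ B ^ 3 * N < (completeIn G R' B).card with hF₂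
  set F₃ := F.filter fun B => ((mixedIn G R B).card : ℝ) ≤ τ B ^ 3 * N ∧
    ((completeIn G R' B).card : ℝ) ≤ τ B ^ 3 * N with hF₃
  have hs1 : F₁ ⊆ F := Finset.filter_subset _ _
  have hs2 : F₂ ⊆ F := Finset.filter_subset _ _
  have hs3 : F₃ ⊆ F := Finset.filter_subset _ _
  have hR'N : (R'.card : ℝ) ≤ N := le_trans (by exact_mod_cast Finset.card_le_card hR') hRN
  have hb1 : ∑ B ∈ F₁, (B.card : ℝ) ≤ D.card / 8 := by
    refine (sum_card_heavy_le hp hC hN (by positivity)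
      (m := fun B => ((mixedIn G R B).card : ℝ)) (fun B _ => Nat.cast_nonneg _)
      (fun B hB => hmix B (hs1 hB)) ?_ fun B hB => (Finset.mem_filter.1 hB).2).trans hz1
    refine le_trans ?_ hRN
    exact_mod_cast sum_card_mixedIn_le hG hD hR (fun B hB => hat B (hs1 hB))
      fun A hA B hB => hdis A (hs1 hA) B (hs1 hB)
  have hb2 : ∑ B ∈ F₂, (B.card : ℝ) ≤ D.card / 8 := by
    refine (sum_card_dominated_le hp hC (fun B hB => (hFD B (hs2 hB)).trans hDL) hN (by positivity)
      (m := fun B => ((completeIn G R' B).card : ℝ)) (fun B _ => Nat.cast_nonneg _)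
      (fun B hB => hcom B (hs2 hB)) ?_ fun B hB => (Finset.mem_filter.1 hB).2).trans hz2
    exact (sum_sq_completeIn_le hC hDL (fun B hB => hat B (hs2 hB))
      (fun A hA B hB => hdis A (hs2 hA) B (hs2 hB)) (fun B hB => hFs B (hs2 hB))
      fun w hw B hB => hmax w hw B (hs2 hB)).trans hR'N
  have hb3 : (D.card : ℝ) / 4 ≤ (F₃.biUnion id).card := by
    rw [hsumcard F subset_rfl] at hcov
    rw [hsumcard F₃ hs3]
    have hsub : F ⊆ F₁ ∪ F₂ ∪ F₃ := by
      intro B hB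
      by_cases h1 : B ∈ F₁
      · simp [h1]
      by_cases h2 : B ∈ F₂
      · simp [h2]
      refine Finset.mem_union_right _ (Finset.mem_filter.2 ⟨hB, ?_, ?_⟩)
      · by_contra h
        exact h1 (Finset.mem_filter.2 ⟨hB, not_le.1 h⟩)
      · by_contra h
        exact h2 (Finset.mem_filter.2 ⟨hB, not_le.1 h⟩)
    have h1 : ∑ B ∈ F, (B.card : ℝ) ≤ ∑ B ∈ F₁ ∪ F₂ ∪ F₃, (B.card : ℝ) :=
      Finset.sum_le_sum_of_subset_of_nonneg hsub fun _ _ _ => Nat.cast_nonneg _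
    have h2 : ∀ A B : Finset (Finset V), ∑ X ∈ A ∪ B, (X.card : ℝ) ≤
        ∑ X ∈ A, (X.card : ℝ) + ∑ X ∈ B, (X.card : ℝ) := by
      intro A B
      have := Finset.sum_union_inter (s₁ := A) (s₂ := B) (f := fun X => (X.card : ℝ))
      have h3 : 0 ≤ ∑ X ∈ A ∩ B, (X.card : ℝ) := Finset.sum_nonneg fun _ _ => Nat.cast_nonneg _
      linarith
    linarith [h2 (F₁ ∪ F₂) F₃, h2 F₁ F₂]
  have hUD : F₃.biUnion id ⊆ D := Finset.biUnion_subset.2 fun B hB => hFD B (hs3 hB)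
  have hUs : s ≤ ((F₃.biUnion id).card : ℝ) := by
    have hne : F₃.Nonempty := by
      by_contra hne
      rw [Finset.not_nonempty_iff_eq_empty] at hne
      rw [hne] at hb3
      simp at hb3
      linarith
    obtain ⟨B, hB⟩ := hne
    exact (hFs B (hs3 hB)).trans
      (by exact_mod_cast Finset.card_le_card (Finset.subset_biUnion_of_mem id hB))
  obtain ⟨μ₀, hμ₀, hq₀⟩ := hC.exists_prob_le (z := 2 * z) (by positivity) (hUD.trans hDL) hUs
    (hz3.trans hb3)
  have hpure : ∀ A ∈ F, ∀ B ∈ F, A ≠ B → CompletePair G A B ∨ AnticompletePair G A B := by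
    intro A hA B hB hAB
    obtain ⟨QA, hQA⟩ := hat A hA
    obtain ⟨QB, hQB⟩ := hat B hB
    exact hQA.pure hQB (hdis A hA B hB hAB)
  obtain ⟨J, hJ, hJa, μ, hμ, hq⟩ := exists_anticomplete_subfamily (G := G) hs0.le hh0 F₃.card F₃
    le_rfl (fun A hA B hB => hdis A (hs3 hA) B (hs3 hB))
    (fun A hA B hB => hpure A (hs3 hA) B (hs3 hB)) (fun A hA => hF A (hs3 hA)) μ₀ hμ₀
  have hJF : J ⊆ F := hJ.trans hs3
  have hcount : (F₃.card : ℝ) ≤ K ^ 6 := by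
    have h1 : (F₃.card : ℝ) * (D.card / K ^ 6) ≤ D.card := by
      calc (F₃.card : ℝ) * (D.card / K ^ 6) = ∑ B ∈ F₃, (D.card : ℝ) / K ^ 6 := by
            rw [Finset.sum_const, nsmul_eq_mul]
        _ ≤ ∑ B ∈ F₃, (B.card : ℝ) := Finset.sum_le_sum fun B hB => hF B (hs3 hB)
        _ = (F₃.biUnion id).card := (hsumcard F₃ hs3).symm
        _ ≤ D.card := by exact_mod_cast Finset.card_le_card hUD
    rw [mul_div_assoc', div_le_iff₀ (by positivity), mul_comm] at h1
    exact le_of_mul_le_mul_left h1 hd0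
  have herr : 2 * (s / (D.card / K ^ 6)) * F₃.card ≤ a / (2 * z) := by
    have h1 : s / (D.card / K ^ 6) ≤ 1 / (4 * K ^ 7) := by
      rw [div_le_div_iff₀ hh0 (by positivity)]
      linarith
    calc 2 * (s / (D.card / K ^ 6)) * F₃.card ≤ 2 * (1 / (4 * K ^ 7)) * K ^ 6 := by gcongr
      _ = 1 / K / 2 := by field_simp; norm_num
      _ ≤ a / 2 := by linarith [hC.lt_energy]
      _ ≤ a / (2 * z) := by
          have := hC.a_pos
          refine div_le_div_of_nonneg_left this.le (by positivity) (by linarith)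
  refine ⟨μ, hμ.mono (Finset.biUnion_subset.2 fun B hB => hFD B (hJF hB)), ?_, ?_⟩
  · have h1 : a / z = a / (2 * z) + a / (2 * z) := by field_simp; norm_num
    linarith
  refine ⟨J.biUnion fun B => R'.filter fun w => w ∈ mixedIn G R B ∪ completeIn G R' B,
    Finset.biUnion_subset.2 fun B _ => Finset.filter_subset _ _, ?_, ?_⟩
  · have hτJ : ∑ B ∈ J, τ B ≤ 1 := hC.sum_anticomplete J
      (fun B hB => ⟨(hFD B (hJF hB)).trans hDL, hFs B (hJF hB)⟩)
      (fun A hA B hB => hdis A (hJF hA) B (hJF hB)) hJa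
    have h1 : ∀ B ∈ J, (((R'.filter fun w => w ∈ mixedIn G R B ∪ completeIn G R' B).card : ℕ) : ℝ)
        ≤ 2 * z ^ 4 * N * τ B := by
      intro B hB
      have hτ0 := hC.tau_nonneg B
      obtain ⟨-, hm, hc⟩ := Finset.mem_filter.1 (hJ hB)
      have e1 : ∀ x : ℝ, x ≤ τ B ^ 3 * N → x ≤ z ^ 6 * N → x ≤ τ B * z ^ 4 * N := by
        intro x hx1 hx2
        rw [← div_le_iff₀ hN] at hx1 hx2 ⊢
        exact min_cube_le hτ0 hx1 hx2
      have hz12 : z ^ 12 * N ≤ z ^ 6 * N := by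
        gcongr ?_ * N
        exact pow_le_pow_of_le_one hz.le hz4 (by norm_num)
      have hm' := e1 _ hm (hmix B (hJF hB))
      have hc' := e1 _ hc ((hcom B (hJF hB)).trans hz12)
      have hle : (((R'.filter fun w => w ∈ mixedIn G R B ∪ completeIn G R' B).card : ℕ) : ℝ) ≤
          (mixedIn G R B).card + (completeIn G R' B).card := by
        have h3 : (R'.filter fun w => w ∈ mixedIn G R B ∪ completeIn G R' B) ⊆
            mixedIn G R B ∪ completeIn G R' B := fun w hw => (Finset.mem_filter.1 hw).2
        exact_mod_cast (Finset.card_le_card h3).trans (Finset.card_union_le _ _)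
      linarith
    calc _ ≤ ∑ B ∈ J,
          (((R'.filter fun w => w ∈ mixedIn G R B ∪ completeIn G R' B).card : ℕ) : ℝ) := by
          exact_mod_cast Finset.card_biUnion_le
      _ ≤ ∑ B ∈ J, 2 * z ^ 4 * N * τ B := Finset.sum_le_sum h1
      _ = 2 * z ^ 4 * N * ∑ B ∈ J, τ B := by rw [Finset.mul_sum]
      _ ≤ 2 * z ^ 4 * N * 1 := by gcongr
      _ = _ := mul_one _
  · intro w hw hwY
    refine Finset.sum_eq_zero fun u _ => ?_
    split_ifs with hwu
    swap
    · rfl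
    by_contra hu
    obtain ⟨B, hB, huB⟩ : ∃ B ∈ J, u ∈ B := by
      by_contra h
      exact hu (hμ.supp u fun h' => h (by simpa using h'))
    refine hwY (Finset.mem_biUnion.2 ⟨B, hB, Finset.mem_filter.2 ⟨hw, ?_⟩⟩)
    by_cases hc : CompleteTo G w B
    · exact Finset.mem_union_right _ (Finset.mem_filter.2 ⟨hw, hc⟩)
    · simp only [CompleteTo] at hc
      push Not at hc
      exact Finset.mem_union_left _ (Finset.mem_filter.2 ⟨hR' hw, ⟨u, huB, hwu⟩, hc⟩)

end Atoms

end

noncomputable section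

variable {V : Type*} [Fintype V]

theorem pow_scale_bounds {z : ℝ} (hz : 0 < z) (hz4 : z ≤ 1 / 4) {e k : ℕ} (hk : 26 + e ≤ k) :
    (z ^ 6) ^ (k + 1) ≤ z ^ (24 + e) / 16 ∧ (z ^ 12) ^ k ≤ z ^ (24 + e) / 16 ∧
      (2 * z) ^ (3 * (k + 2)) ≤ z ^ (24 + e) / 16 := by
  have h0 : z ^ (26 + e) ≤ z ^ (24 + e) / 16 := by
    have h1 : z ^ 2 ≤ 1 / 16 := by nlinarith
    calc z ^ (26 + e) = z ^ (24 + e) * z ^ 2 := by ring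
      _ ≤ z ^ (24 + e) * (1 / 16) := by gcongr
      _ = _ := by ring
  have hz1 : z ≤ 1 := by linarith
  refine ⟨?_, ?_, ?_⟩
  · rw [← pow_mul]
    exact (pow_le_pow_of_le_one hz.le hz1 (by omega)).trans h0
  · rw [← pow_mul]
    exact (pow_le_pow_of_le_one hz.le hz1 (by omega)).trans h0
  · have h2 : (2 * z) ^ 2 ≤ z := by nlinarith
    calc (2 * z) ^ (3 * (k + 2)) ≤ (2 * z) ^ (2 * (26 + e)) :=
          pow_le_pow_of_le_one (by positivity) (by linarith) (by omega)
      _ = ((2 * z) ^ 2) ^ (26 + e) := by rw [pow_mul]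
      _ ≤ z ^ (26 + e) := by gcongr
      _ ≤ _ := h0

theorem exists_cluster {G : SimpleGraph V} {L : Finset V} {s K a : ℝ} {k p : ℕ}
    {τ : Finset V → ℝ} (hp : p = 3 * (k + 2)) (hC : Crit G L s K a p τ) (hG : Free P5ᶜ G)
    {S W : Finset V} (hSL : S ⊆ L) (hWS : W ⊆ S) {v : V} (hv : v ∈ W) {z : ℝ} (hz : 0 < z)
    (hz4 : z ≤ 1 / 4) (hdeg : ∀ u ∈ S, ((nbrsIn G u S).card : ℝ) ≤ z ^ 12 * S.card)
    (hzK : 1 / K < 2 * z ^ 12) (hvW : z ^ 24 * S.card / 2 < (nbrsIn G v W).card) {e : ℕ}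
    (hk : 26 + e ≤ k) (hS : z ^ e * L.card ≤ S.card) (hs : 8 * K ^ 13 * s ≤ z ^ 24 * S.card) :
    ∃ μ, ∃ E ⊆ W, ProbOn E μ ∧ (E.card : ℝ) ≤ z / 3 * S.card ∧ bil (kern G s) μ μ ≤ a / z ∧
      ∀ w ∈ W, w ∉ E → wdeg G μ w ≤ 1 / (3 * K) := by
  have hK := hC.K_large
  have hK0 : 0 < K := by linarith
  have hs0 := hC.s_pos
  have hN : (0 : ℝ) < S.card := by exact_mod_cast Finset.card_pos.2 ⟨v, hWS hv⟩
  have hz1 : z ≤ 1 := by linarith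
  have hpow : ∀ i, 4 ≤ i → z ^ i ≤ z ^ 4 := fun i hi => pow_le_pow_of_le_one hz.le hz1 hi
  obtain ⟨b1, b2, b3⟩ := pow_scale_bounds hz hz4 hk
  set D := nbrsIn G v W with hD
  have hDW : D ⊆ W := nbrsIn_subset _ _ _
  have hDv : ∀ u ∈ D, G.Adj v u := fun u hu => (mem_nbrsIn.1 hu).2
  have hD0 : D.Nonempty := by
    rw [← Finset.card_pos]
    have : (0 : ℝ) < D.card := lt_of_le_of_lt (by positivity) hvW
    exact_mod_cast this
  have hD1 : (1 : ℝ) ≤ D.card := by exact_mod_cast hD0.card_pos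
  have hDN : (D.card : ℝ) ≤ z ^ 12 * S.card :=
    le_trans (by exact_mod_cast card_nbrsIn_mono G v hWS) (hdeg v (hWS hv))
  have hLD : z ^ (24 + e) * L.card ≤ 2 * D.card := by
    calc z ^ (24 + e) * L.card = z ^ 24 * (z ^ e * L.card) := by ring
      _ ≤ z ^ 24 * S.card := by gcongr
      _ ≤ 2 * D.card := by linarith
  have hsD : 4 * K ^ 13 * s ≤ D.card := by linarith
  have hDL : D ⊆ L := (hDW.trans hWS).trans hSL
  set R := W.filter fun w => w ≠ v ∧ ¬ G.Adj v w with hR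
  have hRv : ∀ w ∈ R, ¬ G.Adj v w := fun w hw => (Finset.mem_filter.1 hw).2.2
  have hRW : R ⊆ W := Finset.filter_subset _ _
  have hRS : R ⊆ S := hRW.trans hWS
  have hRN : (R.card : ℝ) ≤ S.card := by exact_mod_cast Finset.card_le_card hRS
  have hdegR : ∀ q ∈ S, ((nbrsIn G q R).card : ℝ) ≤ z ^ 12 * S.card := fun q hq =>
    le_trans (by exact_mod_cast card_nbrsIn_mono G q hRS) (hdeg q hq)
  obtain ⟨X, hXR, hX, F, hat, hdis, hFh, hmix, hsmall, hmax⟩ :=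
    exists_light_atoms (h := (D.card : ℝ) / K ^ 6) hG hDv hRv (pow_pos hz 6) hRN fun q hq => by
      rw [← pow_mul]; exact hdegR q (hWS (hDW hq))
  set R' := R \ X with hR'
  have hR'R : R' ⊆ R := Finset.sdiff_subset
  have hR'N : (R'.card : ℝ) ≤ S.card :=
    le_trans (by exact_mod_cast Finset.card_le_card hR'R) hRN
  suffices h : ∃ μ, ProbOn D μ ∧ bil (kern G s) μ μ ≤ a / z ∧ ∃ Y ⊆ R',
      (Y.card : ℝ) ≤ 2 * z ^ 4 * S.card ∧ ∀ w ∈ R', w ∉ Y → wdeg G μ w ≤ 1 / (3 * K) by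
    obtain ⟨μ, hμ, hq, Y, hYR, hY, hw⟩ := h
    refine ⟨μ, D ∪ {v} ∪ X ∪ Y, ?_, hμ.mono ?_, ?_, hq, ?_⟩
    · exact Finset.union_subset (Finset.union_subset (Finset.union_subset hDW
        (Finset.singleton_subset_iff.2 hv)) (hXR.trans hRW)) ((hYR.trans hR'R).trans hRW)
    · intro x hx
      simp [hx]
    · have hc : ((D ∪ {v} ∪ X ∪ Y).card : ℝ) ≤ D.card + 1 + X.card + Y.card := by
        have h1 := Finset.card_union_le (D ∪ {v} ∪ X) Y
        have h2 := Finset.card_union_le (D ∪ {v}) X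
        have h3 := Finset.card_union_le D {v}
        rw [Finset.card_singleton] at h3
        exact_mod_cast (by omega : (D ∪ {v} ∪ X ∪ Y).card ≤ D.card + 1 + X.card + Y.card)
      have h6 := mul_le_mul_of_nonneg_right (hpow 6 (by norm_num)) hN.le
      have h12 := mul_le_mul_of_nonneg_right (hpow 12 (by norm_num)) hN.le
      have hz3 : 5 * z ^ 4 ≤ z / 3 := by
        have : z ^ 3 ≤ (1 / 4) ^ 3 := by gcongr
        nlinarith
      have := mul_le_mul_of_nonneg_right hz3 hN.le
      linarith
    · intro w hwW hwE
      simp only [Finset.mem_union, Finset.mem_singleton, not_or] at hwE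
      obtain ⟨⟨⟨h1, h2⟩, h3⟩, h4⟩ := hwE
      refine hw w (Finset.mem_sdiff.2 ⟨Finset.mem_filter.2 ⟨hwW, h2, fun h => h1 ?_⟩, h3⟩) h4
      exact mem_nbrsIn.2 ⟨hwW, h⟩
  by_cases hcase : (D.card : ℝ) ≤ 2 * (F.biUnion id).card
  · have hs' : 4 * K ^ 7 * s ≤ D.card / K ^ 6 := by
      rw [le_div_iff₀ (by positivity)]
      linarith [show 4 * K ^ 7 * s * K ^ 6 = 4 * K ^ 13 * s by ring]
    have hLn : (0 : ℝ) ≤ L.card := Nat.cast_nonneg _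
    have c1 := mul_le_mul_of_nonneg_right b1 hLn
    have c2 := mul_le_mul_of_nonneg_right b2 hLn
    have c3 := mul_le_mul_of_nonneg_right b3 hLn
    obtain ⟨μ, hμ, hq, Y, hYR, hY, hw⟩ := exists_prob_of_light_atoms hp hC hG hDL hDv hRv hR'R hN
      hz hz1 hRN hat hdis hFh hmix (fun B hB => by
        obtain ⟨Q, hQ⟩ := hat B hB
        obtain ⟨q, hq⟩ := hQ.nonempty
        refine le_trans ?_ (hdegR q (hWS (hDW (hQ.sub' (hQ.sub hq)))))
        have h4 : completeIn G R' B ⊆ nbrsIn G q R := by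
          intro w hw
          obtain ⟨hwR, hwB⟩ := Finset.mem_filter.1 hw
          exact mem_nbrsIn.2 ⟨hR'R hwR, (hwB q hq).symm⟩
        exact_mod_cast Finset.card_le_card h4)
      (fun w hw => hmax w (Finset.mem_sdiff.1 hw).1 (Finset.mem_sdiff.1 hw).2) hD0 hcase hs'
      (by linarith) (by linarith) (by rw [hp]; linarith)
    refine ⟨μ, hμ, hq, Y, hYR, hY, fun w hw1 hw2 => ?_⟩
    rw [hw w hw1 hw2]
    positivity
  · set D₁ := D \ F.biUnion id with hD₁
    have hD₁D : D₁ ⊆ D := Finset.sdiff_subset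
    have hcard : (D.card : ℝ) ≤ 2 * D₁.card := by
      have h1 : D.card ≤ D₁.card + (F.biUnion id).card := by
        have h2 := Finset.card_le_card (show D ⊆ D₁ ∪ F.biUnion id from fun x hx => by
          by_cases hx' : x ∈ F.biUnion id
          · exact Finset.mem_union_right _ hx'
          · exact Finset.mem_union_left _ (Finset.mem_sdiff.2 ⟨hx, hx'⟩))
        exact h2.trans (Finset.card_union_le _ _)
      have h1' : (D.card : ℝ) ≤ D₁.card + (F.biUnion id).card := by exact_mod_cast h1
      linarith
    have hzD : z ^ p * L.card ≤ D.card / 4 := by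
      have h1 : z ^ p ≤ (2 * z) ^ p := by gcongr; linarith
      have h2 := mul_le_mul_of_nonneg_right (h1.trans (hp ▸ b3)) (Nat.cast_nonneg (α := ℝ) L.card)
      linarith
    have hs6 : s * K ^ 6 ≤ D.card := by
      have h1 : K ^ 6 ≤ K ^ 13 := pow_le_pow_right₀ (by linarith) (by norm_num)
      have h2 := mul_le_mul_of_nonneg_left h1 hs0.le
      have h3 : 0 ≤ K ^ 13 * s := by positivity
      linarith
    obtain ⟨μ, hμ, hq, hbad⟩ := exists_prob_of_small_atoms hC hz hDL hD₁D hD0 hcard hR'N hs6 hzD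
      fun w hw q hq => by
        obtain ⟨hq1, hq2⟩ := mem_nbrsIn.1 hq
        obtain ⟨hqD, hqF⟩ := Finset.mem_sdiff.1 hq1
        rcases hsmall w (Finset.mem_sdiff.1 hw).1 (Finset.mem_sdiff.1 hw).2 q
          (mem_nbrsIn.2 ⟨hqD, hq2⟩) with h | ⟨B, hB, hqB⟩
        · exact h.le
        · exact absurd (Finset.mem_biUnion.2 ⟨B, hB, hqB⟩) hqF
    refine ⟨μ, hμ.mono hD₁D, hq, _, Finset.filter_subset _ _, hbad.trans ?_, fun w hw hwY => ?_⟩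
    · gcongr ?_ * _
      have h1 : (1 / K) ^ 3 ≤ (2 * z ^ 12) ^ 3 := by gcongr
      have h2 : z ^ 32 ≤ (1 / 4) ^ 32 := by gcongr
      calc 36 / K ^ 3 = 36 * (1 / K) ^ 3 := by field_simp
        _ ≤ 36 * (2 * z ^ 12) ^ 3 := by gcongr
        _ = 288 * z ^ 4 * z ^ 32 := by ring
        _ ≤ 288 * z ^ 4 * (1 / 4) ^ 32 := by gcongr
        _ = z ^ 4 * (288 * (1 / 4) ^ 32) := by ring
        _ ≤ z ^ 4 * 2 := by gcongr; norm_num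
        _ = 2 * z ^ 4 := mul_comm _ _
    · by_contra h
      exact hwY (Finset.mem_filter.2 ⟨hw, not_le.1 h⟩)

end

noncomputable section

variable {V : Type*} [Fintype V]

/-- Gluing clusters with few outward edges gives a weight of low energy. -/
theorem exists_prob_of_clusters {G : SimpleGraph V} {S : Finset V} {s a z ξ : ℝ} (ha : 0 < a)
    (hz : 0 < z) (hξ : 0 ≤ ξ)
    (hcl : ∀ W ⊆ S, (S.card : ℝ) / 2 ≤ W.card → ∃ μ, ∃ E ⊆ W, ProbOn E μ ∧
      (E.card : ℝ) ≤ z / 3 * S.card ∧ bil (kern G s) μ μ ≤ a / z ∧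
      ∀ w ∈ W, w ∉ E → wdeg G μ w ≤ ξ) :
    ∀ (m : ℕ) (W : Finset V), W.card ≤ m → W ⊆ S → (S.card : ℝ) / 2 < W.card →
      ∃ μ, ProbOn W μ ∧
        bil (kern G s) μ μ ≤ a * S.card / (3 * (W.card - S.card / 2)) + ξ := by
  have hk := kern_symm G s
  intro m
  induction m with
  | zero =>
    intro W hW _ h
    have : W.card = 0 := by omega
    rw [this, Nat.cast_zero] at h
    have : (0 : ℝ) ≤ S.card := Nat.cast_nonneg _
    linarith
  | succ m ih =>
    intro W hW hWS h
    have hN : (0 : ℝ) < S.card := by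
      have h1 : (W.card : ℝ) ≤ S.card := by exact_mod_cast Finset.card_le_card hWS
      have h2 : (0 : ℝ) ≤ S.card := Nat.cast_nonneg _
      linarith
    obtain ⟨μ, E, hEW, hμ, hE, hq, hw⟩ := hcl W hWS h.le
    have hcard : ((W \ E).card : ℝ) + E.card = W.card := by
      exact_mod_cast Finset.card_sdiff_add_card_eq_card hEW
    have hE0 := hμ.nonempty.card_pos
    by_cases h2 : (S.card : ℝ) / 2 < (W \ E).card
    · obtain ⟨ν, hν, hqν⟩ := ih (W \ E)
        (by have := Finset.card_sdiff_add_card_eq_card hEW; omega)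
        (Finset.sdiff_subset.trans hWS) h2
      have h12 : bil (kern G s) μ ν ≤ ξ := by
        rw [bil_comm hk, bil_eq_sum_wdeg G hν.supp hμ.supp Finset.sdiff_disjoint]
        calc ∑ u, ν u * wdeg G μ u ≤ ∑ u, ν u * ξ := by
              refine Finset.sum_le_sum fun u _ => ?_
              by_cases hu : u ∈ W \ E
              · exact mul_le_mul_of_nonneg_left
                  (hw u (Finset.mem_sdiff.1 hu).1 (Finset.mem_sdiff.1 hu).2) (hν.nonneg u)
              · simp [hν.supp u hu]
          _ = ξ := by rw [← Finset.sum_mul, hν.sum_eq, one_mul]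
      have ht : 0 < ((W \ E).card : ℝ) - S.card / 2 := by linarith
      obtain ⟨ρ, hρ, hqρ⟩ := exists_mix_two hk hμ hν (b₁ := a / z)
        (b₂ := a * S.card / (3 * ((W \ E).card - S.card / 2))) (ξ := ξ)
        (by positivity) (by positivity) h12 (by linarith) hqν
      refine ⟨ρ, hρ.mono (Finset.union_subset hEW Finset.sdiff_subset), hqρ.trans ?_⟩
      gcongr ?_ + ξ
      have ht' : 0 < (W.card : ℝ) - S.card / 2 := by linarith
      have e1 : 1 / (1 / (a / z) + 1 / (a * S.card / (3 * ((W \ E).card - S.card / 2)))) =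
          a * S.card / (z * S.card + 3 * ((W \ E).card - S.card / 2)) := by
        field_simp
      rw [e1]
      refine div_le_div_of_nonneg_left (by positivity) (by positivity) ?_
      linarith
    · refine ⟨μ, hμ.mono hEW, hq.trans ?_⟩
      have ht' : 0 < (W.card : ℝ) - S.card / 2 := by linarith
      have : a / z ≤ a * S.card / (3 * (W.card - S.card / 2)) := by
        rw [div_le_div_iff₀ hz (by positivity), mul_assoc]
        refine mul_le_mul_of_nonneg_left ?_ ha.le
        linarith
      linarith

theorem Crit.false_of_dense {G : SimpleGraph V} {L : Finset V} {s K a : ℝ} {k p : ℕ}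
    {τ : Finset V → ℝ} (hp : p = 3 * (k + 2)) (hC : Crit G L s K a p τ) (hG : Free P5ᶜ G)
    {S : Finset V} (hSL : S ⊆ L) (hS0 : S.Nonempty) {z : ℝ} (hz : 0 < z)
    (hz4 : z ≤ 1 / 4) (hdeg : ∀ u ∈ S, ((nbrsIn G u S).card : ℝ) ≤ z ^ 12 * S.card)
    (hzK : 1 / K < 2 * z ^ 12) {e : ℕ} (hk : 26 + e ≤ k) (hS : z ^ e * L.card ≤ S.card)
    (hs : 8 * K ^ 13 * s ≤ z ^ 24 * S.card)
    (hdense : ∀ W ⊆ S, (S.card : ℝ) / 2 ≤ W.card →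
      ∃ v ∈ W, z ^ 24 * S.card / 2 < (nbrsIn G v W).card) : False := by
  have hK := hC.K_large
  have hK0 : 0 < K := by linarith
  have hN : (0 : ℝ) < S.card := by exact_mod_cast hS0.card_pos
  obtain ⟨μ, hμ, hq⟩ := exists_prob_of_clusters (G := G) (s := s) hC.a_pos hz
    (by positivity : 0 ≤ 1 / (3 * K)) (fun W hWS hW => by
      obtain ⟨v, hv, hvW⟩ := hdense W hWS hW
      exact exists_cluster hp hC hG hSL hWS hv hz hz4 hdeg hzK hvW hk hS hs)
    S.card S le_rfl subset_rfl (by linarith)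
  have h1 := hC.le_energy μ (hμ.mono hSL)
  have h2 : a * S.card / (3 * (S.card - S.card / 2)) = 2 / 3 * a := by
    field_simp
    ring
  have h3 : 1 / (3 * K) = 1 / K / 3 := by field_simp
  rw [h2, h3] at hq
  linarith [hC.lt_energy]

end

noncomputable section

theorem Crit.noPure {V : Type*} [Fintype V] {G : SimpleGraph V} {L : Finset V} {s K a : ℝ} {p : ℕ}
    {τ : Finset V → ℝ} (hC : Crit G L s K a p τ) {g : ℝ} (hsg : s ≤ g)
    (hg : (3 / 4) ^ p * L.card ≤ g) : NoPure G L g := by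
  intro A hA B hB hAB hgA hgB
  have hs0 := hC.s_pos
  have hA0 : A.Nonempty := Finset.card_pos.1 (by
    have : (0 : ℝ) < A.card := by linarith
    exact_mod_cast this)
  have hne : A ≠ B := by
    rintro rfl
    exact hA0.ne_empty (Finset.disjoint_self_iff_empty _ |>.1 hAB)
  have h1 : 3 / 4 ≤ τ A := hC.le_tau (hg.trans hgA)
  have h2 : 3 / 4 ≤ τ B := hC.le_tau (hg.trans hgB)
  have hsize : ∀ C ∈ ({A, B} : Finset (Finset V)), C ⊆ L ∧ s ≤ C.card := by
    intro C hC'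
    rcases Finset.mem_insert.1 hC' with rfl | h
    · exact ⟨hA, hsg.trans hgA⟩
    · rw [Finset.mem_singleton.1 h]; exact ⟨hB, hsg.trans hgB⟩
  have hdis : ∀ C ∈ ({A, B} : Finset (Finset V)), ∀ D ∈ ({A, B} : Finset (Finset V)), C ≠ D →
      Disjoint C D := by
    intro C hC' D hD hCD
    simp only [Finset.mem_insert, Finset.mem_singleton] at hC' hD
    rcases hC' with rfl | rfl <;> rcases hD with rfl | rfl
    exacts [absurd rfl hCD, hAB, hAB.symm, absurd rfl hCD]
  constructor
  · intro hcomp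
    have := hC.sum_complete {A, B} hsize hdis (by
      intro C hC' D hD hCD
      simp only [Finset.mem_insert, Finset.mem_singleton] at hC' hD
      rcases hC' with rfl | rfl <;> rcases hD with rfl | rfl
      exacts [absurd rfl hCD, hcomp, fun x hx y hy => (hcomp y hy x hx).symm, absurd rfl hCD])
    rw [Finset.sum_pair hne] at this
    linarith
  · intro hanti
    have := hC.sum_anticomplete {A, B} hsize hdis (by
      intro C hC' D hD hCD
      simp only [Finset.mem_insert, Finset.mem_singleton] at hC' hD
      rcases hC' with rfl | rfl <;> rcases hD with rfl | rfl
      exacts [absurd rfl hCD, hanti, fun x hx y hy h => hanti y hy x hx h.symm, absurd rfl hCD])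
    rw [Finset.sum_pair hne] at this
    linarith

theorem Crit.lt_of_sparseOn {V : Type*} [Fintype V] {G : SimpleGraph V} {L : Finset V}
    {s K a : ℝ} {p : ℕ} {τ : Finset V → ℝ} (hC : Crit G L s K a p τ) {S : Finset V} (hSL : S ⊆ L)
    {y : ℝ} (hS : SparseOn G S y) (hs : 2 * K * s ≤ S.card) : 1 / K < 2 * y := by
  have hK := hC.K_large
  have hs0 := hC.s_pos
  have hK0 : 0 < K := by linarith
  have hN : (0 : ℝ) < S.card := lt_of_lt_of_le (by positivity) hs
  have hS0 : S.Nonempty := Finset.card_pos.1 (by exact_mod_cast hN)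
  have h1 := hC.le_energy _ ((unif_probOn hS0).mono hSL)
  have h2 := bil_unif_le G (s := s) hS0 hS
  have h3 : (y * S.card + s) / S.card ≤ y + 1 / (2 * K) := by
    rw [add_div, mul_div_cancel_right₀ _ hN.ne']
    refine add_le_add_right ?_ _
    rw [div_le_div_iff₀ hN (by positivity)]
    linarith
  have h4 : 1 / (2 * K) = 1 / K / 2 := by field_simp
  have := hC.lt_energy
  rw [h4] at h3
  linarith

/-- Iterating `Crit.false_of_dense` produces sparser and sparser sets, until the energy bound is
violated. -/
theorem Crit.false_of_sparse {V : Type*} [Fintype V] {G : SimpleGraph V} {L : Finset V}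
    {s K a : ℝ} {k p : ℕ} {τ : Finset V → ℝ} (hp : p = 3 * (k + 2)) (hC : Crit G L s K a p τ)
    (hG : Free P5ᶜ G) {δ : ℝ} {m : ℕ} (hδ : (1 / 4) ^ m ≤ δ) (hk : 38 + m ≤ k)
    (hL : K ^ (16 + 5 * (12 + m)) * s ≤ L.card)
    (hS : ∃ S ⊆ L, δ * L.card ≤ S.card ∧ SparseOn G S ((1 / 4) ^ 12)) : False := by
  have hK := hC.K_large
  have hs0 := hC.s_pos
  have hK0 : 0 < K := by linarith
  have hK1 : 1 ≤ K := by linarith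
  have hn : (0 : ℝ) < L.card := by exact_mod_cast hC.card_pos
  have hδ0 : 0 < δ := lt_of_lt_of_le (by positivity) hδ
  have main : ∀ j : ℕ, 1 ≤ ((1 / 4 : ℝ) ^ 2 ^ j) ^ 12 * K ^ 5 ∧
      ∃ S ⊆ L, (1 / 2) ^ j * δ * L.card ≤ S.card ∧ SparseOn G S (((1 / 4) ^ 2 ^ j) ^ 12) := by
    have step : ∀ j : ℕ, 1 ≤ ((1 / 4 : ℝ) ^ 2 ^ j) ^ 12 * K ^ 5 → ∀ S ⊆ L,
        (1 / 2) ^ j * δ * L.card ≤ S.card → SparseOn G S (((1 / 4) ^ 2 ^ j) ^ 12) →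
        1 / K < 2 * ((1 / 4 : ℝ) ^ 2 ^ j) ^ 12 ∧
        ∃ W ⊆ S, (S.card : ℝ) / 2 ≤ W.card ∧ SparseOn G W (((1 / 4) ^ 2 ^ j) ^ 24) := by
      intro j hj S hSL hSc hSp
      have hz : (0 : ℝ) < (1 / 4) ^ 2 ^ j := by positivity
      have hz4 : (1 / 4 : ℝ) ^ 2 ^ j ≤ 1 / 4 :=
        pow_le_of_le_one (by norm_num) (by norm_num) (by positivity)
      have hz12 : ((1 / 4 : ℝ) ^ 2 ^ j) ^ 12 ≤ (1 / 2) ^ j := by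
        have e1 : ((1 / 4 : ℝ) ^ 2 ^ j) ^ 12 = (1 / 2) ^ (2 ^ j * 24) := by
          rw [show (1 / 4 : ℝ) = (1 / 2) ^ 2 by norm_num, ← pow_mul, ← pow_mul]
          congr 1
          ring
        rw [e1]
        refine pow_le_pow_of_le_one (by norm_num) (by norm_num) ?_
        have := (Nat.lt_two_pow_self (n := j)).le
        omega
      generalize ((1 / 4 : ℝ) ^ 2 ^ j) = z at *
      have hz1 : z ≤ 1 := hz4.trans (by norm_num)
      have hSe : z ^ (12 + m) * L.card ≤ S.card := by
        refine le_trans ?_ hSc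
        rw [pow_add]
        gcongr
        exact (pow_le_pow_left₀ hz.le hz4 m).trans hδ
      have hSK : K ^ 16 * s ≤ S.card := by
        refine le_trans ?_ hSe
        have h1 : 1 ≤ z ^ (12 + m) * K ^ (5 * (12 + m)) := by
          calc (1 : ℝ) ≤ (z ^ 12 * K ^ 5) ^ (12 + m) := one_le_pow₀ hj
            _ = (z ^ (12 + m)) ^ 12 * K ^ (5 * (12 + m)) := by ring
            _ ≤ z ^ (12 + m) * K ^ (5 * (12 + m)) := by
              gcongr
              exact pow_le_of_le_one (by positivity) (pow_le_one₀ hz.le hz1) (by norm_num)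
        calc K ^ 16 * s = 1 * (K ^ 16 * s) := by ring
          _ ≤ z ^ (12 + m) * K ^ (5 * (12 + m)) * (K ^ 16 * s) := by gcongr
          _ = z ^ (12 + m) * (K ^ (16 + 5 * (12 + m)) * s) := by ring
          _ ≤ z ^ (12 + m) * L.card := by gcongr
      have h2K : 1 / K < 2 * z ^ 12 := by
        refine hC.lt_of_sparseOn hSL hSp (le_trans ?_ hSK)
        refine mul_le_mul_of_nonneg_right ?_ hs0.le
        calc 2 * K ≤ K * K := by gcongr; linarith
          _ = K ^ 2 := by ring
          _ ≤ K ^ 16 := pow_le_pow_right₀ hK1 (by norm_num)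
      refine ⟨h2K, ?_⟩
      by_contra hcon
      push Not at hcon
      have hS0 : S.Nonempty := Finset.card_pos.1 (by
        have : (0 : ℝ) < S.card := lt_of_lt_of_le (by positivity) hSe
        exact_mod_cast this)
      refine hC.false_of_dense hp hG hSL hS0 hz hz4 hSp h2K (e := 12 + m) (by omega) hSe ?_ ?_
      · have h24 : 1 ≤ z ^ 24 * (4 * K ^ 2) := by
          have : 1 < 2 * z ^ 12 * K := by rwa [div_lt_iff₀ hK0] at h2K
          nlinarith
        calc 8 * K ^ 13 * s = 1 * (8 * K ^ 13 * s) := by ring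
          _ ≤ z ^ 24 * (4 * K ^ 2) * (8 * K ^ 13 * s) := by gcongr
          _ = z ^ 24 * (32 * (K ^ 15 * s)) := by ring
          _ ≤ z ^ 24 * (K * (K ^ 15 * s)) := by gcongr
          _ = z ^ 24 * (K ^ 16 * s) := by ring
          _ ≤ z ^ 24 * S.card := by gcongr
      · intro W hWS hW
        have := hcon W hWS hW
        unfold SparseOn at this
        push Not at this
        obtain ⟨v, hv, hlt⟩ := this
        refine ⟨v, hv, lt_of_le_of_lt ?_ hlt⟩
        rw [mul_div_assoc]
        gcongr
    intro j
    induction j with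
    | zero =>
      refine ⟨?_, by simpa using hS⟩
      calc (1 : ℝ) ≤ ((1 / 4 : ℝ) ^ 2 ^ 0) ^ 12 * 32 ^ 5 := by norm_num
        _ ≤ _ := by gcongr
    | succ j ih =>
      obtain ⟨hj, S, hSL, hSc, hSp⟩ := ih
      obtain ⟨h2K, W, hWS, hW, hWp⟩ := step j hj S hSL hSc hSp
      have e1 : ((1 / 4 : ℝ) ^ 2 ^ (j + 1)) ^ 12 = ((1 / 4) ^ 2 ^ j) ^ 24 := by
        rw [pow_succ 2 j, pow_mul, ← pow_mul _ 2 12]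
      rw [e1]
      refine ⟨?_, W, hWS.trans hSL, ?_, hWp⟩
      · have hz : (0 : ℝ) < (1 / 4) ^ 2 ^ j := by positivity
        generalize ((1 / 4 : ℝ) ^ 2 ^ j) = z at *
        have h1 : 1 < 2 * z ^ 12 * K := by rwa [div_lt_iff₀ hK0] at h2K
        have h24 : 1 ≤ z ^ 24 * (4 * K ^ 2) := by nlinarith
        refine h24.trans ?_
        gcongr
        calc 4 * K ^ 2 ≤ K * K ^ 2 := by gcongr; linarith
          _ = K ^ 3 := by ring
          _ ≤ K ^ 5 := pow_le_pow_right₀ hK1 (by norm_num)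
      · rw [pow_succ]
        linarith
  obtain ⟨j, hj⟩ := exists_pow_lt_of_lt_one (show (0 : ℝ) < 1 / K ^ 5 by positivity)
    (show (1 / 4 : ℝ) < 1 by norm_num)
  have h1 := (main j).1
  have h2 : ((1 / 4 : ℝ) ^ 2 ^ j) ^ 12 ≤ (1 / 4) ^ j := by
    rw [← pow_mul]
    refine pow_le_pow_of_le_one (by norm_num) (by norm_num) ?_
    have := (Nat.lt_two_pow_self (n := j)).le
    omega
  rw [lt_div_iff₀ (by positivity)] at hj
  have h3 := mul_le_mul_of_nonneg_right h2 (by positivity : 0 ≤ K ^ 5)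
  linarith

theorem exists_crit_false : ∃ p : ℕ, 0 < p ∧ ∃ c : ℕ, ∀ (V : Type) [Fintype V]
    (G : SimpleGraph V) (L : Finset V) (s K a : ℝ) (τ : Finset V → ℝ), Free P5ᶜ G → 1 ≤ s →
    K ^ c * s ≤ L.card → ¬ Crit G L s K a p τ := by
  obtain ⟨δ, hδ, η, hη, H⟩ := exists_sparse_of_noPure (y := (1 / 4) ^ 12) (by positivity)
    (by norm_num)
  obtain ⟨m, hm⟩ := exists_pow_lt_of_lt_one hδ (show (1 / 4 : ℝ) < 1 by norm_num)
  obtain ⟨k, hk⟩ := exists_pow_lt_of_lt_one hη (show (3 / 4 : ℝ) < 1 by norm_num)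
  obtain ⟨c, hc⟩ := exists_pow_lt_of_lt_one hη (show (1 / 32 : ℝ) < 1 by norm_num)
  refine ⟨3 * (38 + m + k + 2), by omega, c + (16 + 5 * (12 + m)), ?_⟩
  intro V _ G L s K a τ hG hs hL hC
  have hK := hC.K_large
  have hK1 : 1 ≤ K := by linarith
  have hs0 := hC.s_pos
  have hηs : s ≤ η * L.card := by
    have h1 : 1 ≤ η * K ^ c := by
      calc (1 : ℝ) = (1 / 32) ^ c * 32 ^ c := by rw [← mul_pow]; norm_num
        _ ≤ η * K ^ c := by gcongr
    calc s = 1 * (1 * s) := by ring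
      _ ≤ η * K ^ c * (K ^ (16 + 5 * (12 + m)) * s) := by
        gcongr
        exact one_le_pow₀ hK1
      _ = η * (K ^ (c + (16 + 5 * (12 + m))) * s) := by ring
      _ ≤ η * L.card := by gcongr
  have hL' : K ^ (16 + 5 * (12 + m)) * s ≤ L.card := by
    refine le_trans ?_ hL
    exact mul_le_mul_of_nonneg_right (pow_le_pow_right₀ hK1 (by omega)) hs0.le
  refine hC.false_of_sparse rfl hG hm.le (by omega) hL' (H V G hG L (by linarith) ?_)
  refine hC.noPure hηs ?_
  gcongr
  refine (pow_le_pow_of_le_one (by norm_num) (by norm_num) ?_).trans hk.le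
  omega

end

noncomputable section

section Energy

variable {V : Type*} [Fintype V]

/-- The minimum of the quadratic form of `k` over probability weights supported on `L`. -/
def energy (k : V → V → ℝ) (L : Finset V) : ℝ :=
  if h : ∃ μ, ProbOn L μ then
    bil k (exists_minimizer k h).choose (exists_minimizer k h).choose else 0

theorem exists_bil_eq_energy (k : V → V → ℝ) {L : Finset V} (hL : L.Nonempty) :
    ∃ μ, ProbOn L μ ∧ bil k μ μ = energy k L := by
  have h : ∃ μ, ProbOn L μ := ⟨_, unif_probOn hL⟩
  refine ⟨(exists_minimizer k h).choose, (exists_minimizer k h).choose_spec.1, ?_⟩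
  rw [energy, dif_pos h]

theorem energy_le (k : V → V → ℝ) {L : Finset V} {μ : V → ℝ} (hμ : ProbOn L μ) :
    energy k L ≤ bil k μ μ := by
  have h : ∃ μ, ProbOn L μ := ⟨_, hμ⟩
  rw [energy, dif_pos h]
  exact (exists_minimizer k h).choose_spec.2 μ hμ

theorem energy_anti (k : V → V → ℝ) {A L : Finset V} (hA : A.Nonempty) (h : A ⊆ L) :
    energy k L ≤ energy k A := by
  obtain ⟨μ, hμ, he⟩ := exists_bil_eq_energy k hA
  exact he ▸ energy_le k (hμ.mono h)

theorem energy_le_two (H : SimpleGraph V) {s : ℝ} {L : Finset V} (hL : L.Nonempty)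
    (hs : s ≤ L.card) : energy (kern H s) L ≤ 2 := by
  refine (energy_le _ (unif_probOn hL)).trans ?_
  refine (bil_unif_le H (d := L.card) hL fun u _ => ?_).trans ?_
  · exact_mod_cast Finset.card_le_card (nbrsIn_subset H u L)
  · have : (0 : ℝ) < L.card := by exact_mod_cast hL.card_pos
    rw [div_le_iff₀ this]
    linarith

theorem sum_le_one_of_energy {H : SimpleGraph V} {s : ℝ} {L : Finset V} {τ : Finset V → ℝ}
    (hpos : 0 < energy (kern H s) L) {F : Finset (Finset V)}
    (hF : ∀ A ∈ F, A ⊆ L ∧ A.Nonempty ∧ energy (kern H s) A * τ A ≤ energy (kern H s) L)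
    (hdis : ∀ A ∈ F, ∀ B ∈ F, A ≠ B → Disjoint A B)
    (hanti : ∀ A ∈ F, ∀ B ∈ F, A ≠ B → AnticompletePair H A B) : ∑ A ∈ F, τ A ≤ 1 := by
  rcases F.eq_empty_or_nonempty with rfl | hne
  · simp
  have hex : ∀ A : Finset V, ∃ μ : V → ℝ, A ∈ F →
      ProbOn A μ ∧ bil (kern H s) μ μ = energy (kern H s) A := by
    intro A
    by_cases hA : A ∈ F
    · obtain ⟨μ, h⟩ := exists_bil_eq_energy (kern H s) (hF A hA).2.1
      exact ⟨μ, fun _ => h⟩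
    · exact ⟨0, fun h => absurd h hA⟩
  choose f hf using hex
  have hApos : ∀ A ∈ F, 0 < energy (kern H s) A := fun A hA =>
    hpos.trans_le (energy_anti _ (hF A hA).2.1 (hF A hA).1)
  obtain ⟨μ, hμ, hsum⟩ := exists_mix_family hne hdis hanti (fun A hA => (hf A hA).1)
    (fun A hA => by rw [(hf A hA).2]; exact hApos A hA)
  have hle : energy (kern H s) L ≤ bil (kern H s) μ μ :=
    energy_le _ (hμ.mono (Finset.biUnion_subset.2 fun A hA => (hF A hA).1))
  rw [← hsum]
  refine le_trans ?_ (mul_le_mul_of_nonneg_right hle (Finset.sum_nonneg fun A hA => by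
    rw [(hf A hA).2]; exact (one_div_pos.2 (hApos A hA)).le))
  rw [Finset.mul_sum]
  refine Finset.sum_le_sum fun A hA => ?_
  rw [(hf A hA).2, mul_one_div, le_div_iff₀ (hApos A hA), mul_comm]
  exact (hF A hA).2.2

end Energy

theorem exists_crit {V : Type*} [Fintype V] {G : SimpleGraph V} {s K : ℝ} {p c : ℕ} (hp : 0 < p)
    (hs : 1 ≤ s) (hK : 32 ≤ K) (hV : K ^ (c + 3 * p) * s ≤ Fintype.card V)
    (h1 : ∀ μ, ProbOn (Finset.univ : Finset V) μ → 1 / K < bil (kern G s) μ μ)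
    (h2 : ∀ μ, ProbOn (Finset.univ : Finset V) μ → 1 / K < bil (kern Gᶜ s) μ μ) :
    ∃ L a τ, K ^ c * s ≤ L.card ∧ Crit G L s K a p τ := by
  have hK0 : 0 < K := by linarith
  have hK1 : 1 ≤ K := by linarith
  set E := energy (kern G s) with hE
  set E' := energy (kern Gᶜ s) with hE'
  have hne : ∀ A : Finset V, s ≤ A.card → A.Nonempty := fun A hA =>
    Finset.card_pos.1 (by
      have : (0 : ℝ) < A.card := by linarith
      exact_mod_cast this)
  have hEK : ∀ A : Finset V, s ≤ A.card → 1 / K < E A := by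
    intro A hA
    obtain ⟨μ, hμ, he⟩ := exists_bil_eq_energy (kern G s) (hne A hA)
    rw [hE, ← he]
    exact h1 μ (hμ.mono (Finset.subset_univ _))
  have hEK' : ∀ A : Finset V, s ≤ A.card → 1 / K < E' A := by
    intro A hA
    obtain ⟨μ, hμ, he⟩ := exists_bil_eq_energy (kern Gᶜ s) (hne A hA)
    rw [hE', ← he]
    exact h2 μ (hμ.mono (Finset.subset_univ _))
  have hKi : 0 < 1 / K := by positivity
  set Γ := K ^ c * s * 4 ^ p with hΓ
  set bad := (Finset.univ : Finset (Finset V)).filter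
    fun A => s ≤ A.card ∧ Γ < A.card * (E A * E' A) ^ p with hbad
  have huniv : (Finset.univ : Finset V) ∈ bad := by
    have hs1 : s ≤ (Finset.univ : Finset V).card := by
      rw [Finset.card_univ]
      refine le_trans ?_ hV
      exact le_mul_of_one_le_left (by linarith) (one_le_pow₀ hK1)
    refine Finset.mem_filter.2 ⟨Finset.mem_univ _, hs1, ?_⟩
    have hc0 : (0 : ℝ) < (Finset.univ : Finset V).card := by linarith
    have hlt : (1 / K * (1 / K)) ^ p < (E Finset.univ * E' Finset.univ) ^ p :=
      pow_lt_pow_left₀ (mul_lt_mul'' (hEK _ hs1) (hEK' _ hs1) hKi.le hKi.le) (by positivity) hp.ne'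
    refine lt_of_le_of_lt ?_ (mul_lt_mul_of_pos_left hlt hc0)
    rw [Finset.card_univ]
    calc Γ ≤ K ^ c * s * K ^ p := by
          rw [hΓ]
          gcongr
          linarith
      _ = K ^ (c + 3 * p) * s * (1 / K * (1 / K)) ^ p := by
          rw [mul_pow, one_div, inv_pow]
          field_simp
          ring
      _ ≤ _ := by gcongr
  obtain ⟨L, hLb, hmin⟩ := Finset.exists_min_image bad Finset.card ⟨_, huniv⟩
  obtain ⟨-, hsL, hΓL⟩ := Finset.mem_filter.1 hLb
  have hL0 := hne L hsL
  have hn : (0 : ℝ) < L.card := by linarith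
  have hEL := hKi.trans (hEK L hsL)
  have hEL' := hKi.trans (hEK' L hsL)
  set τ : Finset V → ℝ := fun A => ((A.card : ℝ) / L.card) ^ (1 / p : ℝ) with hτ
  have hτ0 : ∀ A, 0 ≤ τ A := fun A => by positivity
  have hτp : ∀ A : Finset V, τ A ^ p * L.card = A.card := by
    intro A
    rw [hτ]
    simp only
    rw [← Real.rpow_natCast, ← Real.rpow_mul (by positivity),
      one_div_mul_cancel (by exact_mod_cast hp.ne'), Real.rpow_one, div_mul_cancel₀ _ hn.ne']
  have key : ∀ A ⊆ L, s ≤ A.card → τ A * (E A * E' A) ≤ E L * E' L := by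
    intro A hA hsA
    have hEA := hKi.trans (hEK A hsA)
    have hEA' := hKi.trans (hEK' A hsA)
    rcases hA.eq_or_ssubset with rfl | hss
    · have : τ A = 1 := by
        rw [hτ]
        simp only
        rw [div_self hn.ne', Real.one_rpow]
      rw [this, one_mul]
    · have hnb : A ∉ bad := fun h => absurd (hmin A h) (not_le.2 (Finset.card_lt_card hss))
      have hle : (A.card : ℝ) * (E A * E' A) ^ p ≤ Γ := by
        by_contra hcon
        exact hnb (Finset.mem_filter.2 ⟨Finset.mem_univ _, hsA, not_le.1 hcon⟩)
      rw [← hτp A] at hle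
      have h3 : (τ A * (E A * E' A)) ^ p * L.card ≤ (E L * E' L) ^ p * L.card := by
        rw [mul_pow]
        linarith
      exact le_of_pow_le_pow_left₀ hp.ne' (by positivity) (le_of_mul_le_mul_right h3 hn)
  have hC : ∀ A ⊆ L, s ≤ A.card → E A * τ A ≤ E L := by
    intro A hA hsA
    have hEA' := hKi.trans (hEK' A hsA)
    refine le_of_mul_le_mul_right ?_ hEA'
    have h3 := key A hA hsA
    have h4 := mul_le_mul_of_nonneg_left (energy_anti (kern Gᶜ s) (hne A hsA) hA) hEL.le
    linarith
  have hC' : ∀ A ⊆ L, s ≤ A.card → E' A * τ A ≤ E' L := by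
    intro A hA hsA
    have hEA := hKi.trans (hEK A hsA)
    refine le_of_mul_le_mul_right ?_ hEA
    have h3 := key A hA hsA
    have h4 := mul_le_mul_of_nonneg_left (energy_anti (kern G s) (hne A hsA) hA) hEL'.le
    linarith
  refine ⟨L, E L, τ, ?_, ?_⟩
  · have h3 : (E L * E' L) ^ p ≤ 4 ^ p := by
      refine pow_le_pow_left₀ (by positivity) ?_ p
      have := energy_le_two G hL0 hsL
      have := energy_le_two Gᶜ hL0 hsL
      calc E L * E' L ≤ 2 * 2 := by gcongr
        _ = 4 := by norm_num
    have h4 : K ^ c * s * 4 ^ p ≤ L.card * 4 ^ p :=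
      hΓL.le.trans (mul_le_mul_of_nonneg_left h3 hn.le)
    exact le_of_mul_le_mul_right h4 (by positivity)
  · exact
      { s_pos := by linarith
        K_large := hK
        p_pos := hp
        tau_nonneg := hτ0
        tau_mono := fun A B hAB => by
          have := Finset.card_le_card hAB
          simp only [hτ]
          gcongr
        tau_pow := hτp
        card_pos := hL0.card_pos
        exists_prob := fun A hA hsA => by
          obtain ⟨μ, hμ, he⟩ := exists_bil_eq_energy (kern G s) (hne A hsA)
          exact ⟨μ, hμ, he ▸ hC A hA hsA⟩
        sum_anticomplete := fun F hF hdis hanti => by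
          exact sum_le_one_of_energy hEL
            (fun A hA => ⟨(hF A hA).1, hne A (hF A hA).2, hC A (hF A hA).1 (hF A hA).2⟩) hdis hanti
        sum_complete := fun F hF hdis hcomp => by
          refine sum_le_one_of_energy hEL'
            (fun A hA => ⟨(hF A hA).1, hne A (hF A hA).2, hC' A (hF A hA).1 (hF A hA).2⟩) hdis ?_
          intro A hA B hB hAB a ha b hb hadj
          exact ((SimpleGraph.compl_adj _ _ _).1 hadj).2 (hcomp A hA B hB hAB a ha b hb)
        le_energy := fun μ hμ => energy_le _ hμ
        lt_energy := hEK L hsL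
        lt_energy' := fun μ hμ => h2 μ (hμ.mono (Finset.subset_univ _)) }

theorem exists_low_energy : ∃ C : ℕ, ∀ (V : Type) [Fintype V] (G : SimpleGraph V) (s K : ℝ),
    Free P5ᶜ G → 1 ≤ s → 32 ≤ K → K ^ C * s ≤ Fintype.card V →
    ∃ μ, ProbOn (Finset.univ : Finset V) μ ∧
      (bil (kern G s) μ μ ≤ 1 / K ∨ bil (kern Gᶜ s) μ μ ≤ 1 / K) := by
  obtain ⟨p, hp, c, H⟩ := exists_crit_false
  refine ⟨c + 3 * p, ?_⟩
  intro V _ G s K hG hs hK hV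
  by_contra hcon
  push Not at hcon
  obtain ⟨L, a, τ, hL, hC⟩ := exists_crit hp hs hK hV (fun μ hμ => (hcon μ hμ).1)
    (fun μ hμ => (hcon μ hμ).2)
  exact H V G L s K a τ hG hs hL hC

end

/-- House-free graphs have the polynomial Rödl property. -/
theorem exists_restrictedOn : ∃ a : ℕ, 1 ≤ a ∧
    ∀ x : ℝ, 0 < x → x < 1 / 2 → ∀ (V : Type) [Fintype V] (G : SimpleGraph V), Free P5ᶜ G →
      ∃ S : Finset V, x ^ a * (Fintype.card V : ℝ) ≤ S.card ∧ RestrictedOn G S x := by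
  obtain ⟨C, H⟩ := exists_low_energy
  refine ⟨5 * C + 3, by omega, ?_⟩
  intro x hx hx2 V _ G hG
  have hx5 : x ^ 5 ≤ x / 16 := by
    have : x ^ 4 ≤ (1 / 2) ^ 4 := by gcongr
    calc x ^ 5 = x * x ^ 4 := by ring
      _ ≤ x * (1 / 2) ^ 4 := by gcongr
      _ = x / 16 := by ring
  have hxC : x ^ (5 * C) ≤ (x / 16) ^ C := by
    rw [pow_mul]
    gcongr
  have hx3 : x ^ 3 ≤ 1 / 8 := by
    calc x ^ 3 ≤ (1 / 2) ^ 3 := by gcongr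
      _ = 1 / 8 := by norm_num
  set N : ℝ := (Fintype.card V : ℝ) with hN
  have hN0 : 0 ≤ N := Nat.cast_nonneg _
  by_cases hbig : 1 ≤ (x / 16) ^ C * N
  · set s := ⌊(x / 16) ^ C * N⌋₊ with hs
    have hs1 : 1 ≤ s := Nat.le_floor (by simpa using hbig)
    have hs1' : (1 : ℝ) ≤ s := by exact_mod_cast hs1
    have hle : (s : ℝ) ≤ (x / 16) ^ C * N := Nat.floor_le (by positivity)
    have hge : (x / 16) ^ C * N < s + 1 := Nat.lt_floor_add_one _
    have hK : 32 ≤ 16 / x := by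
      rw [le_div_iff₀ hx]
      linarith
    have hcard : (16 / x) ^ C * s ≤ (Fintype.card V : ℝ) := by
      calc (16 / x) ^ C * s ≤ (16 / x) ^ C * ((x / 16) ^ C * N) := by gcongr
        _ = N := by
          rw [← mul_assoc, ← mul_pow]
          field_simp
          simp
    have hfin : x ^ (5 * C + 3) * N ≤ s / 4 := by
      calc x ^ (5 * C + 3) * N = x ^ (5 * C) * x ^ 3 * N := by rw [pow_add]
        _ ≤ (x / 16) ^ C * (1 / 8) * N := by gcongr
        _ ≤ s / 4 := by linarith
    have hx16 : 16 / (16 / x) = x := by field_simp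
    obtain ⟨μ, hμ, h | h⟩ := H V G s (16 / x) hG hs1' hK hcard
    · obtain ⟨T, hT, hsp⟩ := exists_sparse_of_bil_le hs1 (by linarith) hμ h
      rw [hx16] at hsp
      exact ⟨T, by linarith, Or.inl hsp⟩
    · obtain ⟨T, hT, hsp⟩ := exists_sparse_of_bil_le hs1 (by linarith) hμ h
      rw [hx16] at hsp
      exact ⟨T, by linarith, Or.inr hsp⟩
  · rcases isEmpty_or_nonempty V with hV | ⟨⟨v⟩⟩
    · refine ⟨∅, ?_, Or.inl fun v hv => absurd hv (Finset.notMem_empty v)⟩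
      simp [hN]
    · refine ⟨{v}, ?_, Or.inl fun u hu => ?_⟩
      · rw [Finset.card_singleton, Nat.cast_one]
        calc x ^ (5 * C + 3) * N = x ^ (5 * C) * x ^ 3 * N := by rw [pow_add]
          _ ≤ (x / 16) ^ C * 1 * N := by
            gcongr
            linarith
          _ ≤ 1 := by rw [mul_one]; exact (not_le.1 hbig).le
      · rw [Finset.mem_singleton.1 hu]
        simp [nbrsIn, Finset.filter_singleton, hx.le]

/-- every house-free graph has a large restricted induced subgraph or a
complete-or-anticomplete blockade of polynomial size. -/
theorem house_free_restricted_or_blockade :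
    ∃ a : ℝ, 1 ≤ a ∧
      ∀ x : ℝ, 0 < x → x < 1/2 →
        ∀ (V : Type) [Fintype V] (G : SimpleGraph V),
          Free P5ᶜ G →
          (∃ S : Finset V, x ^ a * (Fintype.card V : ℝ) ≤ (S.card : ℝ) ∧
            RestrictedOn G S x) ∨
          (∃ k : ℝ, 2 ≤ k ∧ k ≤ 1 / x ∧
            ∃ (n : ℕ) (B : Fin n → Finset V), IsBlockade B ∧ k ≤ (n : ℝ) ∧
              (∀ i, (Fintype.card V : ℝ) / k ^ a ≤ ((B i).card : ℝ)) ∧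
              (CompleteBlockade G B ∨ AnticompleteBlockade G B)) := by
  obtain ⟨a, ha, H⟩ := exists_restrictedOn
  refine ⟨a, by exact_mod_cast ha, fun x hx hx2 V _ G hG => Or.inl ?_⟩
  simpa only [Real.rpow_natCast] using H x hx hx2 V G hG
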